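/- Let n ≥ 2, let ℓ : (0,∞)×ℝ^{n-2} → [0,∞) be measurable with ℓ(r,x') ≤ 2πr for H^{n-1}-a.e. (r,x') such that F^ℓ is a set of finite perimeter and finite volume, and let Ω ⊂ (0,∞)×ℝ^{n-2} be open. Then the following are equivalent: (i) H^{n-1}({x ∈ ∂*F^ℓ ∩ Φ₁₂(Ω × S¹) : ν₁₂∥^{F^ℓ}(x) = 0}) = 0; (ii) ξ^ℓ ∈ W^{1,1}_loc(Ω) and ℓ ∈ W^{1,1}_loc(Ω); (iii) P(F^ℓ; Φ₁₂(B × S¹)) = 0 for every Borel set B ⊂ Ω with H^{n-1}(B) = 0. -/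

import Mathlib

/- Common definitions: geometric measure theory notions (density points, essential
boundary, perimeter, reduced boundary and measure-theoretic outer unit normal),
spherical and circular symmetrisation, BV and Sobolev-type notions. -/

open MeasureTheory Metric Set Filter
open scoped ENNReal NNReal Topology RealInnerProductSpace

noncomputable section

/-- Euclidean space `ℝⁿ`. -/
abbrev Euc (n : ℕ) : Type := EuclideanSpace ℝ (Fin n)

/-- `ω_k`: the volume of the unit ball of `ℝ^k`. -/
def omegaBall (k : ℕ) : ℝ := (volume (ball (0 : Euc k) 1)).toReal

/-- The radial unit vector `x̂ = x/|x|`. -/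
def hatv {n : ℕ} (x : Euc n) : Euc n := ‖x‖⁻¹ • x

/-- The first vector of the canonical basis. -/
def e1 (n : ℕ) (hn : 0 < n) : Euc n := EuclideanSpace.single ⟨0, hn⟩ 1

/-- `E` has `n`-dimensional density `t` at `x`. -/
def DensityAt {n : ℕ} (E : Set (Euc n)) (x : Euc n) (t : ℝ≥0∞) : Prop :=
  Tendsto (fun ρ : ℝ => volume (E ∩ ball x ρ) / volume (ball x ρ)) (𝓝[>] (0:ℝ)) (𝓝 t)

/-- The essential boundary `∂ᵉE`: points of density neither `0` nor `1`. -/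
def essBoundary {n : ℕ} (E : Set (Euc n)) : Set (Euc n) :=
  {x | ¬ DensityAt E x 0 ∧ ¬ DensityAt E x 1}

/-- The perimeter of `E` relative to `A`: `P(E;A) = H^{n-1}(∂ᵉE ∩ A)`. -/
def perim {n : ℕ} (E A : Set (Euc n)) : ℝ≥0∞ := μH[(n : ℝ) - 1] (essBoundary E ∩ A)

/-- `ν` is the measure-theoretic outer unit normal of `E` at `x`: the blow-up of `E`
at `x` is the half space `{y : (y-x)·ν ≤ 0}` in density. -/
def HasMTNormal {n : ℕ} (E : Set (Euc n)) (x ν : Euc n) : Prop :=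
  ‖ν‖ = 1 ∧
    Tendsto (fun ρ : ℝ =>
        volume ({y | y ∈ E ∧ 0 < ⟪y - x, ν⟫} ∩ ball x ρ) / volume (ball x ρ))
      (𝓝[>] (0:ℝ)) (𝓝 0) ∧
    Tendsto (fun ρ : ℝ =>
        volume ({y | y ∉ E ∧ ⟪y - x, ν⟫ < 0} ∩ ball x ρ) / volume (ball x ρ))
      (𝓝[>] (0:ℝ)) (𝓝 0)

/-- The reduced boundary `∂*E`. -/
def redBoundary {n : ℕ} (E : Set (Euc n)) : Set (Euc n) := {x | ∃ ν, HasMTNormal E x ν}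

/-- The measure-theoretic outer unit normal `ν^E`. -/
def mtNormal {n : ℕ} (E : Set (Euc n)) (x : Euc n) : Euc n :=
  haveI := Classical.propDecidable (∃ ν, HasMTNormal E x ν)
  if h : ∃ ν, HasMTNormal E x ν then h.choose else 0

/-- The tangential component `ν∥^E(x) = ν^E(x) - (ν^E(x)·x̂)x̂` of the normal along
the sphere `∂B(|x|)`. -/
def nuPar {n : ℕ} (E : Set (Euc n)) (x : Euc n) : Euc n :=
  mtNormal E x - ⟪mtNormal E x, hatv x⟫ • hatv x

/-- The open geodesic ball (spherical cap) `B_β(r p)` in the sphere `∂B(0,r)`. -/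
def capSet {n : ℕ} (p : Euc n) (r β : ℝ) : Set (Euc n) :=
  {x | x ∈ sphere (0 : Euc n) r ∧ Real.arccos ⟪hatv x, p⟫ < β}

/-- The geodesic sphere `S_β(r p)` in the sphere `∂B(0,r)`. -/
def capSphere {n : ℕ} (p : Euc n) (r β : ℝ) : Set (Euc n) :=
  {x | x ∈ sphere (0 : Euc n) r ∧ Real.arccos ⟪hatv x, p⟫ = β}

/-- `E ⊆ ℝⁿ` is spherically `v`-distributed: `H^{n-1}(E ∩ ∂B(0,r)) = v r` for a.e. `r > 0`. -/
def SphDistrib {n : ℕ} (v : ℝ → ℝ) (E : Set (Euc n)) : Prop :=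
  ∀ᵐ r ∂(volume.restrict (Ioi (0:ℝ))),
    μH[(n : ℝ) - 1] (E ∩ sphere (0 : Euc n) r) = ENNReal.ofReal (v r)

/-- The spherical symmetral `F_v` (determined by the angle function `α = α_v` and the
direction `p`). -/
def sphSymm (n : ℕ) (α : ℝ → ℝ) (p : Euc n) : Set (Euc n) :=
  {x : Euc n | x ≠ 0 ∧ Real.arccos ⟪hatv x, p⟫ < α ‖x‖}

/-- `Φ(B × S^{n-1})`, for `B ⊆ (0,∞)`. -/
def sphShell (n : ℕ) (B : Set ℝ) : Set (Euc n) := {x : Euc n | x ≠ 0 ∧ ‖x‖ ∈ B}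

/-- `v ∈ BV(0,∞)`: `v` is integrable on `(0,∞)` and has a representative of bounded
pointwise variation there. -/
def BVIoi (v : ℝ → ℝ) : Prop :=
  IntegrableOn v (Ioi (0:ℝ)) volume ∧
    ∃ w : ℝ → ℝ, (∀ᵐ r ∂(volume.restrict (Ioi (0:ℝ))), w r = v r) ∧
      BoundedVariationOn w (Ioi (0:ℝ))

/-- `f ∈ W^{1,1}_loc(I)` for `I ⊆ ℝ`: `f` has a representative `w` which is locally
absolutely continuous on `I`, i.e. `w b - w a = ∫_a^b g` with `g` locally integrable on `I`. -/
def W11locOn (f : ℝ → ℝ) (I : Set ℝ) : Prop :=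
  ∃ w g : ℝ → ℝ, (∀ᵐ r ∂(volume.restrict I), w r = f r) ∧
    LocallyIntegrableOn g I volume ∧
    ∀ a b : ℝ, uIcc a b ⊆ I → w b - w a = ∫ t in a..b, g t

/-- `S ⊆ ℝ` has one-dimensional density `0` at `x`. -/
def RDensity0 (S : Set ℝ) (x : ℝ) : Prop :=
  Tendsto (fun ρ : ℝ => volume (S ∩ ball x ρ) / volume (ball x ρ)) (𝓝[>] (0:ℝ)) (𝓝 0)

/-- The approximate upper limit `f^∨(x)` (for bounded `f`). -/
def apSup (f : ℝ → ℝ) (x : ℝ) : ℝ := sInf {t : ℝ | RDensity0 {y | t < f y} x}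

/-- The approximate lower limit `f^∧(x)` (for bounded `f`). -/
def apInf (f : ℝ → ℝ) (x : ℝ) : ℝ := sSup {t : ℝ | RDensity0 {y | f y < t} x}

/-- `t` is the approximate limit of `f` at `x` with respect to `A`. -/
def apLimOn (f : ℝ → ℝ) (A : Set ℝ) (x t : ℝ) : Prop :=
  ∀ ε : ℝ, 0 < ε → RDensity0 ({y | ε < |f y - t|} ∩ A) x

/-- Density (with value `t`) at `x` of a subset `A` of the sphere `∂B(0,r)`,
with respect to the measure `H^{n-1}` on the sphere. -/
def SphDensityAt {n : ℕ} (A : Set (Euc n)) (r : ℝ) (x : Euc n) (t : ℝ≥0∞) : Prop :=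
  Tendsto (fun ρ : ℝ =>
      μH[(n : ℝ) - 1] (A ∩ ball x ρ) / μH[(n : ℝ) - 1] (sphere (0 : Euc n) r ∩ ball x ρ))
    (𝓝[>] (0:ℝ)) (𝓝 t)

/-- The essential boundary, within the sphere `∂B(0,r)`, of a subset `A` of that sphere. -/
def sphEssBoundary {n : ℕ} (A : Set (Euc n)) (r : ℝ) : Set (Euc n) :=
  {x | x ∈ sphere (0 : Euc n) r ∧ ¬ SphDensityAt A r x 0 ∧ ¬ SphDensityAt A r x 1}

/-- A pair of mutually singular measures `(σp, σm)` supported in `(0,∞)`, locally finite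
there, representing the distributional derivative `Dξ = σp - σm` of `ξ` on `(0,∞)`. -/
def RepDeriv (ξ : ℝ → ℝ) (σp σm : Measure ℝ) : Prop :=
  σp (Iic (0:ℝ)) = 0 ∧ σm (Iic (0:ℝ)) = 0 ∧
    (∀ K : Set ℝ, K ⊆ Ioi (0:ℝ) → IsCompact K → σp K < ⊤ ∧ σm K < ⊤) ∧
    σp.MutuallySingular σm ∧
    ∀ φ : ℝ → ℝ, ContDiff ℝ 1 φ → HasCompactSupport φ → tsupport φ ⊆ Ioi (0:ℝ) →
      (∫ r in Ioi (0:ℝ), ξ r * deriv φ r) = (∫ r, φ r ∂σm) - ∫ r, φ r ∂σp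

/-- The density `ξ'` of the absolutely continuous part of `Dξ = σp - σm`. -/
def acDeriv (σp σm : Measure ℝ) (r : ℝ) : ℝ :=
  (σp.rnDeriv volume r).toReal - (σm.rnDeriv volume r).toReal

/-- `p_E(r) = H^{n-2}(∂*E ∩ ∂B(0,r))` (as a real number). -/
def pSlice {n : ℕ} (E : Set (Euc n)) (r : ℝ) : ℝ :=
  (μH[(n : ℝ) - 2] (redBoundary E ∩ sphere (0 : Euc n) r)).toReal

/-- The projection `x ↦ x₁₂` onto the plane of the first two coordinates. -/
def pr12 {n : ℕ} (hn : 2 ≤ n) (x : Euc n) : Euc 2 :=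
  (EuclideanSpace.equiv (Fin 2) ℝ).symm fun i => x ⟨i.1, lt_of_lt_of_le i.2 hn⟩

/-- The projection `x ↦ x'` onto the remaining `n - 2` coordinates. -/
def prC {n : ℕ} (hn : 2 ≤ n) (x : Euc n) : Euc (n - 2) :=
  (EuclideanSpace.equiv (Fin (n - 2)) ℝ).symm fun i => x ⟨i.1 + 2, by have := i.2; omega⟩

/-- The circle `∂B((0,x'),r) ∩ Π_{x'}`, for `p = (r, x')`. -/
def circFiber {n : ℕ} (hn : 2 ≤ n) (p : ℝ × Euc (n - 2)) : Set (Euc n) :=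
  {y : Euc n | prC hn y = p.2 ∧ ‖pr12 hn y‖ = p.1}

/-- The circular slice `E_{(r,x')}`, for `p = (r, x')`. -/
def cslice {n : ℕ} (hn : 2 ≤ n) (E : Set (Euc n)) (p : ℝ × Euc (n - 2)) : Set (Euc n) :=
  E ∩ circFiber hn p

/-- `E` is circularly `ℓ`-distributed. -/
def CircDistrib {n : ℕ} (hn : 2 ≤ n) (ℓ : ℝ × Euc (n - 2) → ℝ) (E : Set (Euc n)) : Prop :=
  ∀ᵐ p ∂(volume.restrict ((Ioi (0:ℝ)) ×ˢ (univ : Set (Euc (n - 2))))),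
    μH[(1:ℝ)] (cslice hn E p) = ENNReal.ofReal (ℓ p)

/-- The circular symmetral `F^ℓ`. -/
def circSymm {n : ℕ} (hn : 2 ≤ n) (ℓ : ℝ × Euc (n - 2) → ℝ) : Set (Euc n) :=
  {x : Euc n | pr12 hn x ≠ 0 ∧
    Real.arccos ⟪hatv (pr12 hn x), e1 2 (by norm_num)⟫
      < ℓ (‖pr12 hn x‖, prC hn x) / (2 * ‖pr12 hn x‖)}

/-- `Φ₁₂(B × S¹)`, for `B ⊆ (0,∞) × ℝ^{n-2}`. -/
def cylSet {n : ℕ} (hn : 2 ≤ n) (B : Set (ℝ × Euc (n - 2))) : Set (Euc n) :=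
  {x : Euc n | pr12 hn x ≠ 0 ∧ (‖pr12 hn x‖, prC hn x) ∈ B}

/-- The component `ν₁₂∥^E(x) = ν₁₂^E(x) - (ν^E(x)·x̂₁₂)x̂₁₂` of the normal. -/
def nu12par {n : ℕ} (hn : 2 ≤ n) (E : Set (Euc n)) (x : Euc n) : Euc 2 :=
  pr12 hn (mtNormal E x) - ⟪pr12 hn (mtNormal E x), hatv (pr12 hn x)⟫ • hatv (pr12 hn x)

/-- Density (with value `t`) at `x` of a subset `A` of the circle `circFiber hn p`,
with respect to the measure `H¹` on that circle. -/
def CircDensityAt {n : ℕ} (hn : 2 ≤ n) (A : Set (Euc n)) (p : ℝ × Euc (n - 2)) (x : Euc n)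
    (t : ℝ≥0∞) : Prop :=
  Tendsto (fun ρ : ℝ => μH[(1:ℝ)] (A ∩ ball x ρ) / μH[(1:ℝ)] (circFiber hn p ∩ ball x ρ))
    (𝓝[>] (0:ℝ)) (𝓝 t)

/-- The essential boundary, within the circle `circFiber hn p`, of a subset `A`. -/
def circEssBoundary {n : ℕ} (hn : 2 ≤ n) (A : Set (Euc n)) (p : ℝ × Euc (n - 2)) :
    Set (Euc n) :=
  {x | x ∈ circFiber hn p ∧ ¬ CircDensityAt hn A p x 0 ∧ ¬ CircDensityAt hn A p x 1}

/-- `f` has locally bounded variation on the open set `Ω`: on every open `U` compactly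
contained in `Ω` the distributional gradient of `f` has finite total variation. -/
def BVlocOn {W : Type*} [NormedAddCommGroup W] [NormedSpace ℝ W] [MeasureSpace W]
    (f : W → ℝ) (Ω : Set W) : Prop :=
  LocallyIntegrableOn f Ω volume ∧
    ∀ U : Set W, IsOpen U → IsCompact (closure U) → closure U ⊆ Ω →
      ∃ C : ℝ, ∀ g : W → W, ContDiff ℝ 1 g → HasCompactSupport g → tsupport g ⊆ U →
        (∀ x, ‖g x‖ ≤ 1) →
        (∫ x in U, f x * LinearMap.trace ℝ W (fderiv ℝ g x).toLinearMap) ≤ C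

/-- `f ∈ W^{1,1}_loc(Ω)` for `Ω ⊆ (0,∞) × ℝ^m`: `f` has a locally integrable weak
gradient `(g1, g2)` on `Ω`. -/
def W11locProd {m : ℕ} (f : ℝ × Euc m → ℝ) (Ω : Set (ℝ × Euc m)) : Prop :=
  ∃ (g1 : ℝ × Euc m → ℝ) (g2 : ℝ × Euc m → Euc m),
    LocallyIntegrableOn f Ω volume ∧ LocallyIntegrableOn g1 Ω volume ∧
      LocallyIntegrableOn g2 Ω volume ∧
      ∀ φ : ℝ × Euc m → ℝ, ContDiff ℝ 1 φ → HasCompactSupport φ → tsupport φ ⊆ Ω →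
        ∀ y : ℝ × Euc m,
          (∫ x in Ω, f x * fderiv ℝ φ x y) = -∫ x in Ω, φ x * (g1 x * y.1 + ⟪g2 x, y.2⟫)

/-- A pair of mutually singular measures `(σp, σm)` supported in `Ω₀ = (0,∞) × ℝ^m`,
locally finite there, representing the partial distributional derivative
`D_r ξ = σp - σm` of `ξ` in the radial variable. -/
def RepDerivR {m : ℕ} (ξ : ℝ × Euc m → ℝ) (σp σm : Measure (ℝ × Euc m)) : Prop :=
  σp ((Ioi (0:ℝ)) ×ˢ (univ : Set (Euc m)))ᶜ = 0 ∧
    σm ((Ioi (0:ℝ)) ×ˢ (univ : Set (Euc m)))ᶜ = 0 ∧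
    (∀ K : Set (ℝ × Euc m), K ⊆ (Ioi (0:ℝ)) ×ˢ univ → IsCompact K → σp K < ⊤ ∧ σm K < ⊤) ∧
    σp.MutuallySingular σm ∧
    ∀ φ : ℝ × Euc m → ℝ, ContDiff ℝ 1 φ → HasCompactSupport φ →
      tsupport φ ⊆ (Ioi (0:ℝ)) ×ˢ (univ : Set (Euc m)) →
      (∫ x in (Ioi (0:ℝ)) ×ˢ (univ : Set (Euc m)), ξ x * fderiv ℝ φ x ((1:ℝ), (0 : Euc m)))
        = (∫ x, φ x ∂σm) - ∫ x, φ x ∂σp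

/-- A polar representation `(τ, h)` (with `‖h‖ = 1` `τ`-a.e.) of the distributional
gradient `D_{x'} f = h τ` of `f` in the `x'` variables, on `Ω₀ = (0,∞) × ℝ^m`. -/
def RepDerivX {m : ℕ} (f : ℝ × Euc m → ℝ) (τ : Measure (ℝ × Euc m))
    (h : ℝ × Euc m → Euc m) : Prop :=
  τ ((Ioi (0:ℝ)) ×ˢ (univ : Set (Euc m)))ᶜ = 0 ∧
    (∀ K : Set (ℝ × Euc m), K ⊆ (Ioi (0:ℝ)) ×ˢ univ → IsCompact K → τ K < ⊤) ∧
    (∀ᵐ x ∂τ, ‖h x‖ = 1) ∧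
    ∀ φ : ℝ × Euc m → ℝ, ContDiff ℝ 1 φ → HasCompactSupport φ →
      tsupport φ ⊆ (Ioi (0:ℝ)) ×ˢ (univ : Set (Euc m)) →
      ∀ y : Euc m,
        (∫ x in (Ioi (0:ℝ)) ×ˢ (univ : Set (Euc m)), f x * fderiv ℝ φ x ((0:ℝ), y))
          = -∫ x, φ x * ⟪h x, y⟫ ∂τ

/-- The barycentre function `b_E(r) = r^{1-n} ∫_{E_r} x̂ dH^{n-1}`. -/
def bary (n : ℕ) (E : Set (Euc n)) (r : ℝ) : Euc n :=
  (r ^ (n - 1))⁻¹ • ∫ x in E ∩ sphere (0 : Euc n) r, hatv x ∂μH[(n : ℝ) - 1]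

/-- The average direction `d_E(r)` of the slice `E_r`. -/
def avgDir (n : ℕ) (α : ℝ → ℝ) (E : Set (Euc n)) (r : ℝ) : Euc n :=
  (omegaBall (n - 1) * Real.sin (α r) ^ (n - 1) * r ^ (n - 1))⁻¹ •
    ∫ x in E ∩ sphere (0 : Euc n) r, hatv x ∂μH[(n : ℝ) - 1]

end

set_option linter.unusedSectionVars false
set_option linter.unusedVariables false
set_option linter.style.haveILetI false

section Generic

open Module

/-- density zero, quantitative form -/
def D0 {V : Type*} [NormedAddCommGroup V] [NormedSpace ℝ V] [MeasurableSpace V]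
    (μ : Measure V) (A : Set V) (x : V) : Prop :=
  ∀ ε : ℝ, 0 < ε → ∃ r : ℝ, 0 < r ∧ ∀ ρ : ℝ, 0 < ρ → ρ < r →
    μ.real (A ∩ ball x ρ) ≤ ε * ρ ^ (finrank ℝ V)

variable {V : Type*} [NormedAddCommGroup V] [NormedSpace ℝ V] [FiniteDimensional ℝ V]
  [MeasurableSpace V] [BorelSpace V] (μ : Measure V) [μ.IsAddHaarMeasure]

lemma real_ball_eq (x : V) {ρ : ℝ} (hρ : 0 < ρ) :
    μ.real (ball x ρ) = ρ ^ (finrank ℝ V) * μ.real (ball (0:V) 1) := by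
  simp only [measureReal_def]
  rw [Measure.addHaar_ball_of_pos μ x hρ, ENNReal.toReal_mul, ENNReal.toReal_ofReal (by positivity)]

lemma real_closedBall_eq (x : V) {ρ : ℝ} (hρ : 0 ≤ ρ) :
    μ.real (closedBall x ρ) = ρ ^ (finrank ℝ V) * μ.real (ball (0:V) 1) := by
  simp only [measureReal_def]
  rw [Measure.addHaar_closedBall μ x hρ, ENNReal.toReal_mul, ENNReal.toReal_ofReal (by positivity)]

lemma real_unit_pos : 0 < μ.real (ball (0:V) 1) := by
  rw [measureReal_def, ENNReal.toReal_pos_iff]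
  exact ⟨measure_ball_pos μ 0 one_pos, measure_ball_lt_top⟩

lemma fin_inter_ball (A : Set V) (x : V) (ρ : ℝ) : μ (A ∩ ball x ρ) ≠ ⊤ :=
  ((measure_mono inter_subset_right).trans_lt measure_ball_lt_top).ne

lemma fin_inter_closedBall (A : Set V) (x : V) (ρ : ℝ) : μ (A ∩ closedBall x ρ) ≠ ⊤ :=
  ((measure_mono inter_subset_right).trans_lt measure_closedBall_lt_top).ne

variable {μ}

lemma D0.mono {A B : Set V} {x : V} (h : D0 μ B x) (hAB : A ⊆ B) : D0 μ A x := by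
  intro ε hε
  obtain ⟨r, hr, H⟩ := h ε hε
  refine ⟨r, hr, fun ρ h1 h2 => le_trans ?_ (H ρ h1 h2)⟩
  exact measureReal_mono (inter_subset_inter_left _ hAB) (fin_inter_ball μ _ _ _)

lemma D0.union {A B : Set V} {x : V} (hA : D0 μ A x) (hB : D0 μ B x) : D0 μ (A ∪ B) x := by
  intro ε hε
  obtain ⟨r, hr, H⟩ := hA (ε/2) (half_pos hε)
  obtain ⟨r', hr', H'⟩ := hB (ε/2) (half_pos hε)
  refine ⟨min r r', lt_min hr hr', fun ρ h1 h2 => ?_⟩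
  rw [union_inter_distrib_right]
  refine (measureReal_union_le _ _).trans ?_
  have := H ρ h1 (h2.trans_le (min_le_left _ _))
  have := H' ρ h1 (h2.trans_le (min_le_right _ _))
  linarith

lemma not_D0_univ (x : V) : ¬ D0 μ univ x := by
  intro h
  obtain ⟨r, hr, H⟩ := h (μ.real (ball (0:V) 1) / 2) (half_pos (real_unit_pos μ))
  have := H (r/2) (half_pos hr) (by linarith)
  rw [univ_inter, real_ball_eq μ x (half_pos hr)] at this
  have h1 := real_unit_pos μ
  have h2 : 0 < (r/2) ^ (finrank ℝ V) := by positivity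
  nlinarith [mul_pos h1 h2]

lemma not_D0_both {A : Set V} {x : V} (h : D0 μ A x) (h' : D0 μ Aᶜ x) : False := by
  have := h.union h'
  rw [union_compl_self] at this
  exact not_D0_univ x this

lemma D0_iff_tendsto {A : Set V} {x : V} :
    D0 μ A x ↔ Tendsto (fun ρ : ℝ => μ (A ∩ ball x ρ) / μ (ball x ρ)) (𝓝[>] (0:ℝ)) (𝓝 0) := by
  have hb := real_unit_pos μ
  have key : ∀ ρ : ℝ, 0 < ρ → (μ (A ∩ ball x ρ) / μ (ball x ρ)) =
      ENNReal.ofReal (μ.real (A ∩ ball x ρ) / (ρ ^ (finrank ℝ V) * μ.real (ball (0:V) 1))) := by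
    intro ρ hρ
    rw [← real_ball_eq μ x hρ, measureReal_def, measureReal_def,
      ENNReal.ofReal_div_of_pos (ENNReal.toReal_pos (measure_ball_pos μ x hρ).ne' measure_ball_lt_top.ne),
      ENNReal.ofReal_toReal (fin_inter_ball μ _ _ _), ENNReal.ofReal_toReal measure_ball_lt_top.ne]
  rw [ENNReal.tendsto_nhds_zero]
  constructor
  · intro h ε hε
    by_cases hεt : ε = ⊤
    · simp [hεt]
    have hε' : 0 < ε.toReal := ENNReal.toReal_pos hε.ne' hεt
    obtain ⟨r, hr, H⟩ := h (ε.toReal * μ.real (ball (0:V) 1)) (by positivity)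
    filter_upwards [Ioo_mem_nhdsGT hr] with ρ hρ
    rw [key ρ hρ.1]
    apply ENNReal.ofReal_le_of_le_toReal
    have : 0 < ρ := hρ.1
    rw [div_le_iff₀ (by positivity)]
    have := H ρ hρ.1 hρ.2
    linarith
  · intro h ε hε
    have := h (ENNReal.ofReal (ε / μ.real (ball (0:V) 1))) (by simp; positivity)
    rw [eventually_nhdsWithin_iff, Metric.eventually_nhds_iff] at this
    obtain ⟨r, hr, H⟩ := this
    refine ⟨r, hr, fun ρ h1 h2 => ?_⟩
    have h3 := H (y := ρ) (by simpa [abs_of_pos h1] using h2) h1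
    rw [key ρ h1, ENNReal.ofReal_le_ofReal_iff (by positivity), div_le_iff₀ (by positivity)] at h3
    refine h3.trans (le_of_eq ?_)
    field_simp

/-- closed ball version -/
lemma D0.closedBall {A : Set V} {x : V} (h : D0 μ A x) (ε : ℝ) (hε : 0 < ε) :
    ∃ r : ℝ, 0 < r ∧ ∀ ρ : ℝ, 0 < ρ → ρ < r →
    μ.real (A ∩ Metric.closedBall x ρ) ≤ ε * ρ ^ (finrank ℝ V) := by
  obtain ⟨r, hr, H⟩ := h (ε / 2 ^ (finrank ℝ V)) (by positivity)
  refine ⟨r/2, half_pos hr, fun ρ h1 h2 => ?_⟩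
  have := H (2*ρ) (by linarith) (by linarith)
  refine (measureReal_mono (inter_subset_inter_right _ (closedBall_subset_ball (by linarith : ρ < 2 * ρ)))
    (fin_inter_ball μ _ _ _)).trans (this.trans (le_of_eq ?_))
  rw [mul_pow]; field_simp

lemma D0_of_tendsto_closedBall {A : Set V} {x : V}
    (h : Tendsto (fun ρ : ℝ => μ (A ∩ Metric.closedBall x ρ) / μ (Metric.closedBall x ρ))
      (𝓝[>] (0:ℝ)) (𝓝 0)) : D0 μ A x := by
  rw [D0_iff_tendsto]
  refine tendsto_of_tendsto_of_tendsto_of_le_of_le' tendsto_const_nhds h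
    (Eventually.of_forall fun _ => zero_le) ?_
  filter_upwards [self_mem_nhdsWithin] with ρ hρ
  have hρ' : 0 < ρ := hρ
  rw [show μ (Metric.closedBall x ρ) = μ (ball x ρ) from by
    rw [Measure.addHaar_closedBall μ x hρ'.le, Measure.addHaar_ball_of_pos μ x hρ']]
  gcongr
  exact ball_subset_closedBall

variable (μ)

lemma ae_D0 {A : Set V} (hA : MeasurableSet A) :
    ∀ᵐ x ∂μ, (x ∈ A → D0 μ Aᶜ x) ∧ (x ∉ A → D0 μ A x) := by
  filter_upwards [Besicovitch.ae_tendsto_measure_inter_div_of_measurableSet μ hA,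
    Besicovitch.ae_tendsto_measure_inter_div_of_measurableSet μ hA.compl] with x h1 h2
  constructor
  · intro hx
    apply D0_of_tendsto_closedBall
    simpa [hx] using h2
  · intro hx
    apply D0_of_tendsto_closedBall
    simpa [hx] using h1

/-- `μ (A ∩ ball x ρ) ≤ c` is a closed condition in `x`. -/
lemma isClosed_ball_le (A : Set V) (ρ c : ℝ) :
    IsClosed {x : V | μ.real (A ∩ ball x ρ) ≤ c} := by
  rw [← isOpen_compl_iff, Metric.isOpen_iff]
  intro x hx
  simp only [mem_compl_iff, Set.mem_ofPred_eq, not_le] at hx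
  have hu : A ∩ ball x ρ = ⋃ k : ℕ, A ∩ ball x (ρ - 1/((k:ℝ)+1)) := by
    rw [← inter_iUnion]
    congr 1
    ext z
    simp only [mem_ball, mem_iUnion]
    constructor
    · intro h
      obtain ⟨k, hk⟩ := exists_nat_one_div_lt (sub_pos.2 h)
      exact ⟨k, by linarith⟩
    · rintro ⟨k, hk⟩
      have : 0 < 1/((k:ℝ)+1) := by positivity
      linarith
  have hmono : Monotone fun k : ℕ => A ∩ ball x (ρ - 1/((k:ℝ)+1)) := by
    intro i j hij
    refine inter_subset_inter_right _ (ball_subset_ball ?_)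
    have : 1/((j:ℝ)+1) ≤ 1/((i:ℝ)+1) := by
      apply one_div_le_one_div_of_le (by positivity)
      have : (i:ℝ) ≤ j := by exact_mod_cast hij
      linarith
    linarith
  have ht := tendsto_measure_iUnion_atTop (μ := μ) hmono
  rw [← hu] at ht
  have ht' := (ENNReal.tendsto_toReal (fin_inter_ball μ A x ρ)).comp ht
  obtain ⟨k, hk⟩ := (ht'.eventually (lt_mem_nhds hx)).exists
  refine ⟨1/((k:ℝ)+1), by positivity, fun z hz => ?_⟩
  simp only [mem_compl_iff, Set.mem_ofPred_eq, not_le]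
  refine lt_of_lt_of_le hk ?_
  refine measureReal_mono (inter_subset_inter_right _ ?_) (fin_inter_ball μ _ _ _)
  apply ball_subset_ball'
  rw [dist_comm]
  have := mem_ball.1 hz
  linarith


/-- `D0` is invariant under linear equivalences. -/
lemma D0.map_equiv {V' : Type*} [NormedAddCommGroup V'] [NormedSpace ℝ V'] [FiniteDimensional ℝ V']
    [MeasurableSpace V'] [BorelSpace V'] (μ' : Measure V') [μ'.IsAddHaarMeasure]
    (e : V ≃L[ℝ] V') {A : Set V} {x : V} (h : D0 μ A x) : D0 μ' (e.symm ⁻¹' A) (e x) := by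
  haveI : (Measure.map e μ).IsAddHaarMeasure := e.isAddHaarMeasure_map μ
  obtain ⟨c, hc⟩ : ∃ c : ℝ≥0, μ' = c • Measure.map e μ :=
    ⟨_, Measure.isAddLeftInvariant_eq_smul _ _⟩
  set K : ℝ := ‖(e.symm : V' →L[ℝ] V)‖ + 1 with hK
  have hK0 : 0 < K := by positivity
  have hfin : finrank ℝ V' = finrank ℝ V := e.symm.toLinearEquiv.finrank_eq
  intro ε hε
  obtain ⟨r, hr, H⟩ := h (ε / ((c + 1) * K ^ finrank ℝ V)) (by positivity)
  refine ⟨r / K, by positivity, fun ρ h1 h2 => ?_⟩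
  have h3 := H (K * ρ) (by positivity) (by rwa [lt_div_iff₀ hK0, mul_comm] at h2)
  have hmap : ∀ S : Set V', (Measure.map e μ) S = μ (e ⁻¹' S) := fun S =>
    (e.toHomeomorph.toMeasurableEquiv).map_apply S
  have h4 : μ'.real (e.symm ⁻¹' A ∩ ball (e x) ρ) ≤ c * μ.real (A ∩ ball x (K * ρ)) := by
    have : μ'.real (e.symm ⁻¹' A ∩ ball (e x) ρ) = c * μ.real (e ⁻¹' (e.symm ⁻¹' A ∩ ball (e x) ρ)) := by
      rw [hc, measureReal_def, measureReal_def, Measure.smul_apply, hmap]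
      simp [ENNReal.smul_def]
    rw [this]
    gcongr
    · exact fin_inter_ball μ _ _ _
    · intro z hz
      simp only [mem_preimage, mem_inter_iff, mem_ball] at hz ⊢
      refine ⟨by simpa using hz.1, ?_⟩
      have : dist z x ≤ K * dist (e z) (e x) := by
        rw [dist_eq_norm, dist_eq_norm, ← map_sub]
        have := (e.symm : V' →L[ℝ] V).le_opNorm (e (z - x))
        simp only [ContinuousLinearEquiv.coe_coe, ContinuousLinearEquiv.symm_apply_apply] at this
        refine this.trans ?_
        gcongr
        rw [hK]; linarith
      exact this.trans_lt (by gcongr; exact hz.2)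
  refine h4.trans ?_
  have : (c:ℝ) * μ.real (A ∩ ball x (K * ρ)) ≤ c * (ε / ((c + 1) * K ^ finrank ℝ V) * (K * ρ) ^ finrank ℝ V) := by
    gcongr
  refine this.trans ?_
  rw [hfin, mul_pow]
  have e1 : (c:ℝ) * (ε / ((c + 1) * K ^ finrank ℝ V) * (K ^ finrank ℝ V * ρ ^ finrank ℝ V))
     = (c / (c+1)) * (ε * ρ ^ finrank ℝ V) := by field_simp
  rw [e1]
  have : (c:ℝ) / (c+1) ≤ 1 := by rw [div_le_one (by positivity)]; linarith
  have h5 : 0 ≤ ε * ρ ^ finrank ℝ V := by positivity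
  nlinarith

end Generic


section Topo

/-- connectedness: between an `I` point and an `O` point there is a common accumulation point. -/
lemma conn_aux {I O : Set ℝ} {a b i o : ℝ} (hcov : Icc a b ⊆ I ∪ O)
    (hi : i ∈ Icc a b) (ho : o ∈ Icc a b) (hiI : i ∈ I) (hoO : o ∈ O) :
    ∃ z ∈ uIcc i o, z ∈ closure (I ∩ Icc a b) ∩ closure (O ∩ Icc a b) := by
  have hsub : uIcc i o ⊆ Icc a b := uIcc_subset_Icc hi ho
  have hp : IsPreconnected (uIcc i o) := isPreconnected_uIcc
  rw [isPreconnected_closed_iff] at hp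
  obtain ⟨z, hz1, hz2⟩ := hp (closure (I ∩ Icc a b)) (closure (O ∩ Icc a b)) isClosed_closure isClosed_closure
    (by
      intro z hz
      rcases hcov (hsub hz) with h | h
      · exact Or.inl (subset_closure ⟨h, hsub hz⟩)
      · exact Or.inr (subset_closure ⟨h, hsub hz⟩))
    ⟨i, left_mem_uIcc, subset_closure ⟨hiI, hi⟩⟩ ⟨o, right_mem_uIcc, subset_closure ⟨hoO, ho⟩⟩
  exact ⟨z, hz1, hz2⟩

lemma topo_aux {I O G : Set ℝ} {a b z δ : ℝ} (hcov : Icc a b ⊆ I ∪ O)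
    (hz : z ∈ closure (I ∩ Icc a b) ∩ closure (O ∩ Icc a b)) (hδ : 0 < δ)
    (hsub : ∀ s, |s - z| < δ → s ∈ closure (I ∩ Icc a b) ∩ closure (O ∩ Icc a b) → s ∈ G)
    (hGO : Disjoint G O)
    (hR : ∀ s ∈ G, ∀ η, 0 < η → ¬ ∀ t ∈ Ioo 0 η, s + t ∈ O)
    (hL : ∀ s ∈ G, ∀ η, 0 < η → ¬ ∀ t ∈ Ioo 0 η, s - t ∈ O) : False := by
  set C := closure (I ∩ Icc a b) ∩ closure (O ∩ Icc a b) with hC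
  have hCc : IsClosed C := isClosed_closure.inter isClosed_closure
  have hCsub : C ⊆ Icc a b := fun s hs =>
    (closure_minimal inter_subset_right isClosed_Icc : closure (I ∩ Icc a b) ⊆ Icc a b) hs.1
  obtain ⟨o, ⟨hoO, ho⟩, hoz⟩ := Metric.mem_closure_iff.1 hz.2 δ hδ
  rw [dist_comm, Real.dist_eq] at hoz
  have hoG : o ∉ G := fun h => hGO.le_bot ⟨h, hoO⟩
  have hoC : o ∉ C := fun h => hoG (hsub o hoz h)
  have hzC := hCsub hz
  rcases lt_trichotomy z o with hlt | heq | hgt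
  · -- right side
    have hcomp : IsCompact (C ∩ Icc z o) := isCompact_Icc.inter_left hCc
    obtain ⟨s, hs, hmax⟩ := hcomp.exists_isGreatest ⟨z, hz, left_mem_Icc.2 hlt.le⟩
    have hso : s < o := lt_of_le_of_ne hs.2.2 (fun h => hoC (h ▸ hs.1))
    have hzs := hs.2.1
    have hsG : s ∈ G := hsub s (by rw [abs_of_nonneg (by linarith)]; rw [abs_of_pos (by linarith)] at hoz; linarith) hs.1
    refine hR s hsG (o - s) (by linarith) fun t ht => ?_
    have hm : s + t ∈ Icc a b := ⟨by linarith [ht.1, hzC.1], by linarith [ht.2, ho.2]⟩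
    rcases hcov hm with h | h
    · exfalso
      obtain ⟨y, hy, hyC⟩ := conn_aux hcov hm ho h hoO
      rw [uIcc_of_le (by linarith [ht.2])] at hy
      have := hmax ⟨hyC, by linarith [hy.1, ht.1], hy.2⟩
      linarith [hy.1, ht.1]
    · exact h
  · exact hoC (heq ▸ hz)
  · have hcomp : IsCompact (C ∩ Icc o z) := isCompact_Icc.inter_left hCc
    obtain ⟨s, hs, hmin⟩ := hcomp.exists_isLeast ⟨z, hz, right_mem_Icc.2 hgt.le⟩
    have hso : o < s := lt_of_le_of_ne hs.2.1 (fun h => hoC (h ▸ hs.1))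
    have hzs := hs.2.2
    have hsG : s ∈ G := hsub s (by rw [abs_of_nonpos (by linarith)]; rw [abs_of_neg (by linarith)] at hoz; linarith) hs.1
    refine hL s hsG (s - o) (by linarith) fun t ht => ?_
    have hm : s - t ∈ Icc a b := ⟨by linarith [ht.2, ho.1], by linarith [ht.1, hzC.2]⟩
    rcases hcov hm with h | h
    · exfalso
      obtain ⟨y, hy, hyC⟩ := conn_aux hcov hm ho h hoO
      rw [uIcc_of_ge (by linarith [ht.2])] at hy
      have := hmin ⟨hyC, hy.1, by linarith [hy.2, ht.1]⟩
      linarith [hy.2, ht.1]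
    · exact h

lemma topo_main {I O : Set ℝ} {G H : ℕ → Set ℝ} {a b : ℝ} (hcov : Icc a b ⊆ I ∪ O)
    (hGc : ∀ k, IsClosed (G k)) (hHc : ∀ k, IsClosed (H k))
    (hIG : I ⊆ ⋃ k, G k) (hOH : O ⊆ ⋃ k, H k)
    (hGO : ∀ k, Disjoint (G k) O) (hHI : ∀ k, Disjoint (H k) I)
    (hR : ∀ k, ∀ s ∈ G k, ∀ η, 0 < η → ¬ ∀ t ∈ Ioo 0 η, s + t ∈ O)
    (hL : ∀ k, ∀ s ∈ G k, ∀ η, 0 < η → ¬ ∀ t ∈ Ioo 0 η, s - t ∈ O)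
    (hR' : ∀ k, ∀ s ∈ H k, ∀ η, 0 < η → ¬ ∀ t ∈ Ioo 0 η, s + t ∈ I)
    (hL' : ∀ k, ∀ s ∈ H k, ∀ η, 0 < η → ¬ ∀ t ∈ Ioo 0 η, s - t ∈ I) :
    Icc a b ⊆ I ∨ Icc a b ⊆ O := by
  by_contra hcon
  push Not at hcon
  obtain ⟨⟨o, ho, hoI⟩, ⟨i, hi, hiO⟩⟩ : (∃ o ∈ Icc a b, o ∉ I) ∧ (∃ i ∈ Icc a b, i ∉ O) := by
    simpa [not_subset] using hcon
  have hoO : o ∈ O := (hcov ho).resolve_left hoI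
  have hiI : i ∈ I := (hcov hi).resolve_right hiO
  obtain ⟨z0, -, hz0⟩ := conn_aux hcov hi ho hiI hoO
  set C := closure (I ∩ Icc a b) ∩ closure (O ∩ Icc a b) with hC
  have hCc : IsClosed C := isClosed_closure.inter isClosed_closure
  have hCsub : C ⊆ Icc a b := fun s hs =>
    (closure_minimal inter_subset_right isClosed_Icc : closure (I ∩ Icc a b) ⊆ Icc a b) hs.1
  haveI : CompleteSpace C := hCc.completeSpace_coe
  haveI : Nonempty C := ⟨⟨z0, hz0⟩⟩
  let f : ℕ ⊕ ℕ → Set C := Sum.elim (fun k => (↑) ⁻¹' (G k)) (fun k => (↑) ⁻¹' (H k))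
  obtain ⟨j, hj⟩ := nonempty_interior_of_iUnion_of_closed (f := f)
    (by
      rintro (k | k)
      · exact (hGc k).preimage continuous_subtype_val
      · exact (hHc k).preimage continuous_subtype_val)
    (by
      rw [eq_univ_iff_forall]
      rintro ⟨z, hz⟩
      rcases hcov (hCsub hz) with h | h
      · obtain ⟨k, hk⟩ := mem_iUnion.1 (hIG h)
        exact mem_iUnion.2 ⟨Sum.inl k, hk⟩
      · obtain ⟨k, hk⟩ := mem_iUnion.1 (hOH h)
        exact mem_iUnion.2 ⟨Sum.inr k, hk⟩)
  obtain ⟨⟨z, hz⟩, hzj⟩ := hj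
  rw [mem_interior_iff_mem_nhds, Metric.mem_nhds_iff] at hzj
  obtain ⟨δ, hδ, hsub⟩ := hzj
  have hsub' : ∀ s, |s - z| < δ → ∀ hs : s ∈ C, (⟨s, hs⟩ : C) ∈ f j := fun s hs hsC =>
    hsub (by simpa [Subtype.dist_eq, Real.dist_eq] using hs)
  rcases j with k | k
  · exact topo_aux hcov hz hδ (fun s h1 h2 => hsub' s h1 h2) (hGO k) (hR k) (hL k)
  · rw [union_comm] at hcov
    refine topo_aux (I := O) (O := I) hcov (by rw [inter_comm]; exact hz) hδ (fun s h1 h2 => hsub' s h1 (by rw [hC, inter_comm]; exact h2)) (hHI k) (hR' k) (hL' k)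

end Topo


section Lines

open Module

variable {H : Type*} [NormedAddCommGroup H] [NormedSpace ℝ H] [FiniteDimensional ℝ H]
  [MeasurableSpace H] [BorelSpace H] (ν : Measure H) [ν.IsAddHaarMeasure]

/-- Haar measure on `ℝ × H`. -/
noncomputable abbrev muX : Measure (ℝ × H) := (volume : Measure ℝ).prod ν

lemma finrank_prodR : finrank ℝ (ℝ × H) = finrank ℝ H + 1 := by
  rw [Module.finrank_prod, Module.finrank_self, add_comm]

/-- a.e. line: `E` agrees with its density set -/
lemma ae_line_D0 {E : Set (ℝ × H)} (hE : MeasurableSet E) :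
    ∀ᵐ y ∂ν, ∀ᵐ s ∂(volume : Measure ℝ), ((s, y) ∈ E → D0 (muX ν) Eᶜ (s, y)) ∧
      ((s, y) ∉ E → D0 (muX ν) E (s, y)) := by
  have h := ae_D0 (muX ν) hE
  have h2 : ∀ᵐ z ∂(ν.prod (volume : Measure ℝ)), (z.swap ∈ E → D0 (muX ν) Eᶜ z.swap) ∧
      (z.swap ∉ E → D0 (muX ν) E z.swap) := by
    have := (Measure.measurePreserving_swap (μ := ν) (ν := (volume : Measure ℝ))).quasiMeasurePreserving
    exact this.ae h
  exact Measure.ae_ae_of_ae_prod h2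

/-- uniform smallness of the complement -/
def Qd (ν : Measure H) (ε : ℝ) (E : Set (ℝ × H)) (r0 : ℝ) (x : ℝ × H) : Prop :=
  ∀ ρ, 0 < ρ → ρ < r0 → (muX ν).real (Eᶜ ∩ ball x ρ) ≤ ε * ρ ^ (finrank ℝ H + 1)

lemma nullZ {E : Set (ℝ × H)} (hE : MeasurableSet E) {ε r0 η c : ℝ} (hr0 : 0 < r0) (hη : 0 < η)
    (hε : ε * 3 ^ (finrank ℝ H + 1) ≤ ν.real (ball (0:H) 1) / 4) :
    ν {y | ∃ s ∈ Icc c (c + η / 4), Qd ν ε E r0 (s, y) ∧ ∀ t ∈ Ioo 0 η, D0 (muX ν) E (s + t, y)} = 0 := by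
  set A := {y | ∃ s ∈ Icc c (c + η / 4), Qd ν ε E r0 (s, y) ∧ ∀ t ∈ Ioo 0 η, D0 (muX ν) E (s + t, y)} with hA
  set b := ν.real (ball (0:H) 1) with hb
  have hb0 : 0 < b := real_unit_pos ν
  by_contra hne
  have hline := ae_line_D0 ν hE
  have hne' : ν (A ∩ {y | ∀ᵐ s ∂(volume : Measure ℝ), ((s, y) ∈ E → D0 (muX ν) Eᶜ (s, y)) ∧
      ((s, y) ∉ E → D0 (muX ν) E (s, y))}) ≠ 0 := by
    intro h0
    apply hne
    refine measure_mono_null (t := _ ∪ {y | ∀ᵐ s ∂(volume : Measure ℝ), ((s, y) ∈ E → D0 (muX ν) Eᶜ (s, y)) ∧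
      ((s, y) ∉ E → D0 (muX ν) E (s, y))}ᶜ) ?_ (measure_union_null h0 hline)
    intro y hy
    by_cases h : y ∈ {y | ∀ᵐ s ∂(volume : Measure ℝ), ((s, y) ∈ E → D0 (muX ν) Eᶜ (s, y)) ∧
      ((s, y) ∉ E → D0 (muX ν) E (s, y))}
    · exact Or.inl ⟨hy, h⟩
    · exact Or.inr h
  set A' := A ∩ {y | ∀ᵐ s ∂(volume : Measure ℝ), ((s, y) ∈ E → D0 (muX ν) Eᶜ (s, y)) ∧
      ((s, y) ∉ E → D0 (muX ν) E (s, y))} with hA'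
  have hdens := Besicovitch.ae_tendsto_measure_inter_div ν A'
  have : ∃ y0, Tendsto (fun r => ν (A' ∩ closedBall y0 r) / ν (closedBall y0 r)) (𝓝[>] 0) (𝓝 1) := by
    by_contra hno
    push Not at hno
    apply hne'
    have h0 : ∀ᵐ x ∂ν.restrict A', False := hdens.mono fun x hx => hno x hx
    have := eventually_false_iff_eq_bot.1 h0
    rwa [ae_eq_bot, Measure.restrict_eq_zero] at this
  obtain ⟨y0, hy0⟩ := this
  have hev : ∀ᶠ r in 𝓝[>] (0:ℝ), 1/2 < ν (A' ∩ closedBall y0 r) / ν (closedBall y0 r) :=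
    hy0.eventually (lt_mem_nhds (by norm_num))
  have hpos : (0:ℝ) < min (r0/4) (η/4) := by positivity
  obtain ⟨r, hr, hrI⟩ := (hev.and (Ioo_mem_nhdsGT hpos)).exists
  have hr00 : 0 < r := hrI.1
  have hr1 : r < r0/4 := hrI.2.trans_le (min_le_left _ _)
  have hr2 : r < η/4 := hrI.2.trans_le (min_le_right _ _)
  -- the sup
  set T := {s | ∃ y ∈ A' ∩ closedBall y0 r, s ∈ Icc c (c + η / 4) ∧ Qd ν ε E r0 (s, y) ∧ ∀ t ∈ Ioo 0 η, D0 (muX ν) E (s + t, y)} with hT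
  have hTne : T.Nonempty := by
    have : (A' ∩ closedBall y0 r).Nonempty := by
      by_contra h
      rw [not_nonempty_iff_eq_empty] at h
      rw [h] at hr; simp at hr
    obtain ⟨y, hy⟩ := this
    obtain ⟨s, hs1, hs2⟩ := hy.1.1
    exact ⟨s, y, hy, hs1, hs2⟩
  have hTb : BddAbove T := ⟨c + η/4, fun s hs => by obtain ⟨y, _, h, _⟩ := hs; exact h.2⟩
  obtain ⟨s1, ⟨y1, hy1, hs1, hQ1, -⟩, hs1'⟩ := exists_lt_of_lt_csSup hTne (show sSup T - r/10 < sSup T by linarith)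
  set J := Ioo (s1 + r/10) (s1 + r) with hJ
  set A2 := {y | (volume : Measure ℝ) ((fun s => (s, y)) ⁻¹' (E ∩ J ×ˢ univ)) = 0} ∩ closedBall y0 r with hA2
  have hA2m : MeasurableSet A2 := by
    refine MeasurableSet.inter ?_ isClosed_closedBall.measurableSet
    have := measurable_measure_prodMk_right (μ := (volume : Measure ℝ)) (hE.inter (measurableSet_Ioo.prod MeasurableSet.univ : MeasurableSet (J ×ˢ (univ : Set H))))
    exact this (measurableSet_singleton 0)
  have hsub : A' ∩ closedBall y0 r ⊆ A2 := by
    intro y hy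
    refine ⟨?_, hy.2⟩
    obtain ⟨s, hs, hsQ, hsD⟩ := hy.1.1
    have hsT : s ≤ sSup T := le_csSup hTb ⟨y, hy, hs, hsQ, hsD⟩
    have hl := hy.1.2
    simp only [Set.mem_ofPred_eq] at hl ⊢
    rw [measure_eq_zero_iff_ae_notMem]
    filter_upwards [hl] with q hq hq2
    simp only [mem_preimage, mem_inter_iff, mem_prod, mem_univ, and_true] at hq2
    refine not_D0_both (μ := muX ν) ?_ (hq.1 hq2.1)
    have := hsD (q - s) ⟨by linarith [hq2.2.1], by linarith [hq2.2.2, hs1.2, hs.1]⟩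
    simpa using this
  have hcb := real_closedBall_eq ν y0 hr00.le
  have hA2big : b * r ^ finrank ℝ H / 2 ≤ ν.real A2 := by
    have hfin : ν (closedBall y0 r) ≠ ⊤ := measure_closedBall_lt_top.ne
    have hp : ν (closedBall y0 r) ≠ 0 := (measure_closedBall_pos ν y0 hr00).ne'
    have h1 : 1/2 * ν (closedBall y0 r) ≤ ν A2 := by
      refine le_trans ?_ (measure_mono hsub)
      exact (ENNReal.le_div_iff_mul_le (Or.inl hp) (Or.inl hfin)).1 hr.le
    have h2 := ENNReal.toReal_mono ((measure_mono (inter_subset_right)).trans_lt measure_closedBall_lt_top : ν A2 < ⊤).ne h1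
    rw [ENNReal.toReal_mul] at h2
    simp only [measureReal_def] at hcb ⊢
    rw [hcb] at h2
    rw [show ((1/2 : ℝ≥0∞)).toReal = 1/2 by simp] at h2
    rw [hb, measureReal_def]
    linarith
  have hboxsub : (J ×ˢ A2) \ E ⊆ Eᶜ ∩ ball (s1, y1) (3 * r) := by
    rintro ⟨s, y⟩ ⟨⟨hs, hy⟩, hnE⟩
    refine ⟨hnE, ?_⟩
    rw [mem_ball, Prod.dist_eq]
    refine max_lt ?_ ?_
    · simp only [Real.dist_eq]
      rw [abs_lt]
      exact ⟨by linarith [hs.1], by linarith [hs.2]⟩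
    · have h1 := mem_closedBall.1 hy.2
      have h2 := mem_closedBall.1 hy1.2
      rw [dist_comm] at h2
      have := dist_triangle y y0 y1
      simp only
      linarith
  have hboxE : (muX ν) ((J ×ˢ A2) ∩ E) = 0 := by
    rw [Measure.prod_apply_symm ((measurableSet_Ioo.prod hA2m).inter hE)]
    rw [lintegral_eq_zero_iff' (measurable_measure_prodMk_right ((measurableSet_Ioo.prod hA2m).inter hE)).aemeasurable]
    refine Eventually.of_forall fun y => ?_
    by_cases hy : y ∈ A2
    · refine measure_mono_null ?_ hy.1
      rintro s ⟨⟨hs1, hs2⟩, hs3⟩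
      exact ⟨hs3, hs1, mem_univ _⟩
    · have : ((fun s => (s, y)) ⁻¹' ((J ×ˢ A2) ∩ E)) = ∅ := by
        ext s; simp [hy]
      change (volume : Measure ℝ) ((fun s => (s, y)) ⁻¹' ((J ×ˢ A2) ∩ E)) = 0
      rw [this]; simp
  have hbox : (muX ν).real ((J ×ˢ A2) \ E) = (9/10 * r) * ν.real A2 := by
    rw [measureReal_def, measure_sdiff_null' hboxE, Measure.prod_prod, ENNReal.toReal_mul, Real.volume_Ioo,
      ENNReal.toReal_ofReal (by linarith), measureReal_def]
    congr 1; ring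
  have h1 := hQ1 (3 * r) (by positivity) (by linarith)
  have h2 : (muX ν).real ((J ×ˢ A2) \ E) ≤ _ := (measureReal_mono hboxsub (fin_inter_ball (muX ν) _ _ _)).trans h1
  rw [hbox, mul_pow, ← mul_assoc] at h2
  have h3 : (9/10 * r) * (b * r ^ finrank ℝ H / 2) ≤ ε * 3 ^ (finrank ℝ H + 1) * r ^ (finrank ℝ H + 1) :=
    le_trans (by gcongr) h2
  have h4 : ε * 3 ^ (finrank ℝ H + 1) * r ^ (finrank ℝ H + 1) ≤ b / 4 * r ^ (finrank ℝ H + 1) := by gcongr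
  have h5 : 0 < b * r ^ (finrank ℝ H + 1) := by positivity
  have h6 : (9/10 * r) * (b * r ^ finrank ℝ H / 2) = 9/20 * (b * r ^ (finrank ℝ H + 1)) := by ring
  linarith

end Lines


section Lines2

open Module

variable {H : Type*} [NormedAddCommGroup H] [NormedSpace ℝ H] [FiniteDimensional ℝ H]
  [MeasurableSpace H] [BorelSpace H] (ν : Measure H) [ν.IsAddHaarMeasure]

lemma Qd.mono {ε r0 r1 : ℝ} {E : Set (ℝ × H)} {x : ℝ × H} (h : Qd ν ε E r0 x) (hr : r1 ≤ r0) :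
    Qd ν ε E r1 x := fun ρ h1 h2 => h ρ h1 (h2.trans_le hr)

lemma nullZ' {E : Set (ℝ × H)} (hE : MeasurableSet E) {ε : ℝ}
    (hε : ε * 3 ^ (finrank ℝ H + 1) ≤ ν.real (ball (0:H) 1) / 4) :
    ∀ᵐ y ∂ν, ∀ s r0 η : ℝ, 0 < r0 → 0 < η → Qd ν ε E r0 (s, y) →
      ¬ ∀ t ∈ Ioo 0 η, D0 (muX ν) E (s + t, y) := by
  have : ∀ᵐ y ∂ν, ∀ k j : ℕ, ∀ m : ℤ, ¬ ∃ s ∈ Icc ((m:ℝ) / (4 * ((j:ℝ)+1))) ((m:ℝ) / (4 * ((j:ℝ)+1)) + (1/((j:ℝ)+1)) / 4),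
      Qd ν ε E (1/((k:ℝ)+1)) (s, y) ∧ ∀ t ∈ Ioo 0 (1/((j:ℝ)+1)), D0 (muX ν) E (s + t, y) := by
    rw [ae_all_iff]; intro k
    rw [ae_all_iff]; intro j
    rw [ae_all_iff]; intro m
    have := nullZ ν hE (ε := ε) (r0 := 1/((k:ℝ)+1)) (η := 1/((j:ℝ)+1)) (c := (m:ℝ) / (4 * ((j:ℝ)+1)))
      (by positivity) (by positivity) hε
    rw [measure_eq_zero_iff_ae_notMem] at this
    exact this
  filter_upwards [this] with y hy s r0 η hr0 hη hQ hD
  obtain ⟨k, hk⟩ := exists_nat_one_div_lt hr0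
  obtain ⟨j, hj⟩ := exists_nat_one_div_lt hη
  refine hy k j ⌊4 * ((j:ℝ)+1) * s⌋ ⟨s, ?_, hQ.mono ν hk.le, fun t ht => hD t ⟨ht.1, ht.2.trans hj⟩⟩
  have hj0 : (0:ℝ) < 4 * ((j:ℝ)+1) := by positivity
  have h1 := Int.floor_le (4 * ((j:ℝ)+1) * s)
  have h2 := Int.lt_floor_add_one (4 * ((j:ℝ)+1) * s)
  constructor
  · rw [div_le_iff₀ hj0]; linarith
  · have : (⌊4 * ((j:ℝ)+1) * s⌋ : ℝ) / (4 * ((j:ℝ)+1)) + 1/((j:ℝ)+1)/4 = ((⌊4 * ((j:ℝ)+1) * s⌋ : ℝ) + 1) / (4 * ((j:ℝ)+1)) := by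
      field_simp
    rw [this, le_div_iff₀ hj0]; linarith

/-- reflection in the first coordinate -/
def reflT (x : ℝ × H) : ℝ × H := (-x.1, x.2)

lemma refl_real (A : Set (ℝ × H)) (x : ℝ × H) (ρ : ℝ) :
    (muX ν).real (reflT ⁻¹' A ∩ ball (reflT x) ρ) = (muX ν).real (A ∩ ball x ρ) := by
  have hmp : MeasurePreserving (reflT : ℝ × H → ℝ × H) (muX ν) (muX ν) :=
    (Measure.measurePreserving_neg (volume : Measure ℝ)).prod (MeasurePreserving.id ν)
  have hemb : MeasurableEmbedding (reflT : ℝ × H → ℝ × H) := by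
    have : (reflT : ℝ × H → ℝ × H) = ((MeasurableEquiv.neg ℝ).prodCongr (MeasurableEquiv.refl H)) := by
      ext x <;> rfl
    rw [this]; exact MeasurableEquiv.measurableEmbedding _
  have : reflT ⁻¹' A ∩ ball (reflT x) ρ = reflT ⁻¹' (A ∩ ball x ρ) := by
    ext z
    simp only [reflT, mem_inter_iff, mem_preimage, mem_ball, Prod.dist_eq]
    rw [show dist (-z.1) x.1 = dist z.1 (-x.1) by
      rw [Real.dist_eq, Real.dist_eq, ← abs_neg]; congr 1; ring]
  rw [this, measureReal_def, measureReal_def, hmp.measure_preimage_emb hemb]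

lemma nullZL {E : Set (ℝ × H)} (hE : MeasurableSet E) {ε : ℝ}
    (hε : ε * 3 ^ (finrank ℝ H + 1) ≤ ν.real (ball (0:H) 1) / 4) :
    ∀ᵐ y ∂ν, ∀ s r0 η : ℝ, 0 < r0 → 0 < η → Qd ν ε E r0 (s, y) →
      ¬ ∀ t ∈ Ioo 0 η, D0 (muX ν) E (s - t, y) := by
  have hT : Measurable (reflT : ℝ × H → ℝ × H) := (measurable_fst.neg).prodMk measurable_snd
  filter_upwards [nullZ' ν (hT hE) hε] with y hy s r0 η hr0 hη hQ hD
  refine hy (-s) r0 η hr0 hη ?_ ?_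
  · intro ρ h1 h2
    rw [← preimage_compl]
    have := refl_real ν Eᶜ (s, y) ρ
    simp only [reflT] at this
    exact this.le.trans (hQ ρ h1 h2)
  · intro t ht δ hδ
    obtain ⟨r, hr, h⟩ := hD t ht δ hδ
    refine ⟨r, hr, fun ρ h1 h2 => ?_⟩
    have := refl_real ν E (s - t, y) ρ
    rw [show reflT (s - t, y) = (-s + t, y) by simp only [reflT]; congr 1; ring] at this
    exact this.le.trans (h ρ h1 h2)

/-- **L1**: on almost every line, a segment free of essential boundary is inside one phase. -/
lemma line_const {E : Set (ℝ × H)} (hE : MeasurableSet E) :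
    ∀ᵐ y ∂ν, ∀ a b : ℝ, (∀ s ∈ Icc a b, D0 (muX ν) Eᶜ (s, y) ∨ D0 (muX ν) E (s, y)) →
      (∀ s ∈ Icc a b, D0 (muX ν) Eᶜ (s, y)) ∨ (∀ s ∈ Icc a b, D0 (muX ν) E (s, y)) := by
  set b0 := ν.real (ball (0:H) 1) with hb0
  have hb : 0 < b0 := real_unit_pos ν
  set ε := b0 / 4 / 3 ^ (finrank ℝ H + 1) with hεd
  have hε0 : 0 < ε := by positivity
  have hε : ε * 3 ^ (finrank ℝ H + 1) ≤ b0 / 4 := by rw [hεd]; field_simp; exact le_rfl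
  have hμb : ∀ x : ℝ × H, ∀ ρ, 0 < ρ → (muX ν).real (ball x ρ) = 2 * b0 * ρ ^ (finrank ℝ H + 1) := by
    intro x ρ hρ
    have : (muX ν).real (ball (0 : ℝ × H) 1) = 2 * b0 := by
      rw [measureReal_def, show (0 : ℝ × H) = ((0:ℝ), (0:H)) from rfl, ← ball_prod_same, Measure.prod_prod, ENNReal.toReal_mul,
        Real.volume_ball]
      simp [hb0, measureReal_def]
    rw [real_ball_eq (muX ν) x hρ, finrank_prodR, this]; ring
  -- uniform smallness excludes the other phase
  have hex : ∀ (E : Set (ℝ × H)) x r0, 0 < r0 → Qd ν ε E r0 x → ¬ D0 (muX ν) E x := by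
    intro E x r0 hr0 hQ hD
    obtain ⟨r, hr, h⟩ := hD ε hε0
    have hm : 0 < min r r0 / 2 := by positivity
    have h1 := h (min r r0 / 2) hm (by have := min_le_left r r0; linarith)
    have h2 := hQ (min r r0 / 2) hm (by have := min_le_right r r0; linarith)
    have h3 : (muX ν).real (ball x (min r r0 / 2)) ≤ (muX ν).real (E ∩ ball x (min r r0 / 2)) + (muX ν).real (Eᶜ ∩ ball x (min r r0 / 2)) := by
      refine le_trans ?_ (measureReal_union_le _ _)
      rw [← union_inter_distrib_right, union_compl_self, univ_inter]
    rw [hμb x _ hm] at h3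
    rw [finrank_prodR] at h1
    have hp : 0 < (min r r0 / 2) ^ (finrank ℝ H + 1) := by positivity
    have : 2 * b0 ≤ 2 * ε := by nlinarith
    have h3' : ε * 1 ≤ ε * 3 ^ (finrank ℝ H + 1) := by gcongr; exact one_le_pow₀ (by norm_num)
    linarith
  have hQc : ∀ (E : Set (ℝ × H)) (y : H) r0, IsClosed {s : ℝ | Qd ν ε E r0 (s, y)} := by
    intro E y r0
    have : {s : ℝ | Qd ν ε E r0 (s, y)} = ⋂ ρ : ℝ, ⋂ (_ : 0 < ρ), ⋂ (_ : ρ < r0), (fun s : ℝ => (s, y)) ⁻¹' {x | (muX ν).real (Eᶜ ∩ ball x ρ) ≤ ε * ρ ^ (finrank ℝ H + 1)} := by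
      ext s; simp [Qd]
    rw [this]
    refine isClosed_iInter fun ρ => isClosed_iInter fun _ => isClosed_iInter fun _ => ?_
    exact (isClosed_ball_le (muX ν) _ _ _).preimage (by fun_prop)
  have hD0Q : ∀ (E : Set (ℝ × H)) (x : ℝ × H), D0 (muX ν) Eᶜ x → ∃ k : ℕ, Qd ν ε E (1/((k:ℝ)+1)) x := by
    intro E x hD
    obtain ⟨r, hr, h⟩ := hD ε hε0
    obtain ⟨k, hk⟩ := exists_nat_one_div_lt hr
    refine ⟨k, fun ρ h1 h2 => ?_⟩
    have := h ρ h1 (h2.trans hk)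
    rwa [finrank_prodR] at this
  filter_upwards [nullZ' ν hE hε, nullZL ν hE hε, nullZ' ν hE.compl hε, nullZL ν hE.compl hε]
    with y h1 h2 h3 h4 a b hcov
  refine topo_main (I := {s | D0 (muX ν) Eᶜ (s, y)}) (O := {s | D0 (muX ν) E (s, y)})
    (G := fun k => {s | Qd ν ε E (1/((k:ℝ)+1)) (s, y)}) (H := fun k => {s | Qd ν ε Eᶜ (1/((k:ℝ)+1)) (s, y)})
    hcov (fun k => hQc _ _ _) (fun k => hQc _ _ _) ?_ ?_ ?_ ?_ ?_ ?_ ?_ ?_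
  · intro s hs; exact mem_iUnion.2 (hD0Q E _ hs)
  · intro s hs; exact mem_iUnion.2 (hD0Q Eᶜ _ (by rw [compl_compl]; exact hs))
  · intro k
    rw [Set.disjoint_left]
    intro s hs hs'
    exact hex E _ _ (by positivity) hs hs'
  · intro k
    rw [Set.disjoint_left]
    intro s hs hs'
    exact hex Eᶜ _ _ (by positivity) hs hs'
  · intro k s hs η hη; exact h1 s _ η (by positivity) hη hs
  · intro k s hs η hη; exact h2 s _ η (by positivity) hη hs
  · intro k s hs η hη; exact h3 s _ η (by positivity) hη hs
  · intro k s hs η hη; exact h4 s _ η (by positivity) hη hs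

end Lines2


section Haus

open Module

lemma haus_cover {X : Type*} [MetricSpace X] [MeasurableSpace X] [BorelSpace X] {d : ℕ} (hd : 1 ≤ d)
    {S : Set X} (hS : μH[(d:ℝ)] S ≠ ⊤) {δ : ℝ} (hδ : 0 < δ) :
    ∃ (t : ℕ → Set X) (D : ℕ → ℝ), S ⊆ ⋃ n, t n ∧ (∀ n, 0 ≤ D n) ∧ (∀ n, D n ≤ δ) ∧
      (∀ n, ∀ x ∈ t n, ∀ y ∈ t n, dist x y ≤ D n) ∧
      ∑' n, ENNReal.ofReal (D n ^ d) ≤ μH[(d:ℝ)] S + ENNReal.ofReal δ := by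
  have h := Measure.hausdorffMeasure_apply (d:ℝ) S
  have hlt : ⨅ (t : ℕ → Set X) (_ : S ⊆ ⋃ n, t n) (_ : ∀ n, ediam (t n) ≤ ENNReal.ofReal δ),
          ∑' n, ⨆ _ : (t n).Nonempty, ediam (t n) ^ (d:ℝ) < μH[(d:ℝ)] S + ENNReal.ofReal δ := by
    refine lt_of_le_of_lt ?_ (ENNReal.lt_add_right hS (by simpa using hδ))
    rw [h]
    exact le_iSup₂_of_le (ENNReal.ofReal δ) (by simpa using hδ) le_rfl
  simp only [iInf_lt_iff] at hlt
  obtain ⟨t, ht1, ht2, ht3⟩ := hlt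
  have hfin : ∀ n, ediam (t n) ≠ ⊤ := fun n => ((ht2 n).trans_lt ENNReal.ofReal_lt_top).ne
  refine ⟨t, fun n => (ediam (t n)).toReal, ht1, fun n => ENNReal.toReal_nonneg, fun n => ?_, fun n x hx y hy => ?_, ?_⟩
  · exact ENNReal.toReal_le_of_le_ofReal hδ.le (ht2 n)
  · rw [dist_edist]
    exact ENNReal.toReal_mono (hfin n) (edist_le_ediam_of_mem hx hy)
  · refine le_trans (ENNReal.tsum_le_tsum fun n => ?_) ht3.le
    rw [ENNReal.ofReal_pow ENNReal.toReal_nonneg, ENNReal.ofReal_toReal (hfin n)]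
    rcases (t n).eq_empty_or_nonempty with h0 | h0
    · rw [h0]; simp [show d ≠ 0 by omega]
    · simp [h0]

variable {V : Type*} [NormedAddCommGroup V] [NormedSpace ℝ V] [FiniteDimensional ℝ V]
  [MeasurableSpace V] [BorelSpace V] (μ : Measure V) [μ.IsAddHaarMeasure]

/-- points whose segment in direction `w` hits `S` -/
def hitSet (S : Set V) (w : V) : Set V := {x | ∃ t ∈ Icc (0:ℝ) 1, x + t • w ∈ S}

lemma tube_pos {d : ℕ} (hV : finrank ℝ V = d + 1) {T : Set V} {D : ℝ} (hD : 0 < D)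
    (hT : ∀ x ∈ T, ∀ y ∈ T, dist x y ≤ D) (w : V) :
    μ (hitSet T w) ≤ ENNReal.ofReal (μ.real (ball (0:V) 1) * 2 ^ (d+1) * (‖w‖ + 2 * D) * D ^ d) := by
  rcases T.eq_empty_or_nonempty with rfl | ⟨x0, hx0⟩
  · simp [hitSet]
  set N : ℕ := ⌊‖w‖ / D⌋₊ + 1 with hN
  have hN0 : (0:ℝ) < N := by positivity
  have hN1 : ‖w‖ / D < N := by rw [hN]; push_cast; exact Nat.lt_floor_add_one _
  have hN2 : (N:ℝ) ≤ ‖w‖ / D + 1 := by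
    rw [hN]; push_cast; have := Nat.floor_le (show 0 ≤ ‖w‖ / D by positivity); linarith
  have hsub : hitSet T w ⊆ ⋃ j ∈ Finset.range (N+1), closedBall (x0 - ((j:ℝ)/N) • w) (2 * D) := by
    rintro x ⟨t, ht, hx⟩
    have hfl : ⌊t * N⌋₊ ≤ N := by
      apply Nat.floor_le_of_le
      nlinarith [ht.2]
    refine mem_iUnion₂.2 ⟨⌊t * N⌋₊, Finset.mem_range.2 (by omega), ?_⟩
    rw [mem_closedBall, dist_eq_norm]
    have h1 : x - (x0 - ((⌊t * N⌋₊:ℝ)/N) • w) = (x + t • w - x0) - (t - (⌊t * N⌋₊:ℝ)/N) • w := by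
      module
    rw [h1]
    refine (norm_sub_le _ _).trans ?_
    have h2 := hT _ hx _ hx0
    rw [dist_eq_norm] at h2
    have h3 : ‖(t - (⌊t * N⌋₊:ℝ)/N) • w‖ ≤ D := by
      rw [norm_smul, Real.norm_eq_abs]
      have h4 : |t - (⌊t * N⌋₊:ℝ)/N| ≤ 1 / N := by
        have a1 := Nat.floor_le (show 0 ≤ t * N by have := ht.1; positivity)
        have a2 := Nat.lt_floor_add_one (t * N)
        rw [show t - (⌊t * N⌋₊:ℝ)/N = (t * N - ⌊t * N⌋₊)/N by field_simp, abs_div, abs_of_pos hN0]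
        gcongr
        rw [abs_le]; constructor <;> linarith
      calc |t - (⌊t * N⌋₊:ℝ)/N| * ‖w‖ ≤ 1/N * ‖w‖ := by gcongr
        _ ≤ D := by
          rw [div_lt_iff₀ hD] at hN1
          rw [one_div, inv_mul_le_iff₀ hN0]; exact hN1.le
    linarith
  refine (measure_mono hsub).trans ((measure_biUnion_finset_le _ _).trans ?_)
  have hc : ∀ j ∈ Finset.range (N+1), μ (closedBall (x0 - ((j:ℝ)/N) • w) (2 * D)) = ENNReal.ofReal ((2*D)^(d+1) * μ.real (ball (0:V) 1)) := by
    intro j _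
    rw [← hV, ← real_closedBall_eq μ _ (by positivity), measureReal_def, ENNReal.ofReal_toReal measure_closedBall_lt_top.ne]
  rw [Finset.sum_congr rfl hc, Finset.sum_const, Finset.card_range, nsmul_eq_mul,
    show ((N+1 : ℕ) : ℝ≥0∞) = ENNReal.ofReal ((N:ℝ)+1) by
      rw [← ENNReal.ofReal_natCast]; push_cast; rfl, ← ENNReal.ofReal_mul (by positivity)]
  apply ENNReal.ofReal_le_ofReal
  have hb := real_unit_pos μ
  calc ((N:ℝ)+1) * ((2*D)^(d+1) * μ.real (ball (0:V) 1)) ≤ (‖w‖ / D + 1 + 1) * ((2*D)^(d+1) * μ.real (ball (0:V) 1)) := by gcongr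
    _ = _ := by
      rw [mul_pow, pow_succ D]; field_simp; ring

lemma tube {d : ℕ} (hV : finrank ℝ V = d + 1) {T : Set V} {D : ℝ} (hD : 0 ≤ D)
    (hT : ∀ x ∈ T, ∀ y ∈ T, dist x y ≤ D) (w : V) :
    μ (hitSet T w) ≤ ENNReal.ofReal (μ.real (ball (0:V) 1) * 2 ^ (d+1) * (‖w‖ + 2 * D) * D ^ d) := by
  have hcont : Continuous fun D : ℝ => ENNReal.ofReal (μ.real (ball (0:V) 1) * 2 ^ (d+1) * (‖w‖ + 2 * D) * D ^ d) := by
    refine ENNReal.continuous_ofReal.comp ?_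
    fun_prop
  have := (hcont.tendsto D).mono_left (nhdsWithin_le_nhds (s := Ioi D))
  refine ge_of_tendsto this ?_
  filter_upwards [self_mem_nhdsWithin] with D' hD'
  exact tube_pos μ hV (lt_of_le_of_lt hD hD') (fun x hx y hy => (hT x hx y hy).trans (le_of_lt hD')) w

/-- **Lemma V** -/
lemma hit_le {d : ℕ} (hd : 1 ≤ d) (hV : finrank ℝ V = d + 1) {S : Set V} (hS : μH[(d:ℝ)] S ≠ ⊤) (w : V) :
    μ (hitSet S w) ≤ ENNReal.ofReal (μ.real (ball (0:V) 1) * 2 ^ (d+1) * ‖w‖) * μH[(d:ℝ)] S := by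
  have hlim : Tendsto (fun δ : ℝ => ENNReal.ofReal (μ.real (ball (0:V) 1) * 2 ^ (d+1) * (‖w‖ + 2 * δ)) * (μH[(d:ℝ)] S + ENNReal.ofReal δ))
      (𝓝[>] 0) (𝓝 (ENNReal.ofReal (μ.real (ball (0:V) 1) * 2 ^ (d+1) * (‖w‖ + 2 * 0)) * (μH[(d:ℝ)] S + ENNReal.ofReal 0))) := by
    refine Tendsto.mono_left ?_ nhdsWithin_le_nhds
    refine ENNReal.Tendsto.mul ?_ (Or.inr (by simpa using hS)) ?_ (Or.inr ENNReal.ofReal_ne_top)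
    · exact (ENNReal.continuous_ofReal.comp (by fun_prop)).tendsto (0:ℝ)
    · exact (Continuous.add continuous_const ENNReal.continuous_ofReal).tendsto (0:ℝ)
  rw [mul_zero, add_zero, ENNReal.ofReal_zero, add_zero] at hlim
  refine ge_of_tendsto hlim ?_
  filter_upwards [self_mem_nhdsWithin] with δ hδ
  have hδ : 0 < δ := hδ
  obtain ⟨t, D, hcov, hD0, hDδ, hdist, hsum⟩ := haus_cover hd hS hδ
  have hsub : hitSet S w ⊆ ⋃ n, hitSet (t n) w := by
    rintro x ⟨s, hs, hx⟩
    obtain ⟨n, hn⟩ := mem_iUnion.1 (hcov hx)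
    exact mem_iUnion.2 ⟨n, s, hs, hn⟩
  refine (measure_mono hsub).trans ((measure_iUnion_le _).trans ?_)
  have hb := real_unit_pos μ
  calc ∑' n, μ (hitSet (t n) w) ≤ ∑' n, ENNReal.ofReal (μ.real (ball (0:V) 1) * 2 ^ (d+1) * (‖w‖ + 2 * δ)) * ENNReal.ofReal (D n ^ d) := by
        refine ENNReal.tsum_le_tsum fun n => (tube μ hV (hD0 n) (hdist n) w).trans ?_
        rw [← ENNReal.ofReal_mul (by positivity)]
        apply ENNReal.ofReal_le_ofReal
        have := hD0 n
        gcongr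
        exact hDδ n
    _ ≤ _ := by
        rw [ENNReal.tsum_mul_left]
        gcongr

variable {H : Type*} [NormedAddCommGroup H] [NormedSpace ℝ H] [FiniteDimensional ℝ H]
  [MeasurableSpace H] [BorelSpace H] (ν : Measure H) [ν.IsAddHaarMeasure]

lemma meas_diam_le {d : ℕ} (hH : finrank ℝ H = d) {T : Set H} {D : ℝ} (hD : 0 ≤ D)
    (hT : ∀ x ∈ T, ∀ y ∈ T, dist x y ≤ D) : ν T ≤ ENNReal.ofReal (ν.real (ball (0:H) 1)) * ENNReal.ofReal (D ^ d) := by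
  rcases T.eq_empty_or_nonempty with rfl | ⟨x0, hx0⟩
  · simp
  have : T ⊆ closedBall x0 D := fun x hx => hT x hx x0 hx0
  refine (measure_mono this).trans (le_of_eq ?_)
  rw [Measure.addHaar_closedBall ν _ hD, hH, mul_comm, measureReal_def, ENNReal.ofReal_toReal measure_ball_lt_top.ne]

/-- **Lemma 2** almost every line meets `S` finitely often -/
lemma finite_hits {d : ℕ} (hd : 1 ≤ d) (hH : finrank ℝ H = d) {S : Set (ℝ × H)} (hS : μH[(d:ℝ)] S ≠ ⊤) :
    ∀ᵐ y ∂ν, {s : ℝ | (s, y) ∈ S}.Finite := by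
  set A : ℕ → ℕ → Set H := fun N k => {y | ∃ F : Finset ℝ, F.card = N ∧ (∀ s ∈ F, (s, y) ∈ S) ∧
    ∀ s ∈ F, ∀ s' ∈ F, s ≠ s' → 1/((k:ℝ)+1) < |s - s'|} with hA
  set c := ENNReal.ofReal (ν.real (ball (0:H) 1)) * (μH[(d:ℝ)] S + 1) with hc
  have hctop : c ≠ ⊤ := ENNReal.mul_ne_top ENNReal.ofReal_ne_top (by simp [hS])
  have hAk : ∀ (N k : ℕ), (N:ℝ≥0∞) * ν (A N k) ≤ c := by
    intro N k
    obtain ⟨t, D, hcov, hD0, hDδ, hdist, hsum⟩ := haus_cover hd hS (δ := 1/((k:ℝ)+1)) (by positivity)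
    set f : H → ℝ≥0∞ := fun y => ∑' n, (toMeasurable ν (Prod.snd '' t n)).indicator 1 y with hf
    have hfm : Measurable f := Measurable.tsum fun n => measurable_one.indicator (measurableSet_toMeasurable _ _)
    have hle : A N k ⊆ {y | (N:ℝ≥0∞) ≤ f y} := by
      rintro y ⟨F, hFc, hFS, hFd⟩
      have hch : ∀ s : ℝ, ∃ n, s ∈ F → (s, y) ∈ t n := by
        intro s
        by_cases hs : s ∈ F
        · obtain ⟨n, hn⟩ := mem_iUnion.1 (hcov (hFS s hs)); exact ⟨n, fun _ => hn⟩
        · exact ⟨0, fun h => absurd h hs⟩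
      choose g hg using hch
      have hinj : Set.InjOn g F := by
        intro s hs s' hs' hss
        by_contra hne
        have h1 := hFd s hs s' hs' hne
        have h2 := hdist (g s) _ (hg s hs) _ (hss ▸ hg s' hs')
        rw [Prod.dist_eq] at h2
        have h3 := (le_max_left _ _).trans h2
        simp only [Real.dist_eq] at h3
        linarith [hDδ (g s)]
      have : (N:ℝ≥0∞) = ∑ n ∈ F.image g, (toMeasurable ν (Prod.snd '' t n)).indicator (1 : H → ℝ≥0∞) y := by
        rw [Finset.sum_image hinj]
        rw [Finset.sum_congr rfl (g := fun _ => (1:ℝ≥0∞))]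
        · simp [hFc]
        · intro s hs
          rw [indicator_of_mem]
          · rfl
          · exact subset_toMeasurable _ _ ⟨(s, y), hg s hs, rfl⟩
      simp only [Set.mem_ofPred_eq]
      rw [this]
      exact ENNReal.sum_le_tsum _
    calc (N:ℝ≥0∞) * ν (A N k) ≤ (N:ℝ≥0∞) * ν {y | (N:ℝ≥0∞) ≤ f y} := by gcongr
      _ ≤ ∫⁻ y, f y ∂ν := mul_meas_ge_le_lintegral hfm _
      _ = ∑' n, ν (Prod.snd '' t n) := by
        rw [hf, lintegral_tsum fun n => (measurable_one.indicator (measurableSet_toMeasurable _ _)).aemeasurable]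
        congr 1; ext n
        rw [lintegral_indicator_one (measurableSet_toMeasurable _ _), measure_toMeasurable]
      _ ≤ ∑' n, ENNReal.ofReal (ν.real (ball (0:H) 1)) * ENNReal.ofReal (D n ^ d) := by
        refine ENNReal.tsum_le_tsum fun n => meas_diam_le ν hH (hD0 n) ?_
        rintro _ ⟨x, hx, rfl⟩ _ ⟨y, hy, rfl⟩
        refine le_trans ?_ (hdist n x hx y hy)
        rw [Prod.dist_eq]; exact le_max_right _ _
      _ ≤ c := by
        rw [ENNReal.tsum_mul_left, hc]
        gcongr
        refine hsum.trans ?_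
        gcongr
        rw [ENNReal.ofReal_le_one, div_le_one (by positivity)]
        have : (0:ℝ) ≤ k := by positivity
        linarith
  set B : Set H := {y | ¬ {s : ℝ | (s, y) ∈ S}.Finite} with hB
  have hBsub : ∀ N : ℕ, B ⊆ ⋃ k, A N k := by
    intro N y hy
    obtain ⟨F, hF, hFc⟩ := Set.Infinite.exists_subset_card_eq (s := {s : ℝ | (s, y) ∈ S}) hy N
    -- minimal gap
    have : ∃ δ > 0, ∀ s ∈ F, ∀ s' ∈ F, s ≠ s' → δ < |s - s'| := by
      classical
      set P := F.offDiag.image (fun p : ℝ × ℝ => |p.1 - p.2|) with hP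
      rcases P.eq_empty_or_nonempty with h0 | h0
      · refine ⟨1, one_pos, fun s hs s' hs' hne => ?_⟩
        exfalso
        have : |s - s'| ∈ P := Finset.mem_image.2 ⟨(s, s'), by simp [hs, hs', hne], rfl⟩
        rw [h0] at this; simp at this
      · refine ⟨P.min' h0 / 2, ?_, fun s hs s' hs' hne => ?_⟩
        · have := P.min'_mem h0
          obtain ⟨p, hp, hp2⟩ := Finset.mem_image.1 this
          rw [← hp2]
          have : p.1 - p.2 ≠ 0 := sub_ne_zero.2 (Finset.mem_offDiag.1 hp).2.2
          have := abs_pos.2 this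
          positivity
        · have : |s - s'| ∈ P := Finset.mem_image.2 ⟨(s, s'), by simp [hs, hs', hne], rfl⟩
          have h2 := P.min'_le _ this
          have : 0 < |s - s'| := abs_pos.2 (sub_ne_zero.2 hne)
          linarith
    obtain ⟨δ, hδ, hgap⟩ := this
    obtain ⟨k, hk⟩ := exists_nat_one_div_lt hδ
    exact mem_iUnion.2 ⟨k, F, hFc, fun s hs => hF hs, fun s hs s' hs' hne => hk.trans (hgap s hs s' hs' hne)⟩
  have hmono : ∀ N, Monotone (A N) := by
    intro N k k' hkk y hy
    obtain ⟨F, h1, h2, h3⟩ := hy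
    refine ⟨F, h1, h2, fun s hs s' hs' hne => lt_of_le_of_lt ?_ (h3 s hs s' hs' hne)⟩
    have : (k:ℝ) ≤ k' := by exact_mod_cast hkk
    gcongr
  have hBN : ∀ N : ℕ, (N:ℝ≥0∞) * ν B ≤ c := by
    intro N
    calc (N:ℝ≥0∞) * ν B ≤ (N:ℝ≥0∞) * ν (⋃ k, A N k) := by gcongr; exact hBsub N
      _ = ⨆ k, (N:ℝ≥0∞) * ν (A N k) := by rw [(hmono N).measure_iUnion, ENNReal.mul_iSup]
      _ ≤ c := iSup_le fun k => hAk N k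
  have hB0 : ν B = 0 := by
    by_contra hne
    obtain ⟨N, hN⟩ := ENNReal.exists_nat_mul_gt hne hctop
    exact absurd (hBN N) (not_le.2 hN)
  exact hB0

end Haus


section Cross

open Module

variable {V : Type*} [NormedAddCommGroup V] [NormedSpace ℝ V] [FiniteDimensional ℝ V]
  [MeasurableSpace V] [BorelSpace V]
variable {V' : Type*} [NormedAddCommGroup V'] [NormedSpace ℝ V'] [FiniteDimensional ℝ V']
  [MeasurableSpace V'] [BorelSpace V']

/-- essential boundary -/
def bd (μ : Measure V) (E : Set V) : Set V := {x | ¬ D0 μ E x ∧ ¬ D0 μ Eᶜ x}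

/-- points with a measure theoretic normal -/
def RB (μ : Measure V) (E : Set V) : Set V :=
  {x | ∃ Λ : V →L[ℝ] ℝ, Λ ≠ 0 ∧ D0 μ {y | y ∈ E ∧ 0 < Λ (y - x)} x ∧
    D0 μ {y | y ∉ E ∧ Λ (y - x) < 0} x}

lemma D0.map_iff (μ : Measure V) [μ.IsAddHaarMeasure] (μ' : Measure V') [μ'.IsAddHaarMeasure]
    (e : V ≃L[ℝ] V') {A : Set V} {x : V'} : D0 μ' (e.symm ⁻¹' A) x ↔ D0 μ A (e.symm x) := by
  constructor
  · intro h
    have := D0.map_equiv μ' μ e.symm h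
    have h2 : e.symm.symm ⁻¹' (e.symm ⁻¹' A) = A := by ext; simp
    rwa [h2] at this
  · intro h
    have := D0.map_equiv μ μ' e h
    simpa using this

lemma bd_map (μ : Measure V) [μ.IsAddHaarMeasure] (μ' : Measure V') [μ'.IsAddHaarMeasure]
    (e : V ≃L[ℝ] V') (E : Set V) : bd μ' (e.symm ⁻¹' E) = e.symm ⁻¹' (bd μ E) := by
  ext x
  simp only [bd, Set.mem_ofPred_eq, mem_preimage, ← preimage_compl, D0.map_iff μ μ' e]

lemma RB_map_sub (μ : Measure V) [μ.IsAddHaarMeasure] (μ' : Measure V') [μ'.IsAddHaarMeasure]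
    (e : V ≃L[ℝ] V') {E : Set V} {x : V} (hx : x ∈ RB μ E) : e x ∈ RB μ' (e.symm ⁻¹' E) := by
  obtain ⟨Λ, h0, h1, h2⟩ := hx
  refine ⟨Λ.comp (e.symm : V' →L[ℝ] V), ?_, ?_, ?_⟩
  · intro h
    apply h0
    ext v
    have := congrArg (fun g : V' →L[ℝ] ℝ => g (e v)) h
    simpa using this
  · have := D0.map_equiv μ μ' e h1
    refine this.mono ?_
    intro y hy
    simpa using hy
  · have := D0.map_equiv μ μ' e h2
    refine this.mono ?_
    intro y hy
    simpa using hy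

lemma RB_map (μ : Measure V) [μ.IsAddHaarMeasure] (μ' : Measure V') [μ'.IsAddHaarMeasure]
    (e : V ≃L[ℝ] V') (E : Set V) : RB μ' (e.symm ⁻¹' E) = e.symm ⁻¹' (RB μ E) := by
  ext x
  constructor
  · intro h
    have := RB_map_sub μ' μ e.symm h
    have h2 : e.symm.symm ⁻¹' (e.symm ⁻¹' E) = E := by ext; simp
    rwa [h2] at this
  · intro h
    have := RB_map_sub μ μ' e h
    simpa using this

lemma RB_compl (μ : Measure V) [μ.IsAddHaarMeasure] (E : Set V) : RB μ Eᶜ = RB μ E := by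
  have key : ∀ A : Set V, RB μ A ⊆ RB μ Aᶜ := by
    rintro A x ⟨Λ, h0, h1, h2⟩
    refine ⟨-Λ, neg_ne_zero.2 h0, h2.mono ?_, h1.mono ?_⟩
    · rintro y ⟨hy, hy'⟩
      exact ⟨hy, by simpa using hy'⟩
    · rintro y ⟨hy, hy'⟩
      exact ⟨by simpa using hy, by simpa using hy'⟩
  refine subset_antisymm ?_ (key E)
  have := key Eᶜ
  rwa [compl_compl] at this

lemma bd_compl (μ : Measure V) (E : Set V) : bd μ Eᶜ = bd μ E := by
  ext x
  simp only [bd, Set.mem_ofPred_eq, compl_compl]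
  tauto

lemma null_map (μ : Measure V) [μ.IsAddHaarMeasure] (μ' : Measure V') [μ'.IsAddHaarMeasure]
    (e : V ≃L[ℝ] V') {P : V' → Prop} (h : ∀ᵐ x ∂μ', P x) : ∀ᵐ x ∂μ, P (e x) := by
  haveI : (Measure.map e μ).IsAddHaarMeasure := e.isAddHaarMeasure_map μ
  obtain ⟨c, hc⟩ : ∃ c : ℝ≥0, Measure.map e μ = c • μ' :=
    ⟨_, Measure.isAddLeftInvariant_eq_smul _ _⟩
  have h2 : ∀ᵐ x ∂(Measure.map e μ), P x := by
    rw [hc]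
    exact Measure.ae_smul_measure h c
  exact ae_of_ae_map e.continuous.aemeasurable h2

lemma exists_split (w : V) (hw : w ≠ 0) :
    ∃ (f : V →L[ℝ] ℝ) (e : V ≃L[ℝ] ℝ × f.ker), e w = (1, 0) ∧ finrank ℝ V = finrank ℝ f.ker + 1 := by
  obtain ⟨f, hf⟩ := SeparatingDual.exists_eq_one (R := ℝ) hw
  have h : Function.RightInverse (ContinuousLinearMap.toSpanSingleton ℝ w) f := by
    intro t
    simp [hf]
  refine ⟨f, ContinuousLinearEquiv.equivOfRightInverse f _ h, ?_, ?_⟩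
  · apply Prod.ext
    · simp [hf]
    · apply Subtype.ext
      simp [hf]
  · have := (ContinuousLinearEquiv.equivOfRightInverse f _ h).toLinearEquiv.finrank_eq
    rw [this, finrank_prodR]

variable {H : Type*} [NormedAddCommGroup H] [NormedSpace ℝ H] [FiniteDimensional ℝ H]
  [MeasurableSpace H] [BorelSpace H] (ν : Measure H) [ν.IsAddHaarMeasure]

/-- on almost every line, crossings from `E` to its complement meet `S` -/
def LineCross (E S : Set (ℝ × H)) : Prop :=
  ∀ᵐ y ∂ν, ∀ s1 s2 : ℝ, D0 (muX ν) Eᶜ (s1, y) → D0 (muX ν) E (s2, y) → ∃ a ∈ uIcc s1 s2, (a, y) ∈ S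

lemma lineCross_bd {E : Set (ℝ × H)} (hE : MeasurableSet E) : LineCross ν E (bd (muX ν) E) := by
  filter_upwards [line_const ν hE] with y hy s1 s2 h1 h2
  by_contra hcon
  push Not at hcon
  have hc : ∀ s ∈ Icc (min s1 s2) (max s1 s2), D0 (muX ν) Eᶜ (s, y) ∨ D0 (muX ν) E (s, y) := by
    intro s hs
    have := hcon s hs
    simp only [bd, Set.mem_ofPred_eq] at this
    tauto
  rcases hy _ _ hc with h | h
  · exact not_D0_both h2 (h s2 ⟨min_le_right _ _, le_max_right _ _⟩)
  · exact not_D0_both (h s1 ⟨min_le_left _ _, le_max_left _ _⟩) h1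

lemma cross_of_line (μ : Measure V) [μ.IsAddHaarMeasure] {E S : Set V} (hE : MeasurableSet E) (w : V)
    (e : V ≃L[ℝ] ℝ × H) (he : e w = (1, 0)) (hc : LineCross ν (e.symm ⁻¹' E) (e.symm ⁻¹' S)) :
    ∀ᵐ x ∂μ, (x ∈ E ↔ x + w ∉ E) → x ∈ hitSet S w := by
  have h1 := ae_D0 μ hE
  have h2 : ∀ᵐ x ∂μ, (x + w ∈ E → D0 μ Eᶜ (x + w)) ∧ (x + w ∉ E → D0 μ E (x + w)) :=
    (measurePreserving_add_right μ w).quasiMeasurePreserving.ae h1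
  have h3 : ∀ᵐ z ∂(muX ν), ∀ s1 s2 : ℝ, D0 (muX ν) (e.symm ⁻¹' E)ᶜ (s1, z.2) →
      D0 (muX ν) (e.symm ⁻¹' E) (s2, z.2) → ∃ a ∈ uIcc s1 s2, (a, z.2) ∈ (e.symm ⁻¹' S) :=
    Measure.quasiMeasurePreserving_snd.ae hc
  have h4 := null_map μ (muX ν) e h3
  filter_upwards [h1, h2, h4] with x hx1 hx2 hx3 hxw
  have e1 : ((e x).1, (e x).2) = e x := rfl
  have e2 : ((e x).1 + 1, (e x).2) = e (x + w) := by
    rw [map_add, he]; ext <;> simp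
  have fin : ∀ a ∈ Icc (e x).1 ((e x).1 + 1), (a, (e x).2) ∈ e.symm ⁻¹' S → x ∈ hitSet S w := by
    intro a ha has
    refine ⟨a - (e x).1, ⟨by linarith [ha.1], by linarith [ha.2]⟩, ?_⟩
    have : (a, (e x).2) = e (x + (a - (e x).1) • w) := by
      rw [map_add, map_smul, he]; ext <;> simp
    rw [this] at has
    simpa using has
  by_cases hxE : x ∈ E
  · have hxw' := hxw.1 hxE
    obtain ⟨a, ha, has⟩ := hx3 (e x).1 ((e x).1 + 1)
      (by rw [e1, ← preimage_compl, D0.map_iff μ _ e]; simpa using hx1.1 hxE)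
      (by rw [e2, D0.map_iff μ _ e]; simpa using hx2.2 hxw')
    rw [uIcc_of_le (by linarith)] at ha
    exact fin a ha has
  · have hxw' : x + w ∈ E := by tauto
    obtain ⟨a, ha, has⟩ := hx3 ((e x).1 + 1) (e x).1
      (by rw [e2, ← preimage_compl, D0.map_iff μ _ e]; simpa using hx2.1 hxw')
      (by rw [e1, D0.map_iff μ _ e]; simpa using hx1.2 hxE)
    rw [uIcc_of_ge (by linarith)] at ha
    exact fin a ha has

lemma cross_bd (μ : Measure V) [μ.IsAddHaarMeasure] {E : Set V} (hE : MeasurableSet E) (w : V) :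
    ∀ᵐ x ∂μ, (x ∈ E ↔ x + w ∉ E) → x ∈ hitSet (bd μ E) w := by
  by_cases hw : w = 0
  · subst hw
    refine ae_of_all _ fun x hx => ?_
    simp at hx
  · obtain ⟨f, e, he, -⟩ := exists_split w hw
    refine cross_of_line (Measure.addHaar : Measure f.ker) μ hE w e he ?_
    rw [← bd_map μ (muX (Measure.addHaar : Measure f.ker)) e]
    exact lineCross_bd _ (e.symm.continuous.measurable hE)

end Cross


section ApproxDiff

open Module

variable {H : Type*} [NormedAddCommGroup H] [NormedSpace ℝ H] [FiniteDimensional ℝ H]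
  [MeasurableSpace H] [BorelSpace H] (ν : Measure H) [ν.IsAddHaarMeasure]

lemma D0.mono_local {A B : Set H} {x : H} {r : ℝ} (hr : 0 < r) (h : D0 ν B x)
    (hAB : A ∩ ball x r ⊆ B) : D0 ν A x := by
  intro ε hε
  obtain ⟨r', hr', h'⟩ := h ε hε
  refine ⟨min r r', lt_min hr hr', fun ρ h1 h2 => le_trans ?_ (h' ρ h1 (h2.trans_le (min_le_right _ _)))⟩
  refine measureReal_mono ?_ (fin_inter_ball ν B x ρ)
  rintro z ⟨hz1, hz2⟩
  exact ⟨hAB ⟨hz1, ball_subset_ball (h2.le.trans (min_le_left _ _)) hz2⟩, hz2⟩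

lemma isClosed_meas_ball_le (μ : Measure H) (r : ℝ) (c : ℝ≥0∞) :
    IsClosed {y | μ (ball y r) ≤ c} := by
  rw [← isOpen_compl_iff, Metric.isOpen_iff]
  intro y hy
  simp only [mem_compl_iff, Set.mem_ofPred_eq, not_le] at hy
  have hU : ball y r = ⋃ n : ℕ, ball y (r - 1 / ((n:ℝ) + 1)) := by
    ext z
    simp only [mem_ball, mem_iUnion]
    constructor
    · intro h
      obtain ⟨n, hn⟩ := exists_nat_one_div_lt (sub_pos.2 h)
      exact ⟨n, by linarith⟩
    · rintro ⟨n, hn⟩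
      have : 0 < 1 / ((n:ℝ) + 1) := by positivity
      linarith
  have hmono : Monotone fun n : ℕ => ball y (r - 1 / ((n:ℝ) + 1)) := by
    intro a b hab
    apply ball_subset_ball
    have : 1 / ((b:ℝ) + 1) ≤ 1 / ((a:ℝ) + 1) := by gcongr
    linarith
  rw [hU, hmono.measure_iUnion] at hy
  obtain ⟨n, hn⟩ := lt_iSup_iff.1 hy
  refine ⟨1 / ((n:ℝ) + 1), by positivity, fun z hz => ?_⟩
  simp only [mem_compl_iff, Set.mem_ofPred_eq, not_le]
  refine hn.trans_le (measure_mono ?_)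
  apply ball_subset_ball'
  rw [dist_comm]
  have := mem_ball.1 hz
  linarith

variable {ν}

lemma pair_int {f : H → ℝ} (hf : Measurable f) {μ : Measure H} {C : ℝ}
    (hC : ∀ (w y0 : H) (r : ℝ), 0 < r → ∫⁻ a in closedBall y0 r, ‖f (a + w) - f a‖ₑ ∂ν ≤
      ENNReal.ofReal (C * ‖w‖) * μ (closedBall y0 (r + ‖w‖))) (hC0 : 0 ≤ C) (y : H) {R : ℝ} (hR : 0 < R) :
    ∫⁻ a in closedBall y R, ∫⁻ b in closedBall y R, ‖f a - f b‖ₑ ∂ν ∂ν ≤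
      ν (closedBall (0:H) (2 * R)) * (ENNReal.ofReal (C * (2 * R)) * μ (closedBall y (3 * R))) := by
  have h1 : ∀ a ∈ closedBall y R, ∫⁻ b in closedBall y R, ‖f a - f b‖ₑ ∂ν ≤
      ∫⁻ w in closedBall (0:H) (2 * R), ‖f (a + w) - f a‖ₑ ∂ν := by
    intro a ha
    rw [← lintegral_indicator measurableSet_closedBall, ← lintegral_indicator measurableSet_closedBall,
      ← lintegral_add_left_eq_self _ a]
    refine lintegral_mono fun w => ?_
    by_cases hw : a + w ∈ closedBall y R
    · have : w ∈ closedBall (0:H) (2 * R) := by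
        rw [mem_closedBall_zero_iff]
        have h1 := mem_closedBall.1 hw
        have h2 := mem_closedBall.1 ha
        calc ‖w‖ = dist (a + w) a := by simp
          _ ≤ dist (a + w) y + dist a y := dist_triangle_right _ _ _
          _ ≤ _ := by linarith
      rw [indicator_of_mem hw, indicator_of_mem this, enorm_sub_rev]
    · rw [indicator_of_notMem hw]; exact zero_le
  have hm : Measurable fun p : H × H => ‖f (p.1 + p.2) - f p.1‖ₑ := by fun_prop
  calc _ ≤ ∫⁻ a in closedBall y R, ∫⁻ w in closedBall (0:H) (2 * R), ‖f (a + w) - f a‖ₑ ∂ν ∂ν :=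
        setLIntegral_mono' measurableSet_closedBall h1
    _ = ∫⁻ w in closedBall (0:H) (2 * R), ∫⁻ a in closedBall y R, ‖f (a + w) - f a‖ₑ ∂ν ∂ν := by
        exact lintegral_lintegral_swap hm.aemeasurable
    _ ≤ ∫⁻ w in closedBall (0:H) (2 * R), (ENNReal.ofReal (C * (2 * R)) * μ (closedBall y (3 * R))) ∂ν := by
        refine setLIntegral_mono' measurableSet_closedBall fun w hw => (hC w y R hR).trans ?_
        have := mem_closedBall_zero_iff.1 hw
        gcongr
        linarith
    _ = _ := by rw [setLIntegral_const, mul_comm]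

lemma avg_diff {f : H → ℝ} (hf : Measurable f) (hfi : LocallyIntegrable f ν) {U W B : Set H}
    (hUB : U ⊆ B) (hWB : W ⊆ B) (hU0 : 0 < ν.real U) (hW0 : 0 < ν.real W)
    (hB : IsCompact B) {K : ℝ} (hK0 : 0 ≤ K)
    (h : ∫⁻ a in B, ∫⁻ b in B, ‖f a - f b‖ₑ ∂ν ∂ν ≤ ENNReal.ofReal K) :
    |(⨍ a in U, f a ∂ν) - ⨍ b in W, f b ∂ν| ≤ K / (ν.real U * ν.real W) := by
  have hfB := hfi.integrableOn_isCompact hB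
  have hfU : Integrable f (ν.restrict U) := hfB.mono_set hUB
  have hfW : Integrable f (ν.restrict W) := hfB.mono_set hWB
  haveI : IsFiniteMeasure (ν.restrict U) := ⟨by
    rw [Measure.restrict_apply_univ]; exact (measure_mono hUB).trans_lt hB.measure_lt_top⟩
  haveI : IsFiniteMeasure (ν.restrict W) := ⟨by
    rw [Measure.restrict_apply_univ]; exact (measure_mono hWB).trans_lt hB.measure_lt_top⟩
  have e1 : ∫ a in U, ∫ b in W, (f a - f b) ∂ν ∂ν =
      ν.real W * (∫ a in U, f a ∂ν) - ν.real U * ∫ b in W, f b ∂ν := by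
    have : ∀ a, ∫ b in W, (f a - f b) ∂ν = ν.real W * f a - ∫ b in W, f b ∂ν := by
      intro a
      rw [integral_sub (integrable_const _) hfW, setIntegral_const, smul_eq_mul]
    simp_rw [this]
    rw [integral_sub (hfU.const_mul _) (integrable_const _), setIntegral_const, smul_eq_mul, integral_const_mul]
  have e2 : ‖∫ a in U, ∫ b in W, (f a - f b) ∂ν ∂ν‖ₑ ≤ ENNReal.ofReal K := by
    refine (enorm_integral_le_lintegral_enorm _).trans (le_trans ?_ h)
    calc _ ≤ ∫⁻ a in U, ∫⁻ b in W, ‖f a - f b‖ₑ ∂ν ∂ν :=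
          lintegral_mono fun a => enorm_integral_le_lintegral_enorm _
      _ ≤ ∫⁻ a in U, ∫⁻ b in B, ‖f a - f b‖ₑ ∂ν ∂ν :=
          lintegral_mono fun a => lintegral_mono_set hWB
      _ ≤ _ := lintegral_mono_set hUB
  rw [e1, ← ofReal_norm, ENNReal.ofReal_le_ofReal_iff hK0, Real.norm_eq_abs] at e2
  rw [le_div_iff₀ (by positivity), setAverage_eq, setAverage_eq, smul_eq_mul, smul_eq_mul]
  calc _ = |((ν.real U)⁻¹ * (∫ a in U, f a ∂ν) - (ν.real W)⁻¹ * ∫ b in W, f b ∂ν) * (ν.real U * ν.real W)| := by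
        rw [abs_mul, abs_of_pos (by positivity : 0 < ν.real U * ν.real W)]
    _ = |ν.real W * (∫ a in U, f a ∂ν) - ν.real U * ∫ b in W, f b ∂ν| := by
        congr 1; field_simp
    _ ≤ K := e2

end ApproxDiff


section ApproxDiff2

open Module

variable {H : Type*} [NormedAddCommGroup H] [NormedSpace ℝ H] [FiniteDimensional ℝ H]
  [MeasurableSpace H] [BorelSpace H] {ν : Measure H} [ν.IsAddHaarMeasure]

lemma avg_ball {f : H → ℝ} (hf : Measurable f) (hfi : LocallyIntegrable f ν) {μ : Measure H} {C : ℝ}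
    (hC : ∀ (w y0 : H) (r : ℝ), 0 < r → ∫⁻ a in closedBall y0 r, ‖f (a + w) - f a‖ₑ ∂ν ≤
      ENNReal.ofReal (C * ‖w‖) * μ (closedBall y0 (r + ‖w‖))) (hC0 : 0 ≤ C) {y y1 y2 : H} {R r1 r2 k : ℝ}
    (hR : 0 < R) (hk : 0 ≤ k) (h1 : R ≤ 2 * r1) (h2 : R ≤ 2 * r2)
    (hs1 : closedBall y1 r1 ⊆ closedBall y R) (hs2 : closedBall y2 r2 ⊆ closedBall y R)
    (hμ : μ (closedBall y (3 * R)) ≤ ENNReal.ofReal (k * R ^ finrank ℝ H)) :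
    |(⨍ a in closedBall y1 r1, f a ∂ν) - ⨍ b in closedBall y2 r2, f b ∂ν| ≤
      2 ^ (finrank ℝ H + 1) * 4 ^ finrank ℝ H * C / ν.real (ball (0:H) 1) * k * R := by
  set d := finrank ℝ H with hd
  set c := ν.real (ball (0:H) 1) with hc
  have hc0 : 0 < c := real_unit_pos ν
  have e1 := real_closedBall_eq ν y1 (by linarith : 0 ≤ r1)
  have e2 := real_closedBall_eq ν y2 (by linarith : 0 ≤ r2)
  have e3 := real_closedBall_eq ν (0:H) (by linarith : 0 ≤ 2 * R)
  rw [← hd, ← hc] at e1 e2 e3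
  have r1p : 0 < r1 := by linarith
  have r2p : 0 < r2 := by linarith
  have key := avg_diff hf hfi hs1 hs2 (by rw [e1]; positivity) (by rw [e2]; positivity)
    (isCompact_closedBall y R) (K := c * (2 * R) ^ d * (C * (2 * R) * (k * R ^ d))) (by positivity) (by
      refine (pair_int hf hC hC0 y hR).trans ?_
      have : ν (closedBall (0:H) (2 * R)) = ENNReal.ofReal (ν.real (closedBall (0:H) (2 * R))) := by
        rw [measureReal_def, ENNReal.ofReal_toReal (isCompact_closedBall _ _).measure_ne_top]
      rw [this, e3, mul_comm ((2 * R) ^ d) c, ENNReal.ofReal_mul (by positivity : 0 ≤ c * (2 * R) ^ d),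
        ENNReal.ofReal_mul (by positivity : 0 ≤ C * (2 * R))]
      gcongr)
  refine key.trans ?_
  rw [e1, e2, div_le_iff₀ (by positivity)]
  have hh1 : (R / 2) ^ d ≤ r1 ^ d := by gcongr; linarith
  have hh2 : (R / 2) ^ d ≤ r2 ^ d := by gcongr; linarith
  calc c * (2 * R) ^ d * (C * (2 * R) * (k * R ^ d))
      = 2 ^ (d + 1) * 4 ^ d * C / c * k * R * (((R / 2) ^ d * c) * ((R / 2) ^ d * c)) := by
        have h4 : (4:ℝ) ^ d = 2 ^ d * 2 ^ d := by rw [← mul_pow]; norm_num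
        rw [div_pow, mul_pow, h4]
        field_simp
        try ring
    _ ≤ _ := by gcongr

/-- points where the maximal function is controlled -/
def Dk (μ : Measure H) (k : ℕ) : Set H :=
  {y | ∀ r : ℝ, 0 < r → r < 1 / ((k:ℝ) + 1) → μ (ball y (4 * r)) ≤ ENNReal.ofReal (k * r ^ finrank ℝ H)}

lemma isClosed_Dk (μ : Measure H) (k : ℕ) : IsClosed (Dk μ k) := by
  have : Dk μ k = ⋂ (r : ℝ) (_ : 0 < r) (_ : r < 1 / ((k:ℝ) + 1)),
      {y | μ (ball y (4 * r)) ≤ ENNReal.ofReal (k * r ^ finrank ℝ H)} := by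
    ext; simp [Dk]
  rw [this]
  exact isClosed_iInter fun r => isClosed_iInter fun _ => isClosed_iInter fun _ =>
    isClosed_meas_ball_le μ _ _

lemma ae_Dk (μ : Measure H) [IsFiniteMeasure μ] : ∀ᵐ y ∂ν, ∃ k, y ∈ Dk μ k := by
  filter_upwards [Besicovitch.ae_tendsto_rnDeriv μ ν, Measure.rnDeriv_lt_top μ ν] with y hy hlt
  set d := finrank ℝ H with hd
  set c := ν.real (ball (0:H) 1) with hc
  have hc0 : 0 < c := real_unit_pos ν
  obtain ⟨q, hq1, hq2⟩ := ENNReal.lt_iff_exists_nnreal_btwn.1 hlt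
  have h1 := (hy.eventually_lt_const hq1)
  rw [eventually_nhdsWithin_iff, Metric.eventually_nhds_iff] at h1
  obtain ⟨δ, hδ, h1⟩ := h1
  obtain ⟨k, hk⟩ := exists_nat_gt (max (4 / δ) (q * (4 ^ d * c)))
  refine ⟨k, fun r hr hrk => ?_⟩
  have hk1 : 4 / δ < k := (le_max_left _ _).trans_lt hk
  have hk2 : q * (4 ^ d * c) < k := (le_max_right _ _).trans_lt hk
  have hr4 : 4 * r < δ := by
    rw [lt_div_iff₀ (by positivity)] at hrk
    rw [div_lt_iff₀ hδ] at hk1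
    by_contra hcon
    push Not at hcon
    nlinarith
  have h2 := h1 (y := 4 * r) (by simpa [abs_of_pos hr] using hr4) (by simp [hr])
  have e3 := real_closedBall_eq ν y (by linarith : 0 ≤ 4 * r)
  have hν : ν (closedBall y (4 * r)) = ENNReal.ofReal ((4 * r) ^ d * c) := by
    rw [← e3, measureReal_def, ENNReal.ofReal_toReal (isCompact_closedBall _ _).measure_ne_top]
  have h3 : μ (closedBall y (4 * r)) ≤ q * ν (closedBall y (4 * r)) :=
    (ENNReal.div_le_iff (measure_closedBall_pos ν y (by positivity)).ne'
      (isCompact_closedBall _ _).measure_ne_top).1 h2.le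
  refine (measure_mono ball_subset_closedBall).trans (h3.trans ?_)
  rw [hν, ← ENNReal.ofReal_coe_nnreal, ← ENNReal.ofReal_mul (by positivity)]
  apply ENNReal.ofReal_le_ofReal
  rw [mul_pow]
  calc (q:ℝ) * (4 ^ d * r ^ d * c) = (q * (4 ^ d * c)) * r ^ d := by ring
    _ ≤ _ := by gcongr

end ApproxDiff2


section ApproxDiff3

open Module

variable {H : Type*} [NormedAddCommGroup H] [NormedSpace ℝ H] [FiniteDimensional ℝ H]
  [MeasurableSpace H] [BorelSpace H] {ν : Measure H} [ν.IsAddHaarMeasure]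

lemma avg_lim {f : H → ℝ} (hf : Measurable f) (hfi : LocallyIntegrable f ν) {μ : Measure H} {C : ℝ}
    (hC : ∀ (w y0 : H) (r : ℝ), 0 < r → ∫⁻ a in closedBall y0 r, ‖f (a + w) - f a‖ₑ ∂ν ≤
      ENNReal.ofReal (C * ‖w‖) * μ (closedBall y0 (r + ‖w‖))) (hC0 : 0 ≤ C) {y : H} {k : ℕ}
    (hy : y ∈ Dk μ k)
    (hl : Tendsto (fun r => ⨍ a in closedBall y r, f a ∂ν) (𝓝[>] 0) (𝓝 (f y)))
    {r : ℝ} (hr : 0 < r) (hrk : r < 1 / ((k:ℝ) + 1)) :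
    |(⨍ a in closedBall y r, f a ∂ν) - f y| ≤
      2 * (2 ^ (finrank ℝ H + 1) * 4 ^ finrank ℝ H * C / ν.real (ball (0:H) 1)) * k * r := by
  set K := 2 ^ (finrank ℝ H + 1) * 4 ^ finrank ℝ H * C / ν.real (ball (0:H) 1) with hK
  have hK0 : 0 ≤ K := by positivity
  have hstep : ∀ s, 0 < s → s ≤ r →
      |(⨍ a in closedBall y s, f a ∂ν) - ⨍ a in closedBall y (s / 2), f a ∂ν| ≤ K * k * s := by
    intro s hs hsr
    refine avg_ball hf hfi hC hC0 hs (by positivity) (by linarith) (by linarith) subset_rfl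
      (closedBall_subset_closedBall (by linarith)) ?_
    refine (measure_mono ?_).trans (hy s hs (hsr.trans_lt hrk))
    exact closedBall_subset_ball (by linarith)
  have hj : ∀ j : ℕ, |(⨍ a in closedBall y r, f a ∂ν) - ⨍ a in closedBall y (r / 2 ^ j), f a ∂ν| ≤
      2 * K * k * r * (1 - 1 / 2 ^ j) := by
    intro j
    induction j with
    | zero => simp
    | succ j ih =>
      have h1 := hstep (r / 2 ^ j) (by positivity) (div_le_self hr.le (one_le_pow₀ (by norm_num)))
      rw [div_div, ← pow_succ] at h1
      refine (abs_sub_le _ _ _).trans ((add_le_add ih h1).trans (le_of_eq ?_))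
      rw [pow_succ]
      field_simp
      ring
  have hlim : Tendsto (fun j : ℕ => r / 2 ^ j) atTop (𝓝[>] 0) := by
    rw [tendsto_nhdsWithin_iff]
    refine ⟨?_, Eventually.of_forall fun j => by simp only [mem_Ioi]; positivity⟩
    have := (tendsto_pow_atTop_nhds_zero_of_lt_one (r := (1/2:ℝ)) (by norm_num) (by norm_num)).const_mul r
    simpa [div_eq_mul_inv] using this
  have h2 := ((hl.comp hlim).const_sub (⨍ a in closedBall y r, f a ∂ν)).abs
  refine le_of_tendsto h2 (Eventually.of_forall fun j => (hj j).trans ?_)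
  have : (0:ℝ) ≤ 1 / 2 ^ j := by positivity
  have h3 : 0 ≤ 2 * K * k * r := by positivity
  nlinarith

/-- Approximate differentiability almost everywhere. -/
lemma approx_diff {f : H → ℝ} (hf : Measurable f) {M : ℝ} (hM : ∀ y, |f y| ≤ M)
    {μ : Measure H} [IsFiniteMeasure μ] {C : ℝ}
    (hC : ∀ (w y0 : H) (r : ℝ), 0 < r → ∫⁻ a in closedBall y0 r, ‖f (a + w) - f a‖ₑ ∂ν ≤
      ENNReal.ofReal (C * ‖w‖) * μ (closedBall y0 (r + ‖w‖))) (hC0 : 0 ≤ C) :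
    ∀ᵐ y ∂ν, ∃ L : H →L[ℝ] ℝ, ∀ ε : ℝ, 0 < ε →
      D0 ν {z | ε * ‖z - y‖ < |f z - f y - L (z - y)|} y := by
  have hM0 : 0 ≤ M := (abs_nonneg _).trans (hM 0)
  have hfi : LocallyIntegrable f ν := by
    refine (locallyIntegrable_const (μ := ν) M).mono hf.aestronglyMeasurable (ae_of_all _ fun x => ?_)
    simpa [abs_of_nonneg hM0] using hM x
  set K := 2 ^ (finrank ℝ H + 1) * 4 ^ finrank ℝ H * C / ν.real (ball (0:H) 1) with hK
  have hK0 : 0 ≤ K := by positivity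
  have hleb : ∀ᵐ y ∂ν, Tendsto (fun r => ⨍ a in closedBall y r, f a ∂ν) (𝓝[>] 0) (𝓝 (f y)) := by
    filter_upwards [IsUnifLocDoublingMeasure.ae_tendsto_average ν hfi 1] with y hy
    refine hy (fun _ => y) (fun r => r) tendsto_id ?_
    filter_upwards [self_mem_nhdsWithin] with r hr
    exact mem_closedBall_self (by simpa using (mem_Ioi.1 hr).le)
  obtain ⟨G, hGs, hGm, hG0⟩ := (exists_measurable_superset_of_null hleb)
  have hall : ∀ᵐ y ∂ν, ∀ k, y ∈ Dk μ k → ∃ L : H →L[ℝ] ℝ, ∀ ε : ℝ, 0 < ε →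
      D0 ν {z | ε * ‖z - y‖ < |f z - f y - L (z - y)|} y := by
    rw [ae_all_iff]
    intro k
    set A := Dk μ k ∩ Gᶜ with hA
    have hAm : MeasurableSet A := (isClosed_Dk μ k).measurableSet.inter hGm.compl
    have hGl : ∀ y ∈ A, Tendsto (fun r => ⨍ a in closedBall y r, f a ∂ν) (𝓝[>] 0) (𝓝 (f y)) := by
      intro y hy
      by_contra h
      exact hy.2 (hGs h)
    set Q : ℝ≥0 := ⟨(6 * K + 4 * M) * ((k:ℝ) + 1), by positivity⟩ with hQ
    have hlip : LipschitzOnWith Q f A := by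
      refine LipschitzOnWith.of_dist_le_mul fun y hy z hz => ?_
      rcases eq_or_ne y z with rfl | hne
      · simp
      set r := dist y z with hr
      have hr0 : 0 < r := dist_pos.2 hne
      have hQc : (Q:ℝ) = (6 * K + 4 * M) * ((k:ℝ) + 1) := rfl
      rw [hQc, Real.dist_eq]
      by_cases h2 : 2 * r < 1 / ((k:ℝ) + 1)
      · have a1 := avg_lim hf hfi hC hC0 hy.1 (hGl y hy) hr0 (by linarith)
        have a2 := avg_lim hf hfi hC hC0 hz.1 (hGl z hz) hr0 (by linarith)
        have a3 := avg_ball hf hfi hC hC0 (y := y) (y1 := y) (y2 := z) (R := 2 * r) (r1 := r) (r2 := r)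
          (k := k) (by linarith) (by positivity) le_rfl le_rfl
          (closedBall_subset_closedBall (by linarith))
          (closedBall_subset_closedBall' (by rw [dist_comm]; linarith)) (by
            refine (measure_mono ?_).trans (hy.1 (2 * r) (by linarith) h2)
            exact closedBall_subset_ball (by linarith))
        rw [← hK] at a1 a2 a3
        rw [abs_le] at a1 a2 a3 ⊢
        have : 0 ≤ K * r := by positivity
        have : 0 ≤ M * k * r := by positivity
        have : 0 ≤ M * r := by positivity
        constructor <;> nlinarith [a1.1, a1.2, a2.1, a2.2, a3.1, a3.2]
      · push Not at h2
        rw [div_le_iff₀ (by positivity)] at h2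
        have b1 := abs_le.1 (hM y)
        have b2 := abs_le.1 (hM z)
        have b3 : |f y - f z| ≤ 2 * M := by rw [abs_le]; constructor <;> linarith
        have : 0 ≤ K * ((k:ℝ) + 1) * r := by positivity
        nlinarith
    obtain ⟨g, hg, hgf⟩ := hlip.extend_real
    have hGae : ∀ᵐ y ∂ν, y ∉ G := by
      rw [ae_iff]; simpa using hG0
    filter_upwards [hg.ae_differentiableAt (μ := ν), ae_D0 ν hAm, hGae] with y hy1 hy2 hy3 hyk
    have hyA : y ∈ A := ⟨hyk, hy3⟩
    refine ⟨fderiv ℝ g y, fun ε hε => ?_⟩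
    have := hy1.hasFDerivAt.isLittleO.def hε
    rw [Metric.eventually_nhds_iff] at this
    obtain ⟨δ, hδ, h3⟩ := this
    refine D0.mono_local ν hδ (hy2.1 hyA) ?_
    rintro z ⟨hz1, hz2⟩ hzA
    have h4 := h3 hz2
    rw [← hgf hzA, ← hgf hyA] at h4
    simp only [Set.mem_ofPred_eq] at hz1
    rw [Real.norm_eq_abs] at h4
    linarith
  filter_upwards [hall, ae_Dk (ν := ν) μ] with y h1 ⟨k, hk⟩
  exact h1 k hk

end ApproxDiff3


section LineRB

open Module

lemma cross_point {I O P : Set ℝ} (hP : P.Finite) (hIout : ∀ s, s ∈ I → s ∉ O) (hIP : ∀ s, s ∈ I → s ∉ P)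
    (hOP : ∀ s, s ∈ O → s ∉ P) (hall : ∀ s, s ∉ P → s ∈ I ∨ s ∈ O)
    (hconst : ∀ a b : ℝ, (∀ s ∈ Icc a b, s ∈ I ∨ s ∈ O) → (∀ s ∈ Icc a b, s ∈ I) ∨ (∀ s ∈ Icc a b, s ∈ O))
    {s1 s2 : ℝ} (h1 : s1 ∈ I) (h2 : s2 ∈ O) (h12 : s1 < s2) :
    ∃ a ∈ Icc s1 s2, ∃ η > 0, Ioo (a - η) a ⊆ I ∧ Ioo a (a + η) ⊆ O := by
  set S := I ∩ Icc s1 s2 with hS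
  have hne : S.Nonempty := ⟨s1, h1, le_rfl, h12.le⟩
  have hbdd : BddAbove S := ⟨s2, fun x hx => hx.2.2⟩
  set a := sSup S with ha
  have ha1 : s1 ≤ a := le_csSup hbdd ⟨h1, le_rfl, h12.le⟩
  have ha2 : a ≤ s2 := csSup_le hne fun x hx => hx.2.2
  have hopen : IsOpen (P \ {a})ᶜ := (hP.subset sdiff_subset).isClosed.isOpen_compl
  obtain ⟨η, hη, hball⟩ := Metric.isOpen_iff.1 hopen a (by simp)
  have hnP : ∀ s, |s - a| < η → s ≠ a → s ∉ P := by
    intro s hs hsa hsP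
    exact hball (by simpa [Real.dist_eq] using hs) ⟨hsP, by simpa using hsa⟩
  have haP : a ∈ P := by
    by_contra hcon
    have hc : ∀ s, |s - a| < η → s ∈ I ∨ s ∈ O := fun s hs => by
      rcases eq_or_ne s a with rfl | hsa
      · exact hall _ hcon
      · exact hall _ (hnP s hs hsa)
    obtain ⟨x, hx, hxa⟩ := exists_lt_of_lt_csSup hne (show a - η / 2 < sSup S by linarith)
    have hxa' : x ≤ a := le_csSup hbdd hx
    rcases hconst (a - η / 2) (a + η / 2) (fun s hs => hc s (by
      rw [abs_lt]; constructor <;> linarith [hs.1, hs.2])) with h | h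
    · rcases eq_or_lt_of_le ha2 with h3 | h3
      · exact hIout s2 (h s2 ⟨by linarith, by linarith⟩) h2
      · have hmem : min (a + η / 2) s2 ∈ S := ⟨h _ ⟨le_min (by linarith) (by linarith), min_le_left _ _⟩,
          le_min (by linarith) h12.le, min_le_right _ _⟩
        have := le_csSup hbdd hmem
        have h4 : a < min (a + η / 2) s2 := lt_min (by linarith) h3
        linarith
    · exact hIout x hx.1 (h x ⟨by linarith, by linarith⟩)
  have has2 : a < s2 := lt_of_le_of_ne ha2 fun h => hOP s2 h2 (h ▸ haP)
  refine ⟨a, ⟨ha1, ha2⟩, min η (s2 - a), lt_min hη (by linarith), ?_, ?_⟩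
  · intro s hs
    have hs1 : a - η < s := by linarith [hs.1, min_le_left η (s2 - a)]
    obtain ⟨x, hx, hxa⟩ := exists_lt_of_lt_csSup hne (show s < sSup S from hs.2)
    have hxa' : x < a := lt_of_le_of_ne (le_csSup hbdd hx) fun h => hIP x hx.1 (h ▸ haP)
    rcases hconst s x (fun t ht => hall t (hnP t (by rw [abs_lt]; constructor <;> linarith [ht.1, ht.2])
      (by linarith [ht.2] : t < a).ne)) with h | h
    · exact h s ⟨le_rfl, hxa.le⟩
    · exact absurd (h x ⟨hxa.le, le_rfl⟩) (hIout x hx.1)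
  · intro s hs
    have hs1 : s < a + η := by linarith [hs.2, min_le_left η (s2 - a)]
    have hs2 : s < s2 := by linarith [hs.2, min_le_right η (s2 - a)]
    rcases hall s (hnP s (by rw [abs_lt]; constructor <;> linarith [hs.1]) hs.1.ne') with h | h
    · have := le_csSup hbdd (⟨h, by linarith [hs.1], hs2.le⟩ : s ∈ S)
      linarith [hs.1]
    · exact h

variable {H : Type*} [NormedAddCommGroup H] [NormedSpace ℝ H] [FiniteDimensional ℝ H]
  [MeasurableSpace H] [BorelSpace H] (ν : Measure H) [ν.IsAddHaarMeasure]

/-- slice length function -/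
noncomputable def slf (E : Set (ℝ × H)) (α β : ℝ) (y : H) : ℝ := volume.real {s : ℝ | s ∈ Ioo α β ∧ (s, y) ∈ E}

lemma slf_meas {E : Set (ℝ × H)} (hE : MeasurableSet E) (α β : ℝ) : Measurable (slf E α β) := by
  have : MeasurableSet {x : ℝ × H | x.1 ∈ Ioo α β ∧ x ∈ E} :=
    (measurable_fst measurableSet_Ioo).inter hE
  exact (measurable_measure_prodMk_right this).ennreal_toReal

lemma slf_fin (E : Set (ℝ × H)) (α β : ℝ) (y : H) : volume {s : ℝ | s ∈ Ioo α β ∧ (s, y) ∈ E} ≠ ⊤ :=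
  measure_ne_top_of_subset (fun _ h => h.1) (by simp : volume (Ioo α β) ≠ ⊤)

lemma slf_bdd (E : Set (ℝ × H)) {α β : ℝ} (hαβ : α < β) (y : H) : |slf E α β y| ≤ β - α := by
  rw [slf, abs_of_nonneg measureReal_nonneg]
  have : volume.real (Ioo α β) = β - α := by simp [hαβ.le]
  rw [← this]
  exact measureReal_mono (fun _ h => h.1) (by simp)

lemma slf_diff {E : Set (ℝ × H)} (hE : MeasurableSet E) {d : ℕ} (hd : 1 ≤ d) (hH : finrank ℝ H = d)
    (hb : μH[(d:ℝ)] (bd (muX ν) E) ≠ ⊤) (α β : ℝ) (w y0 : H) (r : ℝ) :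
    ∫⁻ a in closedBall y0 r, ‖slf E α β (a + w) - slf E α β a‖ₑ ∂ν ≤
      ENNReal.ofReal ((muX ν).real (ball 0 1) * 2 ^ (d + 1) * ‖w‖) *
        (Measure.map Prod.snd ((μH[(d:ℝ)] : Measure (ℝ × H)).restrict (bd (muX ν) E)))
          (closedBall y0 (r + ‖w‖)) := by
  set A : Set (ℝ × H) := {x | x ∈ E ↔ x + ((0:ℝ), w) ∉ E} with hA
  have hshift : Measurable fun x : ℝ × H => x + ((0:ℝ), w) := measurable_add_const _
  have hAm : MeasurableSet A := by
    have : A = {x | x ∈ E ∧ x + ((0:ℝ), w) ∉ E} ∪ {x | x ∉ E ∧ x + ((0:ℝ), w) ∈ E} := by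
      ext x; simp only [hA, Set.mem_ofPred_eq, mem_union]; tauto
    rw [this]
    exact (hE.inter (hshift hE.compl)).union (hE.compl.inter (hshift hE))
  have step1 : ∀ a, ‖slf E α β (a + w) - slf E α β a‖ₑ ≤ volume {s : ℝ | (s, a) ∈ A} := by
    intro a
    rw [← ofReal_norm, Real.norm_eq_abs]
    by_cases htop : volume {s : ℝ | (s, a) ∈ A} = ⊤
    · rw [htop]; exact le_top
    rw [← ENNReal.ofReal_toReal htop]
    apply ENNReal.ofReal_le_ofReal
    have hsub : ∀ b c : H, (∀ s, (s, b) ∈ E → (s, c) ∉ E → (s, a) ∈ A) →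
        slf E α β b ≤ slf E α β c + (volume {s : ℝ | (s, a) ∈ A}).toReal := by
      intro b c hbc
      have : {s : ℝ | s ∈ Ioo α β ∧ (s, b) ∈ E} ⊆ {s : ℝ | s ∈ Ioo α β ∧ (s, c) ∈ E} ∪ {s : ℝ | (s, a) ∈ A} := by
        rintro s ⟨hs1, hs2⟩
        by_cases h : (s, c) ∈ E
        · exact Or.inl ⟨hs1, h⟩
        · exact Or.inr (hbc s hs2 h)
      refine (measureReal_mono this ?_).trans (measureReal_union_le _ _)
      exact (measure_union_lt_top (slf_fin E α β c).lt_top (lt_top_iff_ne_top.2 htop)).ne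
    rw [abs_le]
    have e : ∀ s, (s, a) + ((0:ℝ), w) = (s, a + w) := fun s => by simp
    have h1 := hsub (a + w) a (fun s h1 h2 => by
      simp only [hA, Set.mem_ofPred_eq, e]; tauto)
    have h2 := hsub a (a + w) (fun s h1 h2 => by
      simp only [hA, Set.mem_ofPred_eq, e]; tauto)
    constructor <;> linarith
  have step2 : ∫⁻ a in closedBall y0 r, volume {s : ℝ | (s, a) ∈ A} ∂ν =
      muX ν (A ∩ (Prod.snd ⁻¹' closedBall y0 r)) := by
    rw [muX, Measure.prod_apply_symm (hAm.inter (measurable_snd measurableSet_closedBall)),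
      ← lintegral_indicator measurableSet_closedBall]
    congr 1
    ext a
    by_cases ha : a ∈ closedBall y0 r
    · rw [indicator_of_mem ha]; congr 1; ext s; simp only [mem_preimage, mem_inter_iff, Set.mem_ofPred_eq, ha, and_true]
    · rw [indicator_of_notMem ha]
      symm
      convert measure_empty (μ := (volume : Measure ℝ))
      ext s; simp only [mem_preimage, mem_inter_iff, ha, and_false, mem_empty_iff_false]
  set B' := bd (muX ν) E ∩ (Prod.snd ⁻¹' closedBall y0 (r + ‖w‖)) with hB'
  have step3 : muX ν (A ∩ (Prod.snd ⁻¹' closedBall y0 r)) ≤ muX ν (hitSet B' ((0:ℝ), w)) := by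
    apply measure_mono_ae
    filter_upwards [cross_bd (muX ν) hE ((0:ℝ), w)] with x hx hxA
    obtain ⟨t, ht, htx⟩ := hx hxA.1
    refine ⟨t, ht, htx, ?_⟩
    have h1 := mem_closedBall.1 hxA.2
    simp only [mem_preimage, mem_closedBall, Prod.snd_add, Prod.smul_snd]
    calc dist (x.2 + t • w) y0 ≤ dist (x.2 + t • w) x.2 + dist x.2 y0 := dist_triangle _ _ _
      _ ≤ ‖w‖ + r := by
        refine add_le_add ?_ h1
        rw [dist_self_add_left, norm_smul, Real.norm_eq_abs, abs_of_nonneg ht.1]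
        exact mul_le_of_le_one_left (norm_nonneg _) ht.2
      _ = _ := add_comm _ _
  have hfin : μH[(d:ℝ)] B' ≠ ⊤ := measure_ne_top_of_subset inter_subset_left hb
  have step4 := hit_le (muX ν) hd (by rw [finrank_prodR, hH]) hfin ((0:ℝ), w)
  have hnw : ‖((0:ℝ), w)‖ = ‖w‖ := by simp
  rw [hnw] at step4
  rw [Measure.map_apply measurable_snd measurableSet_closedBall,
    Measure.restrict_apply (measurable_snd measurableSet_closedBall), inter_comm]
  calc _ ≤ ∫⁻ a in closedBall y0 r, volume {s : ℝ | (s, a) ∈ A} ∂ν := lintegral_mono step1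
    _ ≤ _ := by rw [step2]; exact step3.trans step4

end LineRB


section LineRB2

open Module

variable {H : Type*} [NormedAddCommGroup H] [NormedSpace ℝ H] [FiniteDimensional ℝ H]
  [MeasurableSpace H] [BorelSpace H] (ν : Measure H) [ν.IsAddHaarMeasure]

/-- deviation of `E` from the subgraph of `α + slf` -/
def devS (E : Set (ℝ × H)) (α β : ℝ) : Set (ℝ × H) :=
  {x | x.1 ∈ Ioo α β ∧ ((x ∉ E ∧ x.1 < α + slf E α β x.2) ∨ (x ∈ E ∧ α + slf E α β x.2 < x.1))}

lemma devS_meas {E : Set (ℝ × H)} (hE : MeasurableSet E) (α β : ℝ) : MeasurableSet (devS E α β) := by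
  have hm : Measurable fun x : ℝ × H => α + slf E α β x.2 :=
    ((slf_meas hE α β).comp measurable_snd).const_add α
  exact (measurable_fst measurableSet_Ioo).inter
    ((hE.compl.inter (measurableSet_lt measurable_fst hm)).union
      (hE.inter (measurableSet_lt hm measurable_fst)))

/-- lines on which `E` is a subgraph in `(α, β)` -/
def subY (E : Set (ℝ × H)) (α β : ℝ) : Set H :=
  {y | volume {s : ℝ | (s, y) ∈ devS E α β} = 0 ∧ slf E α β y ∈ Ioo 0 (β - α)}

lemma subY_meas {E : Set (ℝ × H)} (hE : MeasurableSet E) (α β : ℝ) : MeasurableSet (subY E α β) :=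
  ((measurable_measure_prodMk_right (devS_meas hE α β)) (measurableSet_singleton 0)).inter
    ((slf_meas hE α β) measurableSet_Ioo)

lemma RB_of_graph {E : Set (ℝ × H)} (hE : MeasurableSet E) {α β : ℝ} {y : H}
    (hy : y ∈ subY E α β) (hD : D0 ν (subY E α β)ᶜ y) {L : H →L[ℝ] ℝ}
    (hL : ∀ ε : ℝ, 0 < ε → D0 ν {z | ε * ‖z - y‖ < |slf E α β z - slf E α β y - L (z - y)|} y) :
    (α + slf E α β y, y) ∈ RB (muX ν) E := by
  set f := slf E α β with hf
  set a := α + f y with ha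
  set d := finrank ℝ H with hd
  set c := ν.real (ball (0:H) 1) with hc
  have hc0 : 0 < c := real_unit_pos ν
  obtain ⟨hy1, hy2, hy3⟩ := hy
  set Λ : (ℝ × H) →L[ℝ] ℝ := ContinuousLinearMap.fst ℝ ℝ H - L.comp (ContinuousLinearMap.snd ℝ ℝ H) with hΛ
  have hΛv : ∀ x : ℝ × H, Λ (x - (a, y)) = x.1 - a - L (x.2 - y) := fun x => by simp [hΛ]
  have hnull : muX ν (devS E α β ∩ Prod.snd ⁻¹' subY E α β) = 0 := by
    rw [muX, Measure.prod_apply_symm ((devS_meas hE α β).inter (measurable_snd (subY_meas hE α β)))]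
    rw [lintegral_eq_zero_iff' (measurable_measure_prodMk_right
      ((devS_meas hE α β).inter (measurable_snd (subY_meas hE α β)))).aemeasurable]
    refine ae_of_all _ fun z => ?_
    simp only [Pi.zero_apply]
    by_cases hz : z ∈ subY E α β
    · exact measure_mono_null (fun s hs => hs.1) hz.1
    · convert measure_empty (μ := (volume : Measure ℝ))
      ext s; simp [hz]
  have key : D0 (muX ν) {x | (x ∈ E ∧ 0 < Λ (x - (a, y))) ∨ (x ∉ E ∧ Λ (x - (a, y)) < 0)} (a, y) := by
    intro ε hε
    set ε' := ε / (4 + 2 * c) with hε'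
    have hε'0 : 0 < ε' := by positivity
    obtain ⟨r1, hr1, h1⟩ := hD ε' hε'0
    obtain ⟨r2, hr2, h2⟩ := hL ε' hε'0 ε' hε'0
    refine ⟨min (min r1 r2) (min (f y) (β - α - f y)),
      lt_min (lt_min hr1 hr2) (lt_min hy2 (by linarith)), fun ρ hρ hρlt => ?_⟩
    have l1 : ρ < r1 := hρlt.trans_le ((min_le_left _ _).trans (min_le_left _ _))
    have l2 : ρ < r2 := hρlt.trans_le ((min_le_left _ _).trans (min_le_right _ _))
    have l3 : ρ < f y := hρlt.trans_le ((min_le_right _ _).trans (min_le_left _ _))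
    have l4 : ρ < β - α - f y := hρlt.trans_le ((min_le_right _ _).trans (min_le_right _ _))
    set B := {z | ε' * ‖z - y‖ < |f z - f y - L (z - y)|} with hB
    set S1 : Set (ℝ × H) := Ioo (a - ρ) (a + ρ) ×ˢ ((subY E α β)ᶜ ∩ ball y ρ) with hS1
    set S2 : Set (ℝ × H) := Ioo (a - ρ) (a + ρ) ×ˢ (B ∩ ball y ρ) with hS2
    set S3 : Set (ℝ × H) := {x | x.2 ∈ ball y ρ ∧ |x.1 - a - L (x.2 - y)| ≤ ε' * ρ} with hS3
    set S4 := devS E α β ∩ Prod.snd ⁻¹' subY E α β with hS4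
    have hsub : {x | (x ∈ E ∧ 0 < Λ (x - (a, y))) ∨ (x ∉ E ∧ Λ (x - (a, y)) < 0)} ∩ ball (a, y) ρ ⊆
        (S1 ∪ S2) ∪ (S3 ∪ S4) := by
      rintro x ⟨hx, hxb⟩
      rw [← ball_prod_same] at hxb
      obtain ⟨hb1, hb2⟩ := hxb
      rw [Real.ball_eq_Ioo] at hb1
      by_cases hxY : x.2 ∈ subY E α β
      swap
      · exact Or.inl (Or.inl ⟨hb1, hxY, hb2⟩)
      by_cases hxB : x.2 ∈ B
      · exact Or.inl (Or.inr ⟨hb1, hxB, hb2⟩)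
      right
      by_cases hx4 : x ∈ devS E α β
      · exact Or.inr ⟨hx4, hxY⟩
      left
      refine ⟨hb2, ?_⟩
      simp only [hB, Set.mem_ofPred_eq, not_lt] at hxB
      have hxn : ‖x.2 - y‖ < ρ := by simpa [dist_eq_norm] using hb2
      have hxB' : |f x.2 - f y - L (x.2 - y)| ≤ ε' * ρ := hxB.trans (by gcongr)
      have hin : x.1 ∈ Ioo α β := ⟨by linarith [hb1.1], by linarith [hb1.2]⟩
      simp only [devS, Set.mem_ofPred_eq, not_and_or, not_or, not_lt] at hx4
      have hx4' := hx4.resolve_left (fun h => h hin)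
      simp only [Set.mem_ofPred_eq, hΛv] at hx
      rw [abs_le] at hxB' ⊢
      rcases hx with ⟨hxE, hx⟩ | ⟨hxE, hx⟩
      · have := hx4'.2.resolve_left (fun h => h hxE)
        have h0 : 0 ≤ ε' * ρ := by positivity
        constructor <;> linarith [hxB'.1, hxB'.2]
      · have := hx4'.1.resolve_left (fun h => h hxE)
        have h0 : 0 ≤ ε' * ρ := by positivity
        constructor <;> linarith [hxB'.1, hxB'.2]
    have hvol : volume (Ioo (a - ρ) (a + ρ)) = ENNReal.ofReal (2 * ρ) := by
      rw [Real.volume_Ioo]; congr 1; ring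
    have toE : ∀ A : Set H, ν (A ∩ ball y ρ) = ENNReal.ofReal (ν.real (A ∩ ball y ρ)) := fun A => by
      rw [measureReal_def, ENNReal.ofReal_toReal (fin_inter_ball ν A y ρ)]
    have m1 : muX ν S1 ≤ ENNReal.ofReal (2 * ρ * (ε' * ρ ^ d)) := by
      rw [hS1, muX, Measure.prod_prod, hvol, toE, ← ENNReal.ofReal_mul (by positivity)]
      apply ENNReal.ofReal_le_ofReal
      have := h1 ρ hρ l1
      gcongr
    have m2 : muX ν S2 ≤ ENNReal.ofReal (2 * ρ * (ε' * ρ ^ d)) := by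
      rw [hS2, muX, Measure.prod_prod, hvol, toE, ← ENNReal.ofReal_mul (by positivity)]
      apply ENNReal.ofReal_le_ofReal
      have := h2 ρ hρ l2
      gcongr
    have m3 : muX ν S3 ≤ ENNReal.ofReal (2 * (ε' * ρ) * (ρ ^ d * c)) := by
      have hm : MeasurableSet S3 := by
        refine (measurable_snd measurableSet_ball).inter ?_
        have hc1 : Continuous fun x : ℝ × H => |x.1 - a - L (x.2 - y)| := by fun_prop
        exact measurableSet_le hc1.measurable measurable_const
      rw [muX, Measure.prod_apply_symm hm]
      calc _ ≤ ∫⁻ z, (ball y ρ).indicator (fun _ => ENNReal.ofReal (2 * (ε' * ρ))) z ∂ν := by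
            refine lintegral_mono fun z => ?_
            by_cases hz : z ∈ ball y ρ
            · rw [indicator_of_mem hz]
              calc _ ≤ volume (Icc (a + L (z - y) - ε' * ρ) (a + L (z - y) + ε' * ρ)) := by
                    refine measure_mono fun s hs => ?_
                    have := abs_le.1 hs.2
                    simp only at this
                    exact ⟨by linarith [this.1], by linarith [this.2]⟩
                _ = _ := by rw [Real.volume_Icc]; congr 1; ring
            · rw [indicator_of_notMem hz]
              refine le_of_eq ?_
              convert measure_empty (μ := (volume : Measure ℝ))
              ext s; simp only [hS3, mem_preimage, Set.mem_ofPred_eq, hz, false_and, mem_empty_iff_false]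
        _ = ENNReal.ofReal (2 * (ε' * ρ)) * ν (ball y ρ) := by
            rw [lintegral_indicator measurableSet_ball, setLIntegral_const]
        _ = _ := by
            have := toE univ
            rw [univ_inter, real_ball_eq ν y hρ] at this
            rw [this, ← ENNReal.ofReal_mul (by positivity)]
    rw [measureReal_def]
    refine ENNReal.toReal_le_of_le_ofReal (by positivity) ?_
    calc _ ≤ muX ν ((S1 ∪ S2) ∪ (S3 ∪ S4)) := measure_mono hsub
      _ ≤ (muX ν S1 + muX ν S2) + (muX ν S3 + muX ν S4) :=
          (measure_union_le _ _).trans (add_le_add (measure_union_le _ _) (measure_union_le _ _))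
      _ ≤ (ENNReal.ofReal (2 * ρ * (ε' * ρ ^ d)) + ENNReal.ofReal (2 * ρ * (ε' * ρ ^ d))) +
          (ENNReal.ofReal (2 * (ε' * ρ) * (ρ ^ d * c)) + 0) := by
          rw [hnull]; gcongr
      _ = ENNReal.ofReal (ε * ρ ^ finrank ℝ (ℝ × H)) := by
          rw [add_zero, ← ENNReal.ofReal_add (by positivity) (by positivity),
            ← ENNReal.ofReal_add (by positivity) (by positivity), finrank_prodR, ← hd, pow_succ]
          congr 1
          have : ε = ε' * (4 + 2 * c) := by rw [hε']; field_simp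
          rw [this]; ring
  refine ⟨Λ, ?_, key.mono fun x hx => Or.inl hx, key.mono fun x hx => Or.inr hx⟩
  intro h0
  have := congrArg (fun g : (ℝ × H) →L[ℝ] ℝ => g (1, 0)) h0
  simp [hΛ] at this

lemma line_RB_lt {E : Set (ℝ × H)} (hE : MeasurableSet E) {d : ℕ} (hd : 1 ≤ d) (hH : finrank ℝ H = d)
    (hb : μH[(d:ℝ)] (bd (muX ν) E) ≠ ⊤) :
    ∀ᵐ y ∂ν, ∀ s1 s2 : ℝ, s1 < s2 → D0 (muX ν) Eᶜ (s1, y) → D0 (muX ν) E (s2, y) →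
      ∃ a ∈ Icc s1 s2, (a, y) ∈ RB (muX ν) E := by
  haveI : IsFiniteMeasure (Measure.map Prod.snd ((μH[(d:ℝ)] : Measure (ℝ × H)).restrict (bd (muX ν) E))) := by
    haveI : IsFiniteMeasure ((μH[(d:ℝ)] : Measure (ℝ × H)).restrict (bd (muX ν) E)) :=
      ⟨by rw [Measure.restrict_apply_univ]; exact lt_top_iff_ne_top.2 hb⟩
    infer_instance
  have hY : ∀ᵐ y ∂ν, ∀ α β : ℚ, (α:ℝ) < β → y ∈ subY E α β → (α + slf E α β y, y) ∈ RB (muX ν) E := by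
    rw [ae_all_iff]; intro α
    rw [ae_all_iff]; intro β
    by_cases hαβ : (α:ℝ) < β
    swap
    · exact ae_of_all _ fun y h => absurd h hαβ
    filter_upwards [approx_diff (ν := ν) (slf_meas hE α β) (slf_bdd E hαβ)
      (fun w y0 r _ => by
        have := slf_diff ν hE hd hH hb α β w y0 r
        exact this) (by positivity), ae_D0 ν (subY_meas hE α β)] with y h1 h2 _ hy
    obtain ⟨L, hL⟩ := h1
    exact RB_of_graph ν hE hy (h2.1 hy) hL
  filter_upwards [hY, line_const ν hE, ae_line_D0 ν hE, finite_hits ν hd hH hb] with y g1 g2 g3 g4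
  intro s1 s2 h12 h1 h2
  obtain ⟨a, ha, η, hη, hI, hO⟩ := cross_point (I := {s | D0 (muX ν) Eᶜ (s, y)}) (O := {s | D0 (muX ν) E (s, y)})
    g4 (fun s hs hs' => not_D0_both hs' hs) (fun s hs hs' => hs'.2 hs) (fun s hs hs' => hs'.1 hs)
    (fun s hs => by
      simp only [bd, Set.mem_ofPred_eq] at hs ⊢
      tauto) g2 h1 h2 h12
  refine ⟨a, ha, ?_⟩
  obtain ⟨α, hα1, hα2⟩ := exists_rat_btwn (show a - η < a by linarith)
  obtain ⟨β, hβ1, hβ2⟩ := exists_rat_btwn (show a < a + η by linarith)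
  have hdev : ∀ᵐ s : ℝ, s ∈ Ioo (α:ℝ) β → ((s, y) ∈ E ↔ s < a) := by
    filter_upwards [g3, (show ∀ᵐ s : ℝ, s ≠ a by simp [ae_iff])] with s hs hsa hsab
    constructor
    · intro hsE
      by_contra hcon
      have : a < s := lt_of_le_of_ne (not_lt.1 hcon) hsa.symm
      exact not_D0_both (hO ⟨this, by linarith [hsab.2]⟩) (hs.1 hsE)
    · intro hlt
      by_contra hcon
      exact not_D0_both (hs.2 hcon) (hI ⟨by linarith [hsab.1], hlt⟩)
  have hsl : slf E α β y = a - α := by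
    have : volume {s : ℝ | s ∈ Ioo (α:ℝ) β ∧ (s, y) ∈ E} = volume (Ioo (α:ℝ) a) := by
      apply measure_congr
      filter_upwards [hdev] with s hs
      apply propext
      change (s ∈ Ioo (α:ℝ) β ∧ (s, y) ∈ E) ↔ s ∈ Ioo (α:ℝ) a
      constructor
      · rintro ⟨h3, h4⟩
        exact ⟨h3.1, (hs h3).1 h4⟩
      · rintro ⟨h3, h4⟩
        have : s ∈ Ioo (α:ℝ) β := ⟨h3, by linarith⟩
        exact ⟨this, (hs this).2 h4⟩
    rw [slf, measureReal_def, this, Real.volume_Ioo, ENNReal.toReal_ofReal (by linarith)]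
  have hyY : y ∈ subY E α β := by
    refine ⟨?_, by rw [hsl]; exact ⟨by linarith, by linarith⟩⟩
    have : ∀ᵐ s : ℝ, s ∉ {s : ℝ | (s, y) ∈ devS E α β} := by
      filter_upwards [hdev] with s hs hcon
      simp only [devS, Set.mem_ofPred_eq, hsl] at hcon
      obtain ⟨h3, h4 | h4⟩ := hcon
      · exact h4.1 ((hs h3).2 (by linarith [h4.2]))
      · linarith [(hs h3).1 h4.1, h4.2]
    simpa [ae_iff] using this
  have := g1 α β (by linarith) hyY
  rw [hsl] at this
  simpa using this

lemma lineCross_RB {E : Set (ℝ × H)} (hE : MeasurableSet E) {d : ℕ} (hd : 1 ≤ d) (hH : finrank ℝ H = d)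
    (hb : μH[(d:ℝ)] (bd (muX ν) E) ≠ ⊤) : LineCross ν E (RB (muX ν) E) := by
  filter_upwards [line_RB_lt ν hE hd hH hb, line_RB_lt ν hE.compl hd hH (by rwa [bd_compl])] with y h1 h2
  intro s1 s2 hs1 hs2
  rcases lt_trichotomy s1 s2 with h | h | h
  · rw [uIcc_of_le h.le]; exact h1 s1 s2 h hs1 hs2
  · subst h; exact absurd hs1 (fun h => not_D0_both hs2 h)
  · rw [uIcc_of_ge h.le, ← RB_compl]
    exact h2 s2 s1 h (by rwa [compl_compl]) hs1

end LineRB2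


section ThmA

open Module

variable {V : Type*} [NormedAddCommGroup V] [NormedSpace ℝ V] [FiniteDimensional ℝ V]
  [MeasurableSpace V] [BorelSpace V] (μ : Measure V) [μ.IsAddHaarMeasure]

lemma not_D0_half {Λ : V →L[ℝ] ℝ} (hΛ : Λ ≠ 0) (x : V) : ¬ D0 μ {y | Λ (y - x) < 0} x := by
  intro h
  obtain ⟨u, hu⟩ : ∃ u, 0 < Λ u := by
    by_contra hcon
    push Not at hcon
    apply hΛ
    ext u
    have h1 := hcon u
    have h2 := hcon (-u)
    simp only [map_neg] at h2
    simp; linarith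
  have hu0 : u ≠ 0 := by rintro rfl; simp at hu
  have hun : 0 < ‖u‖ := norm_pos_iff.2 hu0
  have hΛn : 0 < ‖Λ‖ := norm_pos_iff.2 hΛ
  set c := μ.real (ball (0:V) 1) with hc
  have hc0 : 0 < c := real_unit_pos μ
  set κ := min (1/2) (Λ u / (2 * ‖u‖ * ‖Λ‖)) with hκ
  have hκ0 : 0 < κ := by positivity
  obtain ⟨r, hr, h1⟩ := h (κ ^ finrank ℝ V * c / 2) (by positivity)
  set ρ := r / 2 with hρ
  have hρ0 : 0 < ρ := by positivity
  have h2 := h1 ρ hρ0 (by linarith)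
  have hsub : ball (x - (ρ / (2 * ‖u‖)) • u) (κ * ρ) ⊆ {y | Λ (y - x) < 0} ∩ ball x ρ := by
    intro y hy
    set z := y - (x - (ρ / (2 * ‖u‖)) • u) with hz
    have hzn : ‖z‖ < κ * ρ := by rw [mem_ball, dist_eq_norm] at hy; exact hy
    have hyx : y - x = z - (ρ / (2 * ‖u‖)) • u := by rw [hz]; abel
    constructor
    · have hΛyx : Λ (y - x) = Λ z - ρ / (2 * ‖u‖) * Λ u := by
        rw [hyx, map_sub, map_smul, smul_eq_mul]
      change Λ (y - x) < 0
      rw [hΛyx]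
      have h3 : Λ z ≤ ‖Λ‖ * ‖z‖ := (le_abs_self _).trans (Λ.le_opNorm z)
      have h4 : ‖Λ‖ * ‖z‖ < ‖Λ‖ * (κ * ρ) := by gcongr
      have h5 : ‖Λ‖ * (κ * ρ) ≤ ‖Λ‖ * (Λ u / (2 * ‖u‖ * ‖Λ‖) * ρ) := by
        gcongr; exact min_le_right _ _
      have h6 : ‖Λ‖ * (Λ u / (2 * ‖u‖ * ‖Λ‖) * ρ) = ρ / (2 * ‖u‖) * Λ u := by field_simp
      linarith
    · rw [mem_ball, dist_eq_norm, hyx]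
      refine (norm_sub_le _ _).trans_lt ?_
      have h3 : ‖(ρ / (2 * ‖u‖)) • u‖ = ρ / 2 := by
        rw [norm_smul, Real.norm_eq_abs, abs_of_pos (by positivity)]; field_simp
      have h4 : κ * ρ ≤ 1/2 * ρ := by gcongr; exact min_le_left _ _
      rw [h3]; linarith
  have h3 := measureReal_mono (μ := μ) hsub (fin_inter_ball μ _ x ρ)
  rw [real_ball_eq μ _ (by positivity), mul_pow] at h3
  have h5 : 0 < κ ^ finrank ℝ V * c * ρ ^ finrank ℝ V := by positivity
  rw [← hc] at h3
  nlinarith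

lemma RB_subset_bd (E : Set V) : RB μ E ⊆ bd μ E := by
  have key : ∀ A : Set V, ∀ x ∈ RB μ A, ¬ D0 μ A x := by
    rintro A x ⟨Λ, h0, h1, h2⟩ h
    refine not_D0_half μ h0 x ((h.union h2).mono ?_)
    intro y hy
    by_cases hyA : y ∈ A
    · exact Or.inl hyA
    · exact Or.inr ⟨hyA, hy⟩
  intro x hx
  exact ⟨key E x hx, key Eᶜ x (by rwa [RB_compl])⟩

lemma cross_RB {E : Set V} (hE : MeasurableSet E) {d : ℕ} (hd : 1 ≤ d) (hV : finrank ℝ V = d + 1)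
    (hb : μH[(d:ℝ)] (bd μ E) ≠ ⊤) (w : V) :
    ∀ᵐ x ∂μ, (x ∈ E ↔ x + w ∉ E) → x ∈ hitSet (RB μ E) w := by
  by_cases hw : w = 0
  · subst hw
    refine ae_of_all _ fun x hx => ?_
    simp at hx
  · obtain ⟨f, e, he, hfr⟩ := exists_split w hw
    refine cross_of_line (Measure.addHaar : Measure f.ker) μ hE w e he ?_
    rw [← RB_map μ (muX (Measure.addHaar : Measure f.ker)) e]
    refine lineCross_RB _ (e.symm.continuous.measurable hE) hd (by omega) ?_
    rw [bd_map μ (muX (Measure.addHaar : Measure f.ker)) e]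
    have himg : e.symm ⁻¹' (bd μ E) = e '' (bd μ E) := (e.toEquiv.image_eq_preimage_symm _).symm
    rw [himg]
    have hl : LipschitzWith ‖(e : V →L[ℝ] ℝ × f.ker)‖₊ e := (e : V →L[ℝ] ℝ × f.ker).lipschitz
    have := hl.hausdorffMeasure_image_le (d := (d:ℝ)) (by positivity) (bd μ E)
    refine (this.trans_lt (ENNReal.mul_lt_top ?_ (lt_top_iff_ne_top.2 hb))).ne
    exact ENNReal.rpow_lt_top_of_nonneg (by positivity) ENNReal.coe_ne_top

lemma thmA_aux {E : Set V} (hE : MeasurableSet E) {d : ℕ} (hd : 1 ≤ d) (hV : finrank ℝ V = d + 1)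
    (hb : μH[(d:ℝ)] (bd μ E) ≠ ⊤) {φ : V → ℝ} {K : ℝ≥0} (hφ : LipschitzWith K φ) (w : V) :
    ∫⁻ x in {x | x ∈ E ↔ x + w ∉ E}, ENNReal.ofReal |φ x| ∂μ ≤
      ENNReal.ofReal (μ.real (ball (0:V) 1) * 2 ^ (d+1) * ‖w‖) *
        ∫⁻ x in RB μ E, ENNReal.ofReal (|φ x| + K * ‖w‖) ∂μH[(d:ℝ)] := by
  set D := {x | x ∈ E ↔ x + w ∉ E} with hD
  have hφc := hφ.continuous
  rw [lintegral_eq_lintegral_meas_lt _ (ae_of_all _ fun x => abs_nonneg _) (by fun_prop),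
    lintegral_eq_lintegral_meas_lt _ (ae_of_all _ fun x => by positivity) (by fun_prop),
    ← lintegral_const_mul' _ _ ENNReal.ofReal_ne_top]
  refine lintegral_mono fun s => ?_
  have m1 : MeasurableSet {x | s < |φ x|} := measurableSet_lt measurable_const (by fun_prop)
  have m2 : MeasurableSet {x | s < |φ x| + K * ‖w‖} := measurableSet_lt measurable_const (by fun_prop)
  rw [Measure.restrict_apply m1, Measure.restrict_apply m2]
  have hfin : μH[(d:ℝ)] ({x | s < |φ x| + K * ‖w‖} ∩ RB μ E) ≠ ⊤ :=
    measure_ne_top_of_subset (inter_subset_right.trans (RB_subset_bd μ E)) hb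
  refine le_trans (measure_mono_ae ?_) (hit_le μ hd hV hfin w)
  filter_upwards [cross_RB μ hE hd hV hb w] with x hx hxD
  obtain ⟨t, ht, htx⟩ := hx hxD.2
  refine ⟨t, ht, ?_, htx⟩
  have h1 := hφ.dist_le_mul x (x + t • w)
  rw [dist_self_add_right, norm_smul, Real.norm_eq_abs, abs_of_nonneg ht.1, Real.dist_eq] at h1
  have h2 : t * ‖w‖ ≤ ‖w‖ := mul_le_of_le_one_left (norm_nonneg _) ht.2
  have h3 : |φ x| - |φ (x + t • w)| ≤ |φ x - φ (x + t • w)| := abs_sub_abs_le_abs_sub _ _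
  have h4 : (K:ℝ) * (t * ‖w‖) ≤ K * ‖w‖ := by gcongr
  have h5 : s < |φ x| := hxD.1
  simp only [Set.mem_ofPred_eq]
  linarith

theorem thmA {E : Set V} (hE : MeasurableSet E) (hEv : μ E ≠ ⊤) {d : ℕ} (hd : 1 ≤ d) (hV : finrank ℝ V = d + 1)
    (hb : μH[(d:ℝ)] (bd μ E) ≠ ⊤) {φ : V → ℝ} (hφ : ContDiff ℝ 1 φ) (hφs : HasCompactSupport φ) (v : V) :
    |∫ x in E, fderiv ℝ φ x v ∂μ| ≤
      μ.real (ball (0:V) 1) * 2 ^ (d+1) * ‖v‖ * ∫ x in RB μ E, |φ x| ∂μH[(d:ℝ)] := by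
  obtain ⟨K, hK⟩ := hφ.lipschitzWith_of_hasCompactSupport hφs (by norm_num)
  haveI : IsFiniteMeasure ((μH[(d:ℝ)] : Measure V).restrict (RB μ E)) :=
    ⟨by rw [Measure.restrict_apply_univ]; exact (measure_mono (RB_subset_bd μ E)).trans_lt (lt_top_iff_ne_top.2 hb)⟩
  set m := (μH[(d:ℝ)] : Measure V).restrict (RB μ E) with hm
  have hφi : Integrable φ μ := hφ.continuous.integrable_of_hasCompactSupport hφs
  have hφm : Integrable (fun x => |φ x|) m := by
    obtain ⟨B, hB⟩ := hφs.exists_bound_of_continuous hφ.continuous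
    refine Integrable.mono' (integrable_const B) hφ.continuous.abs.aestronglyMeasurable (ae_of_all _ fun x => ?_)
    simpa using hB x
  set C := μ.real (ball (0:V) 1) * 2 ^ (d+1) with hC
  have hC0 : 0 ≤ C := by positivity
  set g : V → ℝ := E.indicator 1 with hg
  have hgi : Integrable g μ := (integrable_indicator_iff hE).2 
    (integrableOn_const hEv : IntegrableOn (fun _ => (1:ℝ)) E μ)
  have hlim := hK.integral_inv_smul_sub_mul_tendsto_integral_lineDeriv_mul hgi (-v)
  have hbound : ∀ t : ℝ, 0 < t → |∫ x, t⁻¹ • (φ (x + t • (-v)) - φ x) * g x ∂μ| ≤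
      C * ‖v‖ * (∫ x, |φ x| ∂m + K * (t * ‖v‖) * m.real univ) := by
    intro t ht
    have e1 : ∫ x, t⁻¹ • (φ (x + t • (-v)) - φ x) * g x ∂μ =
        t⁻¹ * ∫ x, φ x * (g (x + t • v) - g x) ∂μ := by
      have i1 : Integrable (fun x => φ (x + t • (-v)) * g x) μ := by
        refine Integrable.mono (hφi.comp_add_right (t • (-v))) ?_ (ae_of_all _ fun x => ?_)
        · exact (hφi.comp_add_right (t • (-v))).aestronglyMeasurable.mul hgi.aestronglyMeasurable
        · rw [norm_mul]
          refine mul_le_of_le_one_right (norm_nonneg _) ?_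
          by_cases h : x ∈ E <;> simp [hg, h]
      have i2 : ∀ z, Integrable (fun x => φ x * g (x + z)) μ := by
        intro z
        refine Integrable.mono hφi ?_ (ae_of_all _ fun x => ?_)
        · exact hφi.aestronglyMeasurable.mul (hgi.comp_add_right z).aestronglyMeasurable
        · rw [norm_mul]
          refine mul_le_of_le_one_right (norm_nonneg _) ?_
          by_cases h : x + z ∈ E <;> simp [hg, h]
      have i2' : Integrable (fun x => φ x * g x) μ := by simpa using i2 0
      have e2 : ∫ x, φ (x + t • (-v)) * g x ∂μ = ∫ x, φ x * g (x + t • v) ∂μ := by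
        rw [← integral_add_right_eq_self _ (t • v)]
        simp
      calc _ = ∫ x, t⁻¹ * (φ (x + t • (-v)) * g x - φ x * g x) ∂μ := by
            congr 1; ext x; simp only [smul_eq_mul]; ring
        _ = t⁻¹ * (∫ x, φ x * g (x + t • v) ∂μ - ∫ x, φ x * g x ∂μ) := by
            rw [integral_const_mul, integral_sub i1 i2', e2]
        _ = _ := by rw [← integral_sub (i2 _) i2']; simp only [mul_sub]
    have e3 : ‖∫ x, φ x * (g (x + t • v) - g x) ∂μ‖ₑ ≤
        ENNReal.ofReal (C * ‖t • v‖ * (∫ x, |φ x| ∂m + K * ‖t • v‖ * m.real univ)) := by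
      refine (enorm_integral_le_lintegral_enorm _).trans ?_
      have hDm : MeasurableSet {x | x ∈ E ↔ x + t • v ∉ E} := by
        have hshift : Measurable fun x : V => x + t • v := measurable_add_const _
        have : {x | x ∈ E ↔ x + t • v ∉ E} = {x | x ∈ E ∧ x + t • v ∉ E} ∪ {x | x ∉ E ∧ x + t • v ∈ E} := by
          ext x; simp only [Set.mem_ofPred_eq, mem_union]; tauto
        rw [this]
        exact (hE.inter (hshift hE.compl)).union (hE.compl.inter (hshift hE))
      have : ∫⁻ x, ‖φ x * (g (x + t • v) - g x)‖ₑ ∂μ ≤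
          ∫⁻ x in {x | x ∈ E ↔ x + t • v ∉ E}, ENNReal.ofReal |φ x| ∂μ := by
        rw [← lintegral_indicator hDm]
        refine lintegral_mono fun x => ?_
        by_cases h1 : x ∈ E <;> by_cases h2 : x + t • v ∈ E <;>
          simp [indicator, hg, h1, h2, ← ofReal_norm]
      refine this.trans ((thmA_aux μ hE hd hV hb hK (t • v)).trans ?_)
      have hi2 : Integrable (fun x => |φ x| + K * ‖t • v‖) m := hφm.add (integrable_const _)
      rw [← hm, ← ofReal_integral_eq_lintegral_ofReal hi2 (ae_of_all _ fun x => by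
        simp only [Pi.zero_apply]; positivity),
        ← ENNReal.ofReal_mul (by positivity), integral_add hφm (integrable_const _), integral_const, smul_eq_mul,
        mul_comm (m.real univ)]
    have hI0 : 0 ≤ ∫ x, |φ x| ∂m := integral_nonneg fun x => abs_nonneg _
    rw [← ofReal_norm, ENNReal.ofReal_le_ofReal_iff (by positivity), norm_smul, Real.norm_eq_abs,
      Real.norm_eq_abs, abs_of_pos ht] at e3
    rw [e1, abs_mul, abs_of_pos (inv_pos.2 ht), inv_mul_le_iff₀ ht]
    refine e3.trans (le_of_eq ?_)
    ring
  have hr : Tendsto (fun t : ℝ => C * ‖v‖ * (∫ x, |φ x| ∂m + K * (t * ‖v‖) * m.real univ)) (𝓝[>] 0)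
      (𝓝 (C * ‖v‖ * (∫ x, |φ x| ∂m + K * (0 * ‖v‖) * m.real univ))) := by
    refine Tendsto.mono_left ?_ nhdsWithin_le_nhds
    exact Continuous.tendsto (by fun_prop) _
  have hfin := le_of_tendsto_of_tendsto hlim.abs hr (by
    filter_upwards [self_mem_nhdsWithin] with t ht
    exact hbound t ht)
  have e4 : ∫ x, lineDeriv ℝ φ x (-v) * g x ∂μ = - ∫ x in E, fderiv ℝ φ x v ∂μ := by
    rw [← integral_indicator hE, ← integral_neg]
    congr 1
    ext x
    have : DifferentiableAt ℝ φ x := hφ.differentiable (by norm_num) x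
    rw [this.lineDeriv_eq_fderiv]
    by_cases h : x ∈ E <;> simp [hg, h]
  rw [e4, abs_neg] at hfin
  simpa using hfin

end ThmA


section TwoPoint

open Module

variable {V : Type*} [NormedAddCommGroup V] [InnerProductSpace ℝ V] [FiniteDimensional ℝ V]
  [MeasurableSpace V] [BorelSpace V] (μ : Measure V) [μ.IsAddHaarMeasure]

/-- quantitative half space blow-up -/
def Rq (μ : Measure V) (E : Set V) (δ r0 : ℝ) (x ν : V) : Prop :=
  ∀ ρ : ℝ, 0 < ρ → ρ < r0 →
    μ.real ({y | y ∈ E ∧ 0 < ⟪y - x, ν⟫} ∩ ball x ρ) ≤ δ * ρ ^ (finrank ℝ V) ∧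
    μ.real ({y | y ∉ E ∧ ⟪y - x, ν⟫ < 0} ∩ ball x ρ) ≤ δ * ρ ^ (finrank ℝ V)

lemma Rq.compl {μ : Measure V} {E : Set V} {δ r0 : ℝ} {x ν : V} (h : Rq μ E δ r0 x ν) :
    Rq μ Eᶜ δ r0 x (-ν) := by
  intro ρ h1 h2
  obtain ⟨a, b⟩ := h ρ h1 h2
  constructor
  · convert b using 4
    ext y; simp [inner_neg_right]
  · convert a using 4
    ext y; simp [inner_neg_right]

/-- the admissible constant -/
noncomputable def dl (μ : Measure V) (ε : ℝ) : ℝ :=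
  μ.real (ball (0:V) 1) * (1/2) ^ (finrank ℝ V) * ε ^ (finrank ℝ V) / (2 * (ε ^ (finrank ℝ V) + 2 ^ (finrank ℝ V)))

lemma dl_pos {ε : ℝ} (hε : 0 < ε) : 0 < dl μ ε := by
  have := real_unit_pos μ
  unfold dl; positivity

lemma two_point_aux {E : Set V} {ε r0 : ℝ} (hε : 0 < ε) (hε1 : ε ≤ 1) {x x' ν ν' : V}
    (hν' : ‖ν'‖ = 1) (hν : ‖ν‖ = 1) (h : Rq μ E (dl μ ε) r0 x ν) (h' : Rq μ E (dl μ ε) r0 x' ν')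
    (hne : x ≠ x') (hr : 2 * ‖x' - x‖ < r0) : ⟪x' - x, ν⟫ ≤ ε * ‖x' - x‖ := by
  by_contra hcon
  push Not at hcon
  set r := ‖x' - x‖ with hrdef
  have hr0 : 0 < r := norm_pos_iff.2 (sub_ne_zero.2 hne.symm)
  set N := finrank ℝ V
  have hc := real_unit_pos μ
  obtain ⟨h1, -⟩ := h (2 * r) (by positivity) hr
  have hεr : ε * r ≤ r := by nlinarith
  obtain ⟨-, h2⟩ := h' (ε * r) (by positivity) (by linarith)
  have hsub : ball (x' - (ε * r / 2) • ν') (ε * r / 2) ⊆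
      ({y | y ∈ E ∧ 0 < ⟪y - x, ν⟫} ∩ ball x (2 * r)) ∪ ({y | y ∉ E ∧ ⟪y - x', ν'⟫ < 0} ∩ ball x' (ε * r)) := by
    intro y hy
    set z := y - (x' - (ε * r / 2) • ν') with hz
    have hzn : ‖z‖ < ε * r / 2 := by rwa [mem_ball, dist_eq_norm] at hy
    have hyx' : y - x' = z - (ε * r / 2) • ν' := by rw [hz]; abel
    have hn1 : ‖y - x'‖ < ε * r := by
      rw [hyx']
      refine (norm_sub_le _ _).trans_lt ?_
      rw [norm_smul, hν', Real.norm_eq_abs, abs_of_pos (by positivity)]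
      linarith
    by_cases hyE : y ∈ E
    · left
      refine ⟨⟨hyE, ?_⟩, ?_⟩
      · have e : y - x = (y - x') + (x' - x) := by abel
        rw [e, inner_add_left]
        have := abs_le.1 (abs_real_inner_le_norm (y - x') ν)
        rw [hν, mul_one] at this
        linarith [this.1]
      · rw [mem_ball, dist_eq_norm]
        have e : y - x = (y - x') + (x' - x) := by abel
        rw [e]
        refine (norm_add_le _ _).trans_lt ?_
        linarith
    · right
      refine ⟨⟨hyE, ?_⟩, by rwa [mem_ball, dist_eq_norm]⟩
      rw [hyx', inner_sub_left, inner_smul_left, real_inner_self_eq_norm_sq, hν']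
      have := abs_le.1 (abs_real_inner_le_norm z ν')
      rw [hν', mul_one] at this
      simp only [RCLike.conj_to_real]
      linarith [this.2]
  have hm := measureReal_mono hsub (measure_union_ne_top (fin_inter_ball μ _ _ _) (fin_inter_ball μ _ _ _))
  rw [real_ball_eq μ _ (by positivity)] at hm
  have hm2 := hm.trans ((measureReal_union_le _ _).trans (add_le_add h1 h2))
  have e1 : (ε * r / 2) ^ N * μ.real (ball (0:V) 1) = r ^ N * (μ.real (ball (0:V) 1) * (1/2)^N * ε ^ N) := by
    rw [div_eq_mul_one_div, mul_pow, mul_pow]; ring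
  have e2 : dl μ ε * (2 * r) ^ N + dl μ ε * (ε * r) ^ N = r ^ N * (μ.real (ball (0:V) 1) * (1/2)^N * ε ^ N) / 2 := by
    unfold dl
    rw [mul_pow, mul_pow]
    have : ε ^ N + 2 ^ N ≠ 0 := by positivity
    field_simp
    ring
  change (ε * r / 2) ^ N * _ ≤ dl μ ε * (2 * r) ^ N + dl μ ε * (ε * r) ^ N at hm2
  rw [e1, e2] at hm2
  have : 0 < r ^ N * (μ.real (ball (0:V) 1) * (1/2)^N * ε ^ N) := by positivity
  linarith

lemma two_point {E : Set V} {ε r0 : ℝ} (hε : 0 < ε) (hε1 : ε ≤ 1) {x x' ν ν' : V}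
    (hν' : ‖ν'‖ = 1) (hν : ‖ν‖ = 1) (h : Rq μ E (dl μ ε) r0 x ν) (h' : Rq μ E (dl μ ε) r0 x' ν')
    (hr : 2 * ‖x' - x‖ < r0) : |⟪x' - x, ν⟫| ≤ ε * ‖x' - x‖ := by
  by_cases hne : x = x'
  · simp [hne]
  rw [abs_le]
  refine ⟨?_, two_point_aux μ hε hε1 hν' hν h h' hne hr⟩
  have := two_point_aux μ (E := Eᶜ) hε hε1 (ν := -ν) (ν' := -ν') (by simpa) (by simpa) h.compl h'.compl hne hr
  rw [inner_neg_right] at this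
  linarith

lemma second_order {p p' : V} (hp : p ≠ 0) :
    |‖p'‖ - ‖p‖ - ⟪p' - p, ‖p‖⁻¹ • p⟫| ≤ ‖p' - p‖ ^ 2 / (2 * ‖p‖) := by
  have hp0 : 0 < ‖p‖ := norm_pos_iff.2 hp
  have h1 : ‖p' - p‖ ^ 2 = ‖p'‖ ^ 2 - 2 * ⟪p', p⟫ + ‖p‖ ^ 2 := norm_sub_sq_real p' p
  have h2 : ⟪p', p⟫ ≤ ‖p'‖ * ‖p‖ := real_inner_le_norm _ _
  have e : ‖p'‖ - ‖p‖ - ⟪p' - p, ‖p‖⁻¹ • p⟫ = (‖p'‖ * ‖p‖ - ⟪p', p⟫) / ‖p‖ := by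
    rw [inner_smul_right, inner_sub_left, real_inner_self_eq_norm_sq]
    field_simp
    ring
  rw [e, abs_of_nonneg (div_nonneg (by linarith) hp0.le), div_le_div_iff₀ hp0 (by positivity)]
  have : 2 * (‖p'‖ * ‖p‖ - ⟪p', p⟫) ≤ ‖p' - p‖ ^ 2 := by nlinarith [sq_nonneg (‖p'‖ - ‖p‖)]
  nlinarith

end TwoPoint

section Slab

open Module

variable {W : Type*} [NormedAddCommGroup W] [NormedSpace ℝ W] [FiniteDimensional ℝ W]
  [MeasurableSpace W] [BorelSpace W] (μ : Measure W) [μ.IsAddHaarMeasure]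

lemma slab {lam : W →L[ℝ] ℝ} {u : W} (hu : lam u = 1) (hu1 : ‖u‖ ≤ 1) {D : ℝ} (hD : 0 < D) {M : ℕ} (hM : 1 ≤ M)
    {T : Set W} {p0 : W} (hT : ∀ p ∈ T, dist p p0 ≤ D ∧ |lam (p - p0)| ≤ D / (3 * M)) :
    (M : ℝ≥0∞) * μ T ≤ ENNReal.ofReal ((2 * D) ^ (finrank ℝ W) * μ.real (ball (0:W) 1)) := by
  set T' : Set W := {p | dist p p0 ≤ D ∧ |lam (p - p0)| ≤ D / (3 * M)} with hT'
  have hTT : T ⊆ T' := hT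
  have hM0 : (0:ℝ) < M := by exact_mod_cast hM
  have hcl : IsClosed T' :=
    IsClosed.inter (s₁ := {p | dist p p0 ≤ D}) (s₂ := {p | |lam (p - p0)| ≤ D / (3 * M)})
      (isClosed_le (by fun_prop) (by fun_prop)) (isClosed_le (Continuous.abs (by fun_prop)) (by fun_prop))
  set f : Fin M → Set W := fun j => (fun p => p - (j * D / M) • u) ⁻¹' T' with hf
  have hfm : ∀ j, MeasurableSet (f j) := fun j =>
    (hcl.preimage (by fun_prop)).measurableSet
  have hfμ : ∀ j, μ (f j) = μ T' := fun j => by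
    simp only [hf]
    simp only [sub_eq_add_neg]
    exact measure_preimage_add_right μ _ T'
  have hdis : Pairwise (Function.onFun Disjoint f) := by
    intro i j hij
    rw [Function.onFun, Set.disjoint_left]
    rintro p ⟨-, h1⟩ ⟨-, h2⟩
    have hl : ∀ k : Fin M, lam (p - ((k:ℕ) * D / M) • u - p0) = lam (p - p0) - (k:ℕ) * D / M := by
      intro k
      simp only [map_sub, map_smul, hu, smul_eq_mul, mul_one]; ring
    rw [hl i] at h1
    rw [hl j] at h2
    have h3 : |((i:ℕ):ℝ) * D / M - (j:ℕ) * D / M| ≤ 2 * (D / (3 * M)) := by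
      rw [abs_le] at *
      constructor <;> linarith [h1.1, h1.2, h2.1, h2.2]
    have h4 : |((i:ℕ):ℝ) * D / M - (j:ℕ) * D / M| = |((i:ℕ):ℝ) - (j:ℕ)| * (D / M) := by
      rw [← abs_of_pos (show 0 < D / M by positivity), ← abs_mul]
      congr 1; ring
    have h5 : (1:ℝ) ≤ |((i:ℕ):ℝ) - (j:ℕ)| := by
      have : ((i:ℕ):ℤ) - (j:ℕ) ≠ 0 := by
        intro h; apply hij; ext; omega
      have := Int.one_le_abs this
      exact_mod_cast this
    rw [h4] at h3
    have h6 : D / (3 * M) = (D / M) / 3 := by field_simp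
    rw [h6] at h3
    have : 0 < D / M := by positivity
    nlinarith
  have hun : ⋃ j, f j ⊆ closedBall p0 (2 * D) := by
    intro p hp
    obtain ⟨j, hj⟩ := mem_iUnion.1 hp
    have h1 : dist (p - ((j:ℕ) * D / M) • u) p0 ≤ D := hj.1
    rw [mem_closedBall, dist_eq_norm] at *
    have e : p - p0 = (p - ((j:ℕ) * D / M) • u - p0) + ((j:ℕ) * D / M) • u := by abel
    rw [e]
    refine (norm_add_le _ _).trans ?_
    have hj1 : ((j:ℕ):ℝ) ≤ M := by exact_mod_cast j.2.le
    have : ((j:ℕ):ℝ) * D / M ≤ D := by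
      rw [div_le_iff₀ hM0]; nlinarith
    rw [norm_smul, Real.norm_eq_abs, abs_of_nonneg (by positivity)]
    have h7 : ((j:ℕ):ℝ) * D / M * ‖u‖ ≤ ((j:ℕ):ℝ) * D / M := mul_le_of_le_one_right (by positivity) hu1
    linarith
  calc (M : ℝ≥0∞) * μ T ≤ M * μ T' := by gcongr
    _ = ∑ j : Fin M, μ (f j) := by simp [hfμ]
    _ = μ (⋃ j, f j) := by rw [measure_iUnion hdis hfm, tsum_fintype]
    _ ≤ μ (closedBall p0 (2 * D)) := measure_mono hun
    _ = _ := by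
      rw [← real_closedBall_eq μ p0 (by positivity), measureReal_def, ENNReal.ofReal_toReal measure_closedBall_lt_top.ne]

end Slab


section Spec

open Module

variable {n : ℕ} (hn : 2 ≤ n)

/-- the projection on the first two coordinates as a linear map -/
noncomputable def P12 : Euc n →L[ℝ] Euc 2 :=
  LinearMap.toContinuousLinearMap
    { toFun := pr12 hn
      map_add' := by intro x y; ext i; simp [pr12]
      map_smul' := by intro c x; ext i; simp [pr12] }

/-- the projection on the other coordinates as a linear map -/
noncomputable def PC : Euc n →L[ℝ] Euc (n - 2) :=
  LinearMap.toContinuousLinearMap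
    { toFun := prC hn
      map_add' := by intro x y; ext i; simp [prC]
      map_smul' := by intro c x; ext i; simp [prC] }

lemma P12_apply (x : Euc n) : P12 hn x = pr12 hn x := rfl
lemma PC_apply (x : Euc n) : PC hn x = prC hn x := rfl

lemma inner_split (x y : Euc n) : ⟪x, y⟫ = ⟪pr12 hn x, pr12 hn y⟫ + ⟪prC hn x, prC hn y⟫ := by
  obtain ⟨m, rfl⟩ : ∃ m, n = m + 2 := ⟨n - 2, by omega⟩
  simp only [PiLp.inner_apply]
  rw [Fin.sum_univ_succ, Fin.sum_univ_succ, Fin.sum_univ_two, ← add_assoc]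
  rfl

lemma normsq_split (x : Euc n) : ‖x‖ ^ 2 = ‖pr12 hn x‖ ^ 2 + ‖prC hn x‖ ^ 2 := by
  simp only [← real_inner_self_eq_norm_sq]
  exact inner_split hn x x

lemma norm_pr12_le (x : Euc n) : ‖pr12 hn x‖ ≤ ‖x‖ := by
  have := normsq_split hn x
  nlinarith [norm_nonneg x, norm_nonneg (pr12 hn x), sq_nonneg ‖prC hn x‖]

lemma norm_prC_le (x : Euc n) : ‖prC hn x‖ ≤ ‖x‖ := by
  have := normsq_split hn x
  nlinarith [norm_nonneg x, norm_nonneg (prC hn x), sq_nonneg ‖pr12 hn x‖]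

lemma pr12_sub (x y : Euc n) : pr12 hn (x - y) = pr12 hn x - pr12 hn y := map_sub (P12 hn) x y
lemma prC_sub (x y : Euc n) : prC hn (x - y) = prC hn x - prC hn y := map_sub (PC hn) x y

/-- the quotient map to the base -/
noncomputable def piB (x : Euc n) : ℝ × Euc (n - 2) := (‖pr12 hn x‖, prC hn x)

lemma piB_dist (x y : Euc n) : dist (piB hn x) (piB hn y) ≤ ‖x - y‖ := by
  rw [Prod.dist_eq, max_le_iff]
  constructor
  · simp only [piB, Real.dist_eq]
    refine (abs_norm_sub_norm_le _ _).trans ?_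
    rw [← pr12_sub]; exact norm_pr12_le hn _
  · simp only [piB, dist_eq_norm]
    rw [← prC_sub]; exact norm_prC_le hn _

lemma piB_cont : Continuous (piB hn) :=
  (LipschitzWith.of_dist_le_mul (K := 1) fun x y => by
    simpa [dist_eq_norm] using piB_dist hn x y).continuous

lemma pr12_cont : Continuous (pr12 hn) := (P12 hn).continuous
lemma prC_cont : Continuous (prC hn) := (PC hn).continuous

lemma e1_norm : ‖e1 2 (by norm_num)‖ = 1 := by simp [e1]

lemma hatv_norm {p : Euc 2} (hp : p ≠ 0) : ‖hatv p‖ = 1 := by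
  unfold hatv
  rw [norm_smul, norm_inv, norm_norm, inv_mul_cancel₀ (norm_ne_zero_iff.2 hp)]

/-- the angle function -/
noncomputable def Ang (x : Euc n) : ℝ := Real.arccos ⟪hatv (pr12 hn x), e1 2 (by norm_num)⟫

lemma Ang_meas : Measurable (Ang hn) := by
  unfold Ang hatv
  have h1 := (pr12_cont hn).measurable
  have : Measurable fun x : Euc n => ⟪‖pr12 hn x‖⁻¹ • pr12 hn x, e1 2 (by norm_num)⟫ := by
    fun_prop
  exact Real.continuous_arccos.measurable.comp this

/-- half of the angular length -/
noncomputable def uu (ℓ : ℝ × Euc (n - 2) → ℝ) (p : ℝ × Euc (n - 2)) : ℝ := ℓ p / (2 * p.1)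

lemma circ_mem {ℓ : ℝ × Euc (n - 2) → ℝ} {x : Euc n} :
    x ∈ circSymm hn ℓ ↔ pr12 hn x ≠ 0 ∧ Ang hn x < uu ℓ (piB hn x) := Iff.rfl

lemma uu_meas {ℓ : ℝ × Euc (n - 2) → ℝ} (hl : Measurable ℓ) : Measurable (uu ℓ) := by
  unfold uu; fun_prop

lemma circ_meas {ℓ : ℝ × Euc (n - 2) → ℝ} (hl : Measurable ℓ) : MeasurableSet (circSymm hn ℓ) := by
  have h1 : MeasurableSet {x : Euc n | pr12 hn x ≠ 0} :=
    (isOpen_ne_fun (pr12_cont hn) continuous_const).measurableSet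
  exact h1.inter (measurableSet_lt (Ang_meas hn) ((uu_meas hl).comp (piB_cont hn).measurable))

lemma D0_iff_density {E : Set (Euc n)} {x : Euc n} : DensityAt E x 0 ↔ D0 volume E x :=
  D0_iff_tendsto.symm

lemma D0_iff_density1 {E : Set (Euc n)} (hE : MeasurableSet E) {x : Euc n} :
    DensityAt E x 1 ↔ D0 volume Eᶜ x := by
  rw [D0_iff_tendsto]
  have key : ∀ ρ : ℝ, 0 < ρ → volume (E ∩ ball x ρ) / volume (ball x ρ) +
      volume (Eᶜ ∩ ball x ρ) / volume (ball x ρ) = 1 := by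
    intro ρ hρ
    rw [← ENNReal.add_div, inter_comm E, inter_comm Eᶜ, ← sdiff_eq, measure_inter_add_sdiff _ hE]
    exact ENNReal.div_self (measure_ball_pos _ _ hρ).ne' measure_ball_lt_top.ne
  have hfin : ∀ (A : Set (Euc n)) (ρ : ℝ), volume (A ∩ ball x ρ) / volume (ball x ρ) ≤ 1 := by
    intro A ρ
    exact ENNReal.div_le_of_le_mul (by rw [one_mul]; exact measure_mono inter_subset_right)
  have hfin' : ∀ (A : Set (Euc n)) (ρ : ℝ), volume (A ∩ ball x ρ) / volume (ball x ρ) ≠ ⊤ := fun A ρ =>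
    ((hfin A ρ).trans_lt ENNReal.one_lt_top).ne
  constructor
  · intro h
    have h2 := ENNReal.Tendsto.sub (tendsto_const_nhds (x := (1:ℝ≥0∞)) (f := 𝓝[>] (0:ℝ))) h (Or.inl ENNReal.one_ne_top)
    rw [tsub_self] at h2
    refine h2.congr' ?_
    filter_upwards [self_mem_nhdsWithin] with ρ hρ
    rw [← key ρ hρ, ENNReal.add_sub_cancel_left (hfin' _ _)]
  · intro h
    have h2 := ENNReal.Tendsto.sub (tendsto_const_nhds (x := (1:ℝ≥0∞)) (f := 𝓝[>] (0:ℝ))) h (Or.inl ENNReal.one_ne_top)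
    rw [tsub_zero] at h2
    refine h2.congr' ?_
    filter_upwards [self_mem_nhdsWithin] with ρ hρ
    rw [← key ρ hρ, ENNReal.add_sub_cancel_right (hfin' _ _)]

lemma ess_eq_bd {E : Set (Euc n)} (hE : MeasurableSet E) : essBoundary E = bd volume E := by
  ext x
  simp only [essBoundary, bd, Set.mem_ofPred_eq, D0_iff_density, D0_iff_density1 hE]

lemma mtn_iff {E : Set (Euc n)} {x ν : Euc n} : HasMTNormal E x ν ↔ ‖ν‖ = 1 ∧
    D0 volume {y | y ∈ E ∧ 0 < ⟪y - x, ν⟫} x ∧ D0 volume {y | y ∉ E ∧ ⟪y - x, ν⟫ < 0} x := by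
  rw [D0_iff_tendsto, D0_iff_tendsto]; rfl

lemma red_eq_RB {E : Set (Euc n)} : redBoundary E = RB volume E := by
  ext x
  constructor
  · rintro ⟨ν, h⟩
    rw [mtn_iff] at h
    refine ⟨innerSL ℝ ν, ?_, ?_, ?_⟩
    · intro h0
      have := congrArg (fun f => f ν) h0
      simp [h.1] at this
    · simpa [real_inner_comm] using h.2.1
    · simpa [real_inner_comm] using h.2.2
  · rintro ⟨Λ, h0, h1, h2⟩
    set w := (InnerProductSpace.toDual ℝ (Euc n)).symm Λ with hw
    have hΛ : ∀ z, Λ z = ⟪z, w⟫ := by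
      intro z; rw [real_inner_comm, hw, InnerProductSpace.toDual_symm_apply]
    have hw0 : w ≠ 0 := by
      rw [hw]; simpa using h0
    have hwp : 0 < ‖w‖ := norm_pos_iff.2 hw0
    refine ⟨‖w‖⁻¹ • w, ?_⟩
    rw [mtn_iff]
    refine ⟨by rw [norm_smul, norm_inv, norm_norm, inv_mul_cancel₀ hwp.ne'], ?_, ?_⟩
    · convert h1 using 4 with y
      rw [hΛ, inner_smul_right, mul_pos_iff_of_pos_left (inv_pos.2 hwp)]
    · convert h2 using 4 with y
      rw [hΛ, inner_smul_right, mul_neg_iff]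
      simp [hwp, hwp.le]

lemma mtNormal_spec {E : Set (Euc n)} {x : Euc n} (hx : x ∈ redBoundary E) : HasMTNormal E x (mtNormal E x) := by
  have hx' : ∃ ν, HasMTNormal E x ν := hx
  unfold mtNormal
  rw [dif_pos hx']
  exact hx'.choose_spec

lemma Rq_of_normal {E : Set (Euc n)} {x ν : Euc n} (h : HasMTNormal E x ν) {δ : ℝ} (hδ : 0 < δ) :
    ∃ k : ℕ, ∀ r0 : ℝ, r0 ≤ 1 / ((k:ℝ) + 1) → Rq volume E δ r0 x ν := by
  rw [mtn_iff] at h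
  obtain ⟨r1, hr1, H1⟩ := h.2.1 δ hδ
  obtain ⟨r2, hr2, H2⟩ := h.2.2 δ hδ
  obtain ⟨k, hk⟩ := exists_nat_one_div_lt (lt_min hr1 hr2)
  refine ⟨k, fun r0 hr0 ρ h1 h2 => ?_⟩
  have := (h2.trans_le hr0).trans hk
  exact ⟨H1 ρ h1 (this.trans_le (min_le_left _ _)), H2 ρ h1 (this.trans_le (min_le_right _ _))⟩

lemma finrank_base (hn : 2 ≤ n) : finrank ℝ (ℝ × Euc (n - 2)) = n - 1 := by
  rw [Module.finrank_prod, finrank_self, finrank_euclideanSpace, Fintype.card_fin]; omega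

lemma cast_dim (hn : 2 ≤ n) : ((n:ℝ) - 1) = ((n - 1 : ℕ) : ℝ) := by
  rw [Nat.cast_sub (by omega)]; simp

instance instHaarBase {m : ℕ} : (volume : Measure (ℝ × Euc m)).IsAddHaarMeasure := by
  rw [Measure.volume_eq_prod]; infer_instance

end Spec


section Sard

open Module

variable {n : ℕ} (hn : 2 ≤ n)

lemma sard_pt {E : Set (Euc n)} {x x' : Euc n} {k M : ℕ} (hM : 1 ≤ M)
    (hx : x ∈ redBoundary E) (hx' : x' ∈ redBoundary E) (hp : 1 / ((k:ℝ) + 1) ≤ ‖pr12 hn x‖)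
    (hpar : nu12par hn E x = 0)
    (h : Rq volume E (dl (volume : Measure (Euc n)) (1 / (6 * M : ℝ))) (1 / ((k:ℝ) + 1)) x (mtNormal E x))
    (h' : Rq volume E (dl (volume : Measure (Euc n)) (1 / (6 * M : ℝ))) (1 / ((k:ℝ) + 1)) x' (mtNormal E x'))
    {D : ℝ} (hD : ‖x' - x‖ ≤ D) (hDs : D ≤ 1 / (3 * M * ((k:ℝ) + 1))) :
    |⟪pr12 hn (mtNormal E x), hatv (pr12 hn x)⟫ * (piB hn x' - piB hn x).1 +
      ⟪prC hn (mtNormal E x), (piB hn x' - piB hn x).2⟫| ≤ D / (3 * M) := by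
  have hM1 : (1:ℝ) ≤ M := by exact_mod_cast hM
  have hk1 : (0:ℝ) < (k:ℝ) + 1 := by positivity
  have hp0 : 0 < ‖pr12 hn x‖ := lt_of_lt_of_le (by positivity) hp
  have hpne : pr12 hn x ≠ 0 := norm_pos_iff.1 hp0
  set ν := mtNormal E x with hν
  have hν1 : ‖ν‖ = 1 := (mtNormal_spec hx).1
  have hν1' : ‖mtNormal E x'‖ = 1 := (mtNormal_spec hx').1
  set a := ⟪pr12 hn ν, hatv (pr12 hn x)⟫ with ha
  have hpν : pr12 hn ν = a • hatv (pr12 hn x) := sub_eq_zero.1 hpar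
  have ha1 : |a| ≤ 1 := by
    have := norm_pr12_le hn ν
    rw [hpν, norm_smul, hatv_norm hpne, mul_one, hν1] at this
    exact this
  set r := ‖x' - x‖ with hr
  have hr0 : 0 ≤ r := norm_nonneg _
  have hs : 1 / (3 * M * ((k:ℝ) + 1)) = (1 / (3 * M)) * (1 / ((k:ℝ) + 1)) := by field_simp
  have h3 : (1 / (3 * M) : ℝ) ≤ 1 / 3 := by
    apply one_div_le_one_div_of_le <;> linarith
  have hk : 0 < 1 / ((k:ℝ) + 1) := by positivity
  have htp := two_point (volume : Measure (Euc n)) (E := E) (ε := 1 / (6 * M : ℝ)) (by positivity)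
    (by rw [div_le_one (by positivity)]; linarith) hν1' hν1 h h' (by
      rw [hs] at hDs; nlinarith)
  have hso := second_order (p := pr12 hn x) (p' := pr12 hn x') hpne
  have hrr : ‖pr12 hn x' - pr12 hn x‖ ≤ r := by rw [← pr12_sub]; exact norm_pr12_le hn _
  have hso2 : ‖pr12 hn x' - pr12 hn x‖ ^ 2 / (2 * ‖pr12 hn x‖) ≤ D / (6 * M) := by
    rw [div_le_div_iff₀ (by positivity) (by positivity)]
    have h4 : ‖pr12 hn x' - pr12 hn x‖ ^ 2 ≤ D * D := by nlinarith [norm_nonneg (pr12 hn x' - pr12 hn x)]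
    have h5 : D * (3 * M) ≤ ‖pr12 hn x‖ := by
      have : D * (3 * M) ≤ 1 / ((k:ℝ) + 1) := by
        rw [← le_div_iff₀ (by positivity)]; refine hDs.trans (le_of_eq ?_); field_simp
      exact this.trans hp
    nlinarith [hr0.trans hD]
  have e : a * (piB hn x' - piB hn x).1 + ⟪prC hn ν, (piB hn x' - piB hn x).2⟫ =
      ⟪x' - x, ν⟫ + a * (‖pr12 hn x'‖ - ‖pr12 hn x‖ - ⟪pr12 hn x' - pr12 hn x, ‖pr12 hn x‖⁻¹ • pr12 hn x⟫) := by
    rw [inner_split hn (x' - x) ν, hpν, pr12_sub, prC_sub, inner_smul_right, real_inner_comm (prC hn ν)]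
    simp only [piB, Prod.fst_sub, Prod.snd_sub, hatv]
    ring
  rw [e]
  refine (abs_add_le _ _).trans ?_
  rw [abs_mul]
  have h6 : |⟪x' - x, ν⟫| ≤ D / (6 * M) := by
    refine htp.trans ?_
    rw [one_div, ← div_eq_inv_mul]
    exact div_le_div_of_nonneg_right hD (by positivity)
  have h7 : D / (3 * M) = D / (6 * M) + D / (6 * M) := by field_simp; ring
  rw [h7]
  refine add_le_add h6 ?_
  refine (mul_le_of_le_one_left (abs_nonneg _) ha1).trans (hso.trans hso2)


/-- the pieces of the tangential set -/
def NMk (E : Set (Euc n)) (M k : ℕ) : Set (Euc n) :=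
  {x | x ∈ redBoundary E ∧ nu12par hn E x = 0 ∧ 1 / ((k:ℝ) + 1) ≤ ‖pr12 hn x‖ ∧
    Rq volume E (dl (volume : Measure (Euc n)) (1 / (6 * M : ℝ))) (1 / ((k:ℝ) + 1)) x (mtNormal E x)}

lemma sard_piece {E : Set (Euc n)} (hE : MeasurableSet E) (hb : μH[((n - 1 : ℕ):ℝ)] (bd volume E) ≠ ⊤) {M k : ℕ} (hM : 1 ≤ M) :
    (M : ℝ≥0∞) * volume (piB hn '' NMk hn E M k) ≤
      ENNReal.ofReal (2 ^ (n - 1) * (volume : Measure (ℝ × Euc (n - 2))).real (ball 0 1)) *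
        (μH[((n - 1 : ℕ):ℝ)] (bd volume E) + 1) := by
  have hsub : NMk hn E M k ⊆ bd volume E := by
    intro x hx
    have := hx.1
    rw [red_eq_RB] at this
    exact RB_subset_bd volume E this
  have hM1 : (1:ℝ) ≤ M := by exact_mod_cast hM
  set δ : ℝ := min 1 (1 / (3 * M * ((k:ℝ) + 1))) with hδ
  have hδ0 : 0 < δ := by rw [hδ]; positivity
  obtain ⟨t, D, hcov, hD0, hDδ, hdist, hsum⟩ := haus_cover (show 1 ≤ n - 1 by omega)
    (S := NMk hn E M k) ((measure_mono hsub).trans_lt hb.lt_top).ne hδ0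
  set c := (volume : Measure (ℝ × Euc (n - 2))).real (ball 0 1) with hc
  have hc0 : 0 < c := real_unit_pos volume
  have hpt : ∀ i, (M : ℝ≥0∞) * volume (piB hn '' (NMk hn E M k ∩ t i)) ≤
      ENNReal.ofReal (2 ^ (n - 1) * c) * ENNReal.ofReal (D i ^ (n - 1)) := by
    intro i
    rcases (NMk hn E M k ∩ t i).eq_empty_or_nonempty with h0 | ⟨x, hx⟩
    · simp [h0]
    have hd : ∀ x' ∈ NMk hn E M k ∩ t i, ‖x' - x‖ ≤ D i := fun x' hx' => by
      rw [← dist_eq_norm]; exact hdist i x' hx'.2 x hx.2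
    rcases (hD0 i).eq_or_lt with h0 | hDpos
    · have hsing : piB hn '' (NMk hn E M k ∩ t i) ⊆ {piB hn x} := by
        rintro _ ⟨x', hx', rfl⟩
        have := hd x' hx'
        rw [← h0] at this
        have := sub_eq_zero.1 (norm_le_zero_iff.1 this)
        rw [this]; rfl
      rw [measure_mono_null hsing (by
        haveI : Nontrivial (ℝ × Euc (n - 2)) := inferInstance
        exact measure_singleton _)]
      simp
    · set ν := mtNormal E x with hν
      have hν1 : ‖ν‖ = 1 := (mtNormal_spec hx.1.1).1
      set a := ⟪pr12 hn ν, hatv (pr12 hn x)⟫ with ha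
      have hpne : pr12 hn x ≠ 0 := norm_pos_iff.1 (lt_of_lt_of_le (by positivity) hx.1.2.2.1)
      have hpν : pr12 hn ν = a • hatv (pr12 hn x) := sub_eq_zero.1 hx.1.2.1
      have hpn : ‖pr12 hn ν‖ = |a| := by
        rw [hpν, norm_smul, hatv_norm hpne, mul_one, Real.norm_eq_abs]
      set lam : (ℝ × Euc (n - 2)) →L[ℝ] ℝ :=
        a • ContinuousLinearMap.fst ℝ ℝ (Euc (n - 2)) + (innerSL ℝ (prC hn ν)).comp (ContinuousLinearMap.snd ℝ ℝ (Euc (n - 2))) with hlam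
      have hla : ∀ z, lam z = a * z.1 + ⟪prC hn ν, z.2⟫ := fun z => by simp [hlam]
      have h1 := slab (volume : Measure (ℝ × Euc (n - 2))) (lam := lam) (u := (a, prC hn ν)) (by
        rw [hla]
        have := normsq_split hn ν
        rw [hν1, hpn, sq_abs] at this
        simp only [real_inner_self_eq_norm_sq]; nlinarith) (by
          rw [Prod.norm_def, max_le_iff]
          constructor
          · rw [Real.norm_eq_abs, ← hpn, ← hν1]; exact norm_pr12_le hn ν
          · rw [← hν1]; exact norm_prC_le hn ν) hDpos hM (T := piB hn '' (NMk hn E M k ∩ t i)) (p0 := piB hn x) (by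
          rintro _ ⟨x', hx', rfl⟩
          refine ⟨(piB_dist hn _ _).trans (hd x' hx'), ?_⟩
          rw [hla]
          exact sard_pt hn hM hx.1.1 hx'.1.1 hx.1.2.2.1 hx.1.2.1 hx.1.2.2.2 hx'.1.2.2.2 (hd x' hx')
            ((hDδ i).trans (min_le_right _ _)))
      refine h1.trans (le_of_eq ?_)
      rw [← ENNReal.ofReal_mul (by positivity), finrank_base hn]
      congr 1
      rw [mul_pow]; ring
  calc (M : ℝ≥0∞) * volume (piB hn '' NMk hn E M k) ≤ M * ∑' i, volume (piB hn '' (NMk hn E M k ∩ t i)) := by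
        gcongr
        refine (measure_mono ?_).trans (measure_iUnion_le _)
        rintro _ ⟨x, hx, rfl⟩
        obtain ⟨i, hi⟩ := mem_iUnion.1 (hcov hx)
        exact mem_iUnion.2 ⟨i, x, ⟨hx, hi⟩, rfl⟩
    _ = ∑' i, M * volume (piB hn '' (NMk hn E M k ∩ t i)) := ENNReal.tsum_mul_left.symm
    _ ≤ ∑' i, ENNReal.ofReal (2 ^ (n - 1) * c) * ENNReal.ofReal (D i ^ (n - 1)) := ENNReal.tsum_le_tsum hpt
    _ = ENNReal.ofReal (2 ^ (n - 1) * c) * ∑' i, ENNReal.ofReal (D i ^ (n - 1)) := ENNReal.tsum_mul_left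
    _ ≤ _ := by
      gcongr
      refine hsum.trans (add_le_add (measure_mono hsub) ?_)
      rw [← ENNReal.ofReal_one]
      exact ENNReal.ofReal_le_ofReal (min_le_left _ _)

lemma sard {E : Set (Euc n)} (hE : MeasurableSet E) (hb : μH[((n - 1 : ℕ):ℝ)] (bd volume E) ≠ ⊤) :
    volume (piB hn '' {x | x ∈ redBoundary E ∧ pr12 hn x ≠ 0 ∧ nu12par hn E x = 0}) = 0 := by
  set N := {x | x ∈ redBoundary E ∧ pr12 hn x ≠ 0 ∧ nu12par hn E x = 0} with hN
  set K := ENNReal.ofReal (2 ^ (n - 1) * (volume : Measure (ℝ × Euc (n - 2))).real (ball 0 1)) *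
        (μH[((n - 1 : ℕ):ℝ)] (bd volume E) + 1) with hK
  have hKt : K ≠ ⊤ := ENNReal.mul_ne_top ENNReal.ofReal_ne_top (by simp [hb])
  have hMb : ∀ M : ℕ, 1 ≤ M → (M : ℝ≥0∞) * volume (piB hn '' N) ≤ K := by
    intro M hM
    have hmono : Monotone fun k => piB hn '' NMk hn E M k := by
      intro k l hkl
      refine image_mono ?_
      rintro x ⟨h1, h2, h3, h4⟩
      have hkl' : 1 / ((l:ℝ) + 1) ≤ 1 / ((k:ℝ) + 1) := by
        apply one_div_le_one_div_of_le (by positivity)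
        have : (k:ℝ) ≤ l := by exact_mod_cast hkl
        linarith
      exact ⟨h1, h2, hkl'.trans h3, fun ρ hρ hρ' => h4 ρ hρ (hρ'.trans_le hkl')⟩
    have hsub : piB hn '' N ⊆ ⋃ k, piB hn '' NMk hn E M k := by
      rintro _ ⟨x, ⟨h1, h2, h3⟩, rfl⟩
      have hM1 : (1:ℝ) ≤ M := by exact_mod_cast hM
      obtain ⟨k, hk⟩ := Rq_of_normal (mtNormal_spec h1) (dl_pos (volume : Measure (Euc n)) (ε := 1 / (6 * M : ℝ)) (by positivity))
      obtain ⟨l, hl⟩ := exists_nat_one_div_lt (norm_pos_iff.2 h2)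
      have e1 : 1 / (((max k l : ℕ):ℝ) + 1) ≤ 1 / ((k:ℝ) + 1) := by
        apply one_div_le_one_div_of_le (by positivity); push_cast; gcongr; exact le_max_left _ _
      have e2 : 1 / (((max k l : ℕ):ℝ) + 1) ≤ 1 / ((l:ℝ) + 1) := by
        apply one_div_le_one_div_of_le (by positivity); push_cast; gcongr; exact le_max_right _ _
      exact mem_iUnion.2 ⟨max k l, x, ⟨h1, h3, e2.trans hl.le, hk _ e1⟩, rfl⟩
    refine (mul_le_mul_right (measure_mono hsub) _).trans ?_
    rw [hmono.measure_iUnion, ENNReal.mul_iSup]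
    exact iSup_le fun k => sard_piece hn hE hb hM
  by_contra h0
  obtain ⟨M, hM⟩ := ENNReal.exists_nat_mul_gt h0 hKt
  rcases Nat.eq_zero_or_pos M with rfl | hM1
  · simp at hM
  exact absurd (hMb M hM1) (not_le.2 hM)

lemma haus_ac_vol (hn : 2 ≤ n) : (μH[((n - 1 : ℕ):ℝ)] : Measure (ℝ × Euc (n - 2))) ≪ volume := by
  have h : (μH[((n - 1 : ℕ):ℝ)] : Measure (ℝ × Euc (n - 2))).IsAddHaarMeasure := by
    rw [← finrank_base hn]; infer_instance
  exact Measure.absolutelyContinuous_isAddHaarMeasure _ _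

lemma vol_ac_haus (hn : 2 ≤ n) : (volume : Measure (ℝ × Euc (n - 2))) ≪ μH[((n - 1 : ℕ):ℝ)] := by
  have h : (μH[((n - 1 : ℕ):ℝ)] : Measure (ℝ × Euc (n - 2))).IsAddHaarMeasure := by
    rw [← finrank_base hn]; infer_instance
  exact Measure.absolutelyContinuous_isAddHaarMeasure _ _

/-- (iii) implies (i) -/
lemma iii_i {E : Set (Euc n)} (hE : MeasurableSet E) (hb : perim E univ < ⊤) {Ω : Set (ℝ × Euc (n - 2))}
    (hΩ : IsOpen Ω)
    (h : ∀ B : Set (ℝ × Euc (n - 2)), MeasurableSet B → B ⊆ Ω → μH[(n : ℝ) - 1] B = 0 →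
        perim E (cylSet hn B) = 0) :
    μH[(n : ℝ) - 1] {x : Euc n | x ∈ redBoundary E ∩ cylSet hn Ω ∧ nu12par hn E x = 0} = 0 := by
  have hb' : μH[((n - 1 : ℕ):ℝ)] (bd volume E) ≠ ⊤ := by
    rw [← cast_dim hn, ← ess_eq_bd hE]
    unfold perim at hb; rw [inter_univ] at hb; exact hb.ne
  have hs := sard hn hE hb'
  set N := {x | x ∈ redBoundary E ∧ pr12 hn x ≠ 0 ∧ nu12par hn E x = 0} with hN
  set B := toMeasurable volume (piB hn '' N) ∩ Ω
  have hB := h B ((measurableSet_toMeasurable _ _).inter hΩ.measurableSet) inter_subset_right (by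
    rw [cast_dim hn]
    apply haus_ac_vol hn
    exact measure_mono_null inter_subset_left (by rw [measure_toMeasurable]; exact hs))
  refine measure_mono_null ?_ hB
  rintro x ⟨⟨h1, h2⟩, h3⟩
  refine ⟨?_, h2.1, ?_, h2.2⟩
  · rw [ess_eq_bd hE]
    rw [red_eq_RB] at h1
    exact RB_subset_bd volume E h1
  · exact subset_toMeasurable _ _ ⟨x, ⟨h1, h2.1, h3⟩, rfl⟩

end Sard


section ClaimY

open Module

lemma haus_null_antilip {X Y : Type*} [MetricSpace X] [MeasurableSpace X] [BorelSpace X] [Nonempty X]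
    [MetricSpace Y] [MeasurableSpace Y] [BorelSpace Y] {d : ℕ} {S : Set X} {f : X → Y} {C : ℝ≥0}
    (h : ∀ x ∈ S, ∀ y ∈ S, dist x y ≤ C * dist (f x) (f y)) (h0 : μH[(d:ℝ)] (f '' S) = 0) :
    μH[(d:ℝ)] S = 0 := by
  have hinj : InjOn f S := by
    intro x hx y hy hxy
    have := h x hx y hy
    rw [hxy, dist_self, mul_zero] at this
    exact dist_le_zero.1 this
  set g := Function.invFunOn f S with hg
  have hgf : ∀ x ∈ S, g (f x) = x := fun x hx =>
    hinj (Function.invFunOn_mem ⟨x, hx, rfl⟩) hx (Function.invFunOn_eq ⟨x, hx, rfl⟩)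
  have hgL : LipschitzOnWith C g (f '' S) := by
    apply LipschitzOnWith.of_dist_le_mul
    rintro _ ⟨x, hx, rfl⟩ _ ⟨y, hy, rfl⟩
    rw [hgf x hx, hgf y hy]; exact h x hx y hy
  have h1 := hgL.hausdorffMeasure_image_le (d := d) (by positivity)
  rw [h0, mul_zero] at h1
  refine measure_mono_null ?_ (le_antisymm h1 (zero_le))
  intro x hx
  exact ⟨f x, ⟨x, hx, rfl⟩, hgf x hx⟩

lemma perp2 {e u v : Euc 2} (he : ‖e‖ = 1) (hu : ⟪u, e⟫ = 0) (hv : ⟪v, e⟫ = 0) :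
    |⟪u, v⟫| = ‖u‖ * ‖v‖ := by
  have he' : e 0 ^ 2 + e 1 ^ 2 = 1 := by
    have := congrArg (fun t => t ^ 2) he
    simpa [EuclideanSpace.norm_sq_eq, Fin.sum_univ_two] using this
  have hun : ‖u‖ ^ 2 = u 0 ^ 2 + u 1 ^ 2 := by simp [EuclideanSpace.norm_sq_eq, Fin.sum_univ_two]
  have hvn : ‖v‖ ^ 2 = v 0 ^ 2 + v 1 ^ 2 := by simp [EuclideanSpace.norm_sq_eq, Fin.sum_univ_two]
  have huv : ⟪u, v⟫ = u 0 * v 0 + u 1 * v 1 := by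
    simp [PiLp.inner_apply, Fin.sum_univ_two, mul_comm]
  have hu' : u 0 * e 0 + u 1 * e 1 = 0 := by
    rw [← hu]; simp [PiLp.inner_apply, Fin.sum_univ_two, mul_comm]
  have hv' : v 0 * e 0 + v 1 * e 1 = 0 := by
    rw [← hv]; simp [PiLp.inner_apply, Fin.sum_univ_two, mul_comm]
  have hdet : u 0 * v 1 - u 1 * v 0 = 0 := by
    have h1 : (u 0 * v 1 - u 1 * v 0) * e 0 = 0 := by linear_combination v 1 * hu' - u 1 * hv'
    have h2 : (u 0 * v 1 - u 1 * v 0) * e 1 = 0 := by linear_combination - v 0 * hu' + u 0 * hv'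
    linear_combination e 0 * h1 + e 1 * h2 - (u 0 * v 1 - u 1 * v 0) * he'
  have hsq : |⟪u, v⟫| ^ 2 = (‖u‖ * ‖v‖) ^ 2 := by
    rw [sq_abs, mul_pow, hun, hvn, huv]
    linear_combination -(u 0 * v 1 - u 1 * v 0) * hdet
  exact (sq_eq_sq₀ (abs_nonneg _) (by positivity)).1 hsq

variable {n : ℕ} (hn : 2 ≤ n)

set_option maxHeartbeats 1000000 in
lemma claimY_pt {E : Set (Euc n)} {x x' : Euc n} {k r0 : ℝ} (hk : 1 ≤ k)
    (hx : x ∈ redBoundary E) (hx' : x' ∈ redBoundary E) (hp : 1 / k ≤ ‖pr12 hn x‖)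
    (hpar : 1 / k ≤ ‖nu12par hn E x‖)
    (h : Rq volume E (dl (volume : Measure (Euc n)) (1 / (4 * k))) r0 x (mtNormal E x))
    (h' : Rq volume E (dl (volume : Measure (Euc n)) (1 / (4 * k))) r0 x' (mtNormal E x'))
    (hrr0 : 2 * ‖x' - x‖ < r0) (hr : ‖x' - x‖ ≤ 1 / (4 * k ^ 2)) : ‖x' - x‖ ≤ (4 * k + 4) * dist (piB hn x') (piB hn x) := by
  have hk0 : 0 < k := by linarith
  have hp0 : 0 < ‖pr12 hn x‖ := lt_of_lt_of_le (by positivity) hp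
  have hpne : pr12 hn x ≠ 0 := norm_pos_iff.1 hp0
  set ν := mtNormal E x with hν
  have hν1 : ‖ν‖ = 1 := (mtNormal_spec hx).1
  have hν1' : ‖mtNormal E x'‖ = 1 := (mtNormal_spec hx').1
  set e := hatv (pr12 hn x) with he
  have he1 : ‖e‖ = 1 := hatv_norm hpne
  have hee : ⟪e, e⟫ = 1 := by rw [real_inner_self_eq_norm_sq, he1]; norm_num
  set a := ⟪pr12 hn ν, e⟫ with ha
  set w := pr12 hn ν - a • e with hw
  have hpar' : 1 / k ≤ ‖w‖ := hpar
  set r := ‖x' - x‖ with hrd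
  have hr0 : 0 ≤ r := norm_nonneg _
  set s := dist (piB hn x') (piB hn x) with hs
  set p := pr12 hn x with hpd
  set p' := pr12 hn x' with hpd'
  set b := ⟪p' - p, e⟫ with hb
  set q := p' - p - b • e with hq
  have htp := two_point (volume : Measure (Euc n)) (E := E) (ε := 1 / (4 * k)) (by positivity)
    (by rw [div_le_one (by positivity)]; linarith) hν1' hν1 h h' hrr0
  have hwe : ⟪w, e⟫ = 0 := by
    rw [hw, inner_sub_left, inner_smul_left, hee]; simp [ha]
  have hqe : ⟪q, e⟫ = 0 := by
    rw [hq, inner_sub_left, inner_smul_left, hee]; simp [hb]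
  have hqw := perp2 he1 hqe hwe
  have hso := second_order (p := p) (p' := p') hpne
  have hrr : ‖p' - p‖ ≤ r := by rw [hpd, hpd', ← pr12_sub]; exact norm_pr12_le hn _
  have hso2 : |‖p'‖ - ‖p‖ - b| ≤ k * r ^ 2 / 2 := by
    refine hso.trans ?_
    rw [div_le_div_iff₀ (by positivity) (by norm_num)]
    have h1 : ‖p' - p‖ ^ 2 ≤ r ^ 2 := by gcongr
    have h2 : 1 ≤ k * ‖p‖ := by rwa [div_le_iff₀' hk0] at hp
    nlinarith [sq_nonneg r]
  have hs1 : |‖p'‖ - ‖p‖| ≤ s := by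
    rw [hs, Prod.dist_eq]; exact le_max_left _ _
  have hs2 : ‖prC hn x' - prC hn x‖ ≤ s := by
    rw [hs, Prod.dist_eq, ← dist_eq_norm]; exact le_max_right _ _
  have hs0 : 0 ≤ s := dist_nonneg
  have hbb : |b| ≤ s + k * r ^ 2 / 2 := by
    rw [abs_le] at *
    constructor <;> linarith [hs1.1, hs1.2, hso2.1, hso2.2]
  have ha1 : |a| ≤ 1 := by
    refine (abs_real_inner_le_norm _ _).trans ?_
    rw [he1, mul_one, ← hν1]; exact norm_pr12_le hn ν
  have hpd2 : p' - p = b • e + q := by rw [hq]; abel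
  have hνd : pr12 hn ν = a • e + w := by rw [hw]; abel
  have hinn : ⟪x' - x, ν⟫ = a * b + ⟪q, w⟫ + ⟪prC hn x' - prC hn x, prC hn ν⟫ := by
    rw [inner_split hn, pr12_sub, prC_sub]
    change ⟪p' - p, pr12 hn ν⟫ + _ = _
    rw [hpd2, hνd]
    simp only [inner_add_left, inner_add_right, inner_smul_left, inner_smul_right, hee, hqe, real_inner_comm w e, hwe]
    simp
  have hC : |⟪prC hn x' - prC hn x, prC hn ν⟫| ≤ s := by
    refine (abs_real_inner_le_norm _ _).trans ?_
    have : ‖prC hn ν‖ ≤ 1 := by rw [← hν1]; exact norm_prC_le hn ν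
    nlinarith [norm_nonneg (prC hn x' - prC hn x), norm_nonneg (prC hn ν)]
  have hab : |a * b| ≤ s + k * r ^ 2 / 2 := by
    rw [abs_mul]
    exact (mul_le_of_le_one_left (abs_nonneg _) ha1).trans hbb
  have hqw2 : ‖q‖ * ‖w‖ ≤ 1 / (4 * k) * r + 2 * s + k * r ^ 2 / 2 := by
    rw [← hqw]
    have e : ⟪q, w⟫ = ⟪x' - x, ν⟫ - a * b - ⟪prC hn x' - prC hn x, prC hn ν⟫ := by rw [hinn]; ring
    rw [e]
    refine (abs_sub _ _).trans ?_
    have := abs_sub ⟪x' - x, ν⟫ (a * b)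
    linarith
  have hqk : ‖q‖ ≤ r / 4 + 2 * k * s + k ^ 2 * r ^ 2 / 2 := by
    have h1 : 1 ≤ k * ‖w‖ := by rwa [div_le_iff₀' hk0] at hpar'
    calc ‖q‖ ≤ k * (‖q‖ * ‖w‖) := by nlinarith [norm_nonneg q]
      _ ≤ k * (1 / (4 * k) * r + 2 * s + k * r ^ 2 / 2) := by gcongr
      _ = _ := by field_simp
  have hrsum : r ≤ ‖q‖ + |b| + s := by
    have h1 : r ^ 2 = ‖p' - p‖ ^ 2 + ‖prC hn x' - prC hn x‖ ^ 2 := by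
      rw [hrd, normsq_split hn, pr12_sub, prC_sub]
    have h2 : ‖p' - p‖ ≤ |b| + ‖q‖ := by
      rw [hpd2]; refine (norm_add_le _ _).trans ?_
      rw [norm_smul, he1, mul_one, Real.norm_eq_abs]
    have h3 : r ≤ ‖p' - p‖ + ‖prC hn x' - prC hn x‖ := by
      nlinarith [norm_nonneg (p' - p), norm_nonneg (prC hn x' - prC hn x)]
    linarith
  have hr4 : k ^ 2 * r ^ 2 ≤ r / 4 := by
    have : k ^ 2 * r ≤ 1 / 4 := by
      rw [← le_div_iff₀' (by positivity)]; refine hr.trans (le_of_eq ?_); field_simp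
    nlinarith
  have hr5 : k * r ^ 2 ≤ k ^ 2 * r ^ 2 := by
    have : k ≤ k ^ 2 := by nlinarith
    nlinarith [sq_nonneg r]
  linarith

lemma claimY {E : Set (Euc n)} {B : Set (ℝ × Euc (n - 2))} (hB : volume B = 0) :
    μH[((n - 1 : ℕ):ℝ)] {x | x ∈ redBoundary E ∧ pr12 hn x ≠ 0 ∧ piB hn x ∈ B ∧ nu12par hn E x ≠ 0} = 0 := by
  set Z : ℕ → ℕ → Set (Euc n) := fun k j => {x | x ∈ redBoundary E ∧ piB hn x ∈ B ∧
    1 / ((k:ℝ) + 1) ≤ ‖pr12 hn x‖ ∧ 1 / ((k:ℝ) + 1) ≤ ‖nu12par hn E x‖ ∧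
    Rq volume E (dl (volume : Measure (Euc n)) (1 / (4 * ((k:ℝ) + 1)))) (1 / ((j:ℝ) + 1)) x (mtNormal E x)} with hZ
  have hcov : {x | x ∈ redBoundary E ∧ pr12 hn x ≠ 0 ∧ piB hn x ∈ B ∧ nu12par hn E x ≠ 0} ⊆ ⋃ k, ⋃ j, Z k j := by
    rintro x ⟨h1, h2, h3, h4⟩
    obtain ⟨k, hk⟩ := exists_nat_one_div_lt (lt_min (norm_pos_iff.2 h2) (norm_pos_iff.2 h4))
    obtain ⟨j, hj⟩ := Rq_of_normal (mtNormal_spec h1) (dl_pos (volume : Measure (Euc n)) (ε := 1 / (4 * ((k:ℝ) + 1))) (by positivity))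
    exact mem_iUnion.2 ⟨k, mem_iUnion.2 ⟨j, h1, h3, hk.le.trans (min_le_left _ _), hk.le.trans (min_le_right _ _), hj _ le_rfl⟩⟩
  refine measure_mono_null hcov (measure_iUnion_null fun k => measure_iUnion_null fun j => ?_)
  refine measure_null_of_locally_null _ fun x0 hx0 => ?_
  set R : ℝ := min (1 / (8 * ((k:ℝ) + 1) ^ 2)) (1 / (8 * ((j:ℝ) + 1))) with hR
  have hR0 : 0 < R := by rw [hR]; positivity
  refine ⟨Z k j ∩ ball x0 R, inter_mem self_mem_nhdsWithin (mem_nhdsWithin_of_mem_nhds (ball_mem_nhds _ hR0)), ?_⟩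
  refine haus_null_antilip (f := piB hn) (C := (4 * ((k:ℝ≥0) + 1) + 4)) ?_ ?_
  · rintro x ⟨⟨h1, h2, h3, h4, h5⟩, hx⟩ y ⟨⟨g1, g2, g3, g4, g5⟩, hy⟩
    have hd : dist x y < 2 * R := by
      have := dist_triangle_right x y x0
      rw [mem_ball] at hx hy
      linarith
    rw [dist_eq_norm] at hd ⊢
    have hk0 : (0:ℝ) < (k:ℝ) + 1 := by positivity
    have hj0 : (0:ℝ) < (j:ℝ) + 1 := by positivity
    have a1 : R ≤ (1 / (4 * ((k:ℝ) + 1) ^ 2)) / 2 := by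
      refine (min_le_left _ _).trans (le_of_eq ?_); field_simp; norm_num
    have a2 : R ≤ (1 / ((j:ℝ) + 1)) / 8 := by
      refine (min_le_right _ _).trans (le_of_eq ?_); field_simp
    have hpj : 0 < 1 / ((j:ℝ) + 1) := by positivity
    have := claimY_pt hn (k := (k:ℝ) + 1) (by linarith [(Nat.cast_nonneg k : (0:ℝ) ≤ k)]) g1 h1 g3 g4 g5 h5 (by linarith) (by linarith)
    simpa using this
  · apply haus_ac_vol hn
    refine measure_mono_null ?_ hB
    rintro _ ⟨x, hx, rfl⟩
    exact hx.1.2.1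

end ClaimY


section Polar

open Module

variable {n : ℕ} (hn : 2 ≤ n)

/-- splitting off the first two coordinates -/
noncomputable def JL : Euc n →ₗ[ℝ] (ℝ × ℝ) × Euc (n - 2) where
  toFun x := ((pr12 hn x 0, pr12 hn x 1), prC hn x)
  map_add' x y := by
    have h1 := (P12 hn).map_add x y
    have h2 := (PC hn).map_add x y
    simp only [P12_apply, PC_apply] at h1 h2
    rw [h1, h2]; rfl
  map_smul' c x := by
    have h1 := (P12 hn).map_smul c x
    have h2 := (PC hn).map_smul c x
    simp only [P12_apply, PC_apply] at h1 h2
    rw [h1, h2]; rfl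

lemma JL_inj : Function.Injective (JL hn) := by
  rw [← LinearMap.ker_eq_bot, LinearMap.ker_eq_bot']
  intro x hx
  have hx' : ((pr12 hn x 0, pr12 hn x 1), prC hn x) = 0 := hx
  simp only [Prod.mk_eq_zero] at hx'
  have h1 : pr12 hn x = 0 := by
    ext i; fin_cases i
    · exact hx'.1.1
    · exact hx'.1.2
  have h := normsq_split hn x
  rw [h1, hx'.2] at h
  simpa using h

/-- the splitting as an equivalence -/
noncomputable def JE : Euc n ≃L[ℝ] (ℝ × ℝ) × Euc (n - 2) :=
  (LinearMap.linearEquivOfInjective (JL hn) (JL_inj hn) (by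
    simp only [finrank_euclideanSpace, Fintype.card_fin, Module.finrank_prod, finrank_self]; omega)).toContinuousLinearEquiv

lemma JE_apply (x : Euc n) : JE hn x = ((pr12 hn x 0, pr12 hn x 1), prC hn x) := rfl

lemma JE_symm_pr12 (a b : ℝ) (y : Euc (n - 2)) : pr12 hn ((JE hn).symm ((a, b), y)) 0 = a ∧
    pr12 hn ((JE hn).symm ((a, b), y)) 1 = b := by
  have h := (JE hn).apply_symm_apply ((a, b), y)
  rw [JE_apply] at h
  simp only [Prod.mk.injEq] at h
  exact h.1

lemma JE_symm_prC (a b : ℝ) (y : Euc (n - 2)) : prC hn ((JE hn).symm ((a, b), y)) = y := by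
  have h := (JE hn).apply_symm_apply ((a, b), y)
  rw [JE_apply] at h
  simp only [Prod.mk.injEq] at h
  exact h.2

lemma norm2 (p : Euc 2) : ‖p‖ ^ 2 = p 0 ^ 2 + p 1 ^ 2 := by simp [EuclideanSpace.norm_sq_eq, Fin.sum_univ_two]

lemma Ang_eq (x : Euc n) : Ang hn x = Real.arccos (‖pr12 hn x‖⁻¹ * pr12 hn x 0) := by
  unfold Ang hatv e1
  rw [EuclideanSpace.inner_single_right]; simp

lemma polar_norm {r θ : ℝ} (hr : 0 ≤ r) (y : Euc (n - 2)) :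
    ‖pr12 hn ((JE hn).symm ((r * Real.cos θ, r * Real.sin θ), y))‖ = r := by
  have h := norm2 (pr12 hn ((JE hn).symm ((r * Real.cos θ, r * Real.sin θ), y)))
  rw [(JE_symm_pr12 hn _ _ y).1, (JE_symm_pr12 hn _ _ y).2] at h
  have h2 : ‖pr12 hn ((JE hn).symm ((r * Real.cos θ, r * Real.sin θ), y))‖ ^ 2 = r ^ 2 := by
    rw [h]; linear_combination r ^ 2 * Real.cos_sq_add_sin_sq θ
  exact (sq_eq_sq₀ (norm_nonneg _) hr).1 h2

lemma polar_piB {r θ : ℝ} (hr : 0 ≤ r) (y : Euc (n - 2)) :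
    piB hn ((JE hn).symm ((r * Real.cos θ, r * Real.sin θ), y)) = (r, y) := by
  unfold piB
  rw [polar_norm hn hr, JE_symm_prC]

lemma polar_Ang {r θ : ℝ} (hr : 0 < r) (hθ : |θ| ≤ Real.pi) (y : Euc (n - 2)) :
    Ang hn ((JE hn).symm ((r * Real.cos θ, r * Real.sin θ), y)) = |θ| := by
  rw [Ang_eq, polar_norm hn hr.le, (JE_symm_pr12 hn _ _ y).1, inv_mul_cancel_left₀ hr.ne', ← Real.cos_abs,
    Real.arccos_cos (abs_nonneg _) hθ]

instance instHaarSplit {m : ℕ} : (volume : Measure ((ℝ × ℝ) × Euc m)).IsAddHaarMeasure := by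
  haveI : (volume : Measure (ℝ × ℝ)).IsAddHaarMeasure := by
    rw [Measure.volume_eq_prod]; infer_instance
  rw [Measure.volume_eq_prod]; infer_instance

/-- the constant of the splitting (it equals one, but this is not needed) -/
noncomputable def cJ : ℝ≥0 :=
  haveI : (Measure.map (JE hn) volume).IsAddHaarMeasure := (JE hn).isAddHaarMeasure_map volume
  Measure.addHaarScalarFactor (Measure.map (JE hn) volume) volume

lemma cJ_pos : 0 < cJ hn := by
  haveI : (Measure.map (JE hn) volume).IsAddHaarMeasure := (JE hn).isAddHaarMeasure_map volume
  exact Measure.addHaarScalarFactor_pos_of_isAddHaarMeasure _ _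

lemma map_JE : Measure.map (JE hn) volume = cJ hn • (volume : Measure ((ℝ × ℝ) × Euc (n - 2))) := by
  haveI : (Measure.map (JE hn) volume).IsAddHaarMeasure := (JE hn).isAddHaarMeasure_map volume
  exact Measure.isAddLeftInvariant_eq_smul _ _

lemma polar_lint {G : (ℝ × Euc (n - 2)) × ℝ → ℝ≥0∞} (hG : Measurable G) :
    ∫⁻ x : Euc n, G (piB hn x, Ang hn x) = cJ hn * ∫⁻ p in Ioi (0:ℝ) ×ˢ (univ : Set (Euc (n - 2))),
      ENNReal.ofReal p.1 * ∫⁻ θ in Ioo (-Real.pi) Real.pi, G (p, |θ|) := by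
  set H : (ℝ × ℝ) × Euc (n - 2) → ℝ≥0∞ := fun z => G (piB hn ((JE hn).symm z), Ang hn ((JE hn).symm z)) with hH
  have hHm : Measurable H := hG.comp
    (((piB_cont hn).measurable.prodMk (Ang_meas hn)).comp (JE hn).symm.continuous.measurable)
  have habs : Measurable fun θ : ℝ => |θ| := continuous_abs.measurable
  have e1 : ∫⁻ x : Euc n, G (piB hn x, Ang hn x) = ∫⁻ z, H z ∂(Measure.map (JE hn) volume) := by
    rw [lintegral_map hHm (JE hn).continuous.measurable]
    simp [hH]
  rw [e1, map_JE, lintegral_smul_measure, ENNReal.smul_def, smul_eq_mul]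
  congr 1
  rw [Measure.volume_eq_prod, lintegral_prod_symm _ hHm.aemeasurable]
  have e2 : ∀ y : Euc (n - 2), ∫⁻ p : ℝ × ℝ, H (p, y) =
      ∫⁻ r in Ioi (0:ℝ), ENNReal.ofReal r * ∫⁻ θ in Ioo (-Real.pi) Real.pi, G ((r, y), |θ|) := by
    intro y
    rw [← lintegral_comp_polarCoord_symm]
    have e3 : ∫⁻ p in polarCoord.target, ENNReal.ofReal p.1 • H (polarCoord.symm p, y) =
        ∫⁻ p in Ioi (0:ℝ) ×ˢ Ioo (-Real.pi) Real.pi, ENNReal.ofReal p.1 * G ((p.1, y), |p.2|) := by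
      refine setLIntegral_congr_fun (measurableSet_Ioi.prod measurableSet_Ioo) ?_
      rintro ⟨r, θ⟩ ⟨hr, hθ⟩
      have hr' : 0 < r := hr
      have hθ' : |θ| ≤ Real.pi := abs_le.2 ⟨hθ.1.le, hθ.2.le⟩
      simp only [hH, smul_eq_mul]
      change _ * G (piB hn ((JE hn).symm ((r * Real.cos θ, r * Real.sin θ), y)), Ang hn ((JE hn).symm ((r * Real.cos θ, r * Real.sin θ), y))) = _
      rw [polar_piB hn hr'.le, polar_Ang hn hr' hθ']
    rw [e3, Measure.volume_eq_prod, ← Measure.prod_restrict, lintegral_prod]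
    · refine lintegral_congr fun r => ?_
      have hh : Measurable fun θ : ℝ => G ((r, y), |θ|) := hG.comp (measurable_const.prodMk habs)
      exact lintegral_const_mul (μ := volume.restrict (Ioo (-Real.pi) Real.pi)) (ENNReal.ofReal r) hh
    · refine Measurable.aemeasurable ?_
      refine Measurable.mul (by fun_prop) ?_
      exact hG.comp ((by fun_prop : Measurable fun p : ℝ × ℝ => (p.1, y)).prodMk (habs.comp measurable_snd))
  simp_rw [e2]
  have hm : Measurable fun p : ℝ × Euc (n - 2) => ENNReal.ofReal p.1 * ∫⁻ θ in Ioo (-Real.pi) Real.pi, G (p, |θ|) := by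
    refine Measurable.mul (by fun_prop) ?_
    exact Measurable.lintegral_prod_right' (f := fun z : (ℝ × Euc (n - 2)) × ℝ => G (z.1, |z.2|))
      (hG.comp (measurable_fst.prodMk (habs.comp measurable_snd)))
  rw [show (volume : Measure (ℝ × Euc (n - 2))) = volume.prod volume from rfl, ← Measure.prod_restrict,
    Measure.restrict_univ, lintegral_prod_symm _ hm.aemeasurable]

end Polar


theorem riesz18 {W : Type*} [NormedAddCommGroup W] [NormedSpace ℝ W] [FiniteDimensional ℝ W]
    [MeasurableSpace W] [BorelSpace W]
    (vol μ : Measure W) [SigmaFinite vol] [IsFiniteMeasure μ] (hac : μ ≪ vol)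
    (S : Submodule ℝ (W → ℝ)) (hS : ∀ φ ∈ S, Continuous φ ∧ HasCompactSupport φ)
    (T : S →ₗ[ℝ] ℝ) (hT : ∀ φ : S, |T φ| ≤ ∫ x, |(φ : W → ℝ) x| ∂μ) :
    ∃ G : W → ℝ, Integrable G vol ∧ ∀ φ : S, T φ = ∫ x, (φ : W → ℝ) x * G x ∂vol := by
  classical
  have hmem : ∀ φ : S, MemLp (φ : W → ℝ) 2 μ := fun φ =>
    (hS φ φ.2).1.memLp_of_hasCompactSupport (hS φ φ.2).2
  let ι : S →ₗ[ℝ] Lp ℝ 2 μ :=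
    { toFun := fun φ => (hmem φ).toLp
      map_add' := fun φ ψ => by
        rw [← MemLp.toLp_add]; rfl
      map_smul' := fun c φ => by
        simp only [RingHom.id_apply]
        rw [← MemLp.toLp_const_smul]; rfl }
  set M : ℝ := (μ univ ^ ((1:ℝ)/2)).toReal with hM
  have hb : ∀ φ : S, |T φ| ≤ M * ‖ι φ‖ := by
    intro φ
    refine (hT φ).trans ?_
    have h1 : ∫ x, |(φ : W → ℝ) x| ∂μ = (eLpNorm (φ : W → ℝ) 1 μ).toReal := by
      rw [eLpNorm_one_eq_lintegral_enorm]
      have := integral_norm_eq_lintegral_enorm (hmem φ).1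
      simpa [Real.norm_eq_abs] using this
    have h2 : ‖ι φ‖ = (eLpNorm (φ : W → ℝ) 2 μ).toReal := Lp.norm_toLp _ (hmem φ)
    rw [h1, h2, hM, mul_comm, ← ENNReal.toReal_mul]
    have h3 := eLpNorm_le_eLpNorm_mul_rpow_measure_univ (μ := μ) (p := 1) (q := 2) (by norm_num)
      (hmem φ).1
    refine ENNReal.toReal_mono ?_ (h3.trans (le_of_eq ?_))
    · refine ENNReal.mul_ne_top (hmem φ).2.ne ?_
      exact ENNReal.rpow_ne_top_of_nonneg (by norm_num) (measure_ne_top _ _)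
    · congr 2
      norm_num
  have hk : ∀ φ ψ : S, ι φ = ι ψ → T φ = T ψ := by
    intro φ ψ h
    have h3 : |T (φ - ψ)| ≤ 0 := by
      refine (hb _).trans (le_of_eq ?_)
      rw [map_sub, h]
      simp
    have h4 := abs_nonpos_iff.1 h3
    rw [map_sub] at h4
    linarith
  have hsur : ∀ y : LinearMap.range ι, ∃ φ : S, ι φ = y := fun y => y.2
  choose g hgι using hsur
  let f : LinearMap.range ι →ₗ[ℝ] ℝ :=
    { toFun := fun y => T (g y)
      map_add' := fun y z => by
        rw [← map_add]; apply hk; rw [map_add, hgι, hgι, hgι]; rfl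
      map_smul' := fun c y => by
        rw [RingHom.id_apply, ← map_smul]; apply hk; rw [map_smul, hgι, hgι]; rfl }
  have hfb : ∀ y, ‖f y‖ ≤ M * ‖y‖ := by
    intro y
    have := hb (g y)
    rw [hgι] at this
    exact this
  obtain ⟨F, hF, -⟩ := exists_extension_norm_eq (LinearMap.range ι) (f.mkContinuous M hfb)
  have hTF : ∀ φ : S, T φ = F (ι φ) := by
    intro φ
    have h1 := hF (ι.rangeRestrict φ)
    rw [LinearMap.mkContinuous_apply] at h1
    have h2 : F (ι φ) = T (g (ι.rangeRestrict φ)) := h1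
    rw [h2]
    apply hk
    rw [hgι]; rfl
  set v : Lp ℝ 2 μ := (InnerProductSpace.toDual ℝ (Lp ℝ 2 μ)).symm F with hv
  have hFv : ∀ y, F y = ⟪v, y⟫ := fun y => (InnerProductSpace.toDual_symm_apply).symm
  have hvint : Integrable v μ := (Lp.memLp v).integrable (by norm_num)
  refine ⟨fun x => (μ.rnDeriv vol x).toReal * v x, ?_, fun φ => ?_⟩
  · exact (integrable_rnDeriv_smul_iff hac).2 hvint
  · rw [hTF, hFv, L2.inner_def]
    have h1 : ∫ x, ⟪v x, (ι φ : Lp ℝ 2 μ) x⟫ ∂μ = ∫ x, (φ : W → ℝ) x * v x ∂μ := by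
      refine integral_congr_ae ?_
      filter_upwards [(hmem φ).coeFn_toLp] with x hx
      have : (ι φ : Lp ℝ 2 μ) x = (φ : W → ℝ) x := hx
      rw [this]; rfl
    rw [h1, ← integral_rnDeriv_smul hac]
    refine integral_congr_ae (Eventually.of_forall fun x => ?_)
    simp only [smul_eq_mul]; ring

/-- The submodule of `C^1_c(Ω)`. -/
def C1c {W : Type*} [NormedAddCommGroup W] [NormedSpace ℝ W] (Ω : Set W) : Submodule ℝ (W → ℝ) where
  carrier := {φ | ContDiff ℝ 1 φ ∧ HasCompactSupport φ ∧ tsupport φ ⊆ Ω}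
  zero_mem' := ⟨contDiff_const, HasCompactSupport.zero, by simp [tsupport]⟩
  add_mem' := fun {a b} ha hb => ⟨ha.1.add hb.1, ha.2.1.add hb.2.1,
    (tsupport_add a b).trans (union_subset ha.2.2 hb.2.2)⟩
  smul_mem' := fun c φ h => by
    refine ⟨contDiff_const.smul h.1, (h.2.1.smul_left : HasCompactSupport ((fun _ : W => c) • φ)), ?_⟩
    exact (closure_mono (Function.support_const_smul_subset c φ)).trans h.2.2

theorem contDiff_of_ts {W : Type*} [NormedAddCommGroup W] [NormedSpace ℝ W] {φ : W → ℝ}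
    {Ω : Set W} (hs : tsupport φ ⊆ Ω)
    (h : ∀ x ∈ Ω, ContDiffAt ℝ 1 φ x) : ContDiff ℝ 1 φ := by
  rw [contDiff_iff_contDiffAt]
  intro x
  by_cases hx : x ∈ tsupport φ
  · exact h x (hs hx)
  · have : φ =ᶠ[𝓝 x] fun _ => 0 := notMem_tsupport_iff_eventuallyEq.1 hx
    exact contDiffAt_const.congr_of_eventuallyEq this


section Sob
variable {m : ℕ}

theorem li_mul {W : Type*} [NormedAddCommGroup W] [MeasurableSpace W]
    [BorelSpace W] {μ : Measure W} {f φ : W → ℝ} {Ω : Set W}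
    (hf : LocallyIntegrableOn f Ω μ) (hφ : Continuous φ) (hc : HasCompactSupport φ)
    (hs : tsupport φ ⊆ Ω) : Integrable (fun x => f x * φ x) μ := by
  have h1 : IntegrableOn f (tsupport φ) μ := hf.integrableOn_compact_subset hs hc
  have h2 : IntegrableOn (fun x => f x * φ x) (tsupport φ) μ :=
    h1.mul_continuousOn hφ.continuousOn hc
  rw [← integrableOn_univ]
  refine h2.of_forall_sdiff_eq_zero MeasurableSet.univ (fun x hx => ?_)
  rw [image_eq_zero_of_notMem_tsupport hx.2, mul_zero]

theorem C1c_fd {W : Type*} [NormedAddCommGroup W] [NormedSpace ℝ W] {Ω : Set W} {φ : W → ℝ}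
    (h : φ ∈ C1c Ω) (y : W) : Continuous (fun x => fderiv ℝ φ x y) ∧
      HasCompactSupport (fun x => fderiv ℝ φ x y) ∧ tsupport (fun x => fderiv ℝ φ x y) ⊆ Ω :=
  ⟨(h.1.continuous_fderiv one_ne_zero).clm_apply continuous_const, h.2.1.fderiv_apply ℝ y,
    (tsupport_fderiv_apply_subset ℝ y).trans h.2.2⟩

theorem C1c_divr {Ω : Set (ℝ × Euc m)} (hΩ : Ω ⊆ Ioi (0:ℝ) ×ˢ univ) {φ : ℝ × Euc m → ℝ}
    (h : φ ∈ C1c Ω) : (fun p : ℝ × Euc m => φ p / p.1) ∈ C1c Ω := by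
  have hsub : tsupport (fun p : ℝ × Euc m => φ p / p.1) ⊆ tsupport φ := by
    apply closure_mono
    intro p hp hp'
    exact hp (by simp [hp'])
  refine ⟨contDiff_of_ts (hsub.trans h.2.2) fun x hx => ?_, ?_, hsub.trans h.2.2⟩
  · have : x.1 ≠ 0 := (hΩ hx).1.ne'
    exact h.1.contDiffAt.div contDiffAt_fst this
  · exact h.2.1.mono' (subset_closure.trans hsub)

theorem fd_divr {φ : ℝ × Euc m → ℝ} (h : ContDiff ℝ 1 φ) (p y : ℝ × Euc m) (hp : p.1 ≠ 0) :
    fderiv ℝ (fun p : ℝ × Euc m => φ p / p.1) p y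
      = fderiv ℝ φ p y / p.1 - φ p * y.1 / p.1 ^ 2 := by
  have h1 : HasFDerivAt φ (fderiv ℝ φ p) p := (h.differentiable one_ne_zero p).hasFDerivAt
  have h2 : HasFDerivAt (fun p : ℝ × Euc m => p.1) (ContinuousLinearMap.fst ℝ ℝ (Euc m)) p :=
    hasFDerivAt_fst
  have h3 := h1.fun_mul ((hasDerivAt_inv hp).comp_hasFDerivAt p h2)
  have h4 : (fun p : ℝ × Euc m => φ p / p.1) = fun p => φ p * (Inv.inv ∘ fun p => p.1) p := by
    ext p; simp [div_eq_mul_inv]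
  rw [h4, h3.fderiv]
  simp
  field_simp
  ring

theorem li_divr {E : Type*} [NormedAddCommGroup E] [NormedSpace ℝ E] {Ω : Set (ℝ × Euc m)}
    (ho : IsOpen Ω) (hΩ : Ω ⊆ Ioi (0:ℝ) ×ˢ univ)
    {f : ℝ × Euc m → E} (hf : LocallyIntegrableOn f Ω volume) :
    LocallyIntegrableOn (fun p => (p.1)⁻¹ • f p) Ω volume := by
  refine hf.continuousOn_smul ho.isLocallyClosed ?_
  exact continuous_fst.continuousOn.inv₀ fun p hp => (hΩ hp).1.ne'

theorem W11_divr {Ω : Set (ℝ × Euc m)} (ho : IsOpen Ω) (hΩ : Ω ⊆ Ioi (0:ℝ) ×ˢ univ)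
    {f : ℝ × Euc m → ℝ} (hf : W11locProd f Ω) : W11locProd (fun p => f p / p.1) Ω := by
  obtain ⟨g1, g2, hf0, hg1, hg2, H⟩ := hf
  have hfr := li_divr ho hΩ hf0
  have hfrr := li_divr ho hΩ hfr
  have hg1r := li_divr ho hΩ hg1
  have hg2r := li_divr ho hΩ hg2
  refine ⟨fun p => (p.1)⁻¹ • g1 p - (p.1)⁻¹ • (p.1)⁻¹ • f p, fun p => (p.1)⁻¹ • g2 p, ?_,
    hg1r.sub hfrr, hg2r, ?_⟩
  · refine hfr.congr ?_
    exact Eventually.of_forall fun p => by simp [div_eq_inv_mul]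
  intro φ h1 h2 h3 y
  have hφ : φ ∈ C1c Ω := ⟨h1, h2, h3⟩
  have hψ := C1c_divr hΩ hφ
  have key := H _ hψ.1 hψ.2.1 hψ.2.2 y
  have hi1 : Integrable (fun p => f p * fderiv ℝ (fun p : ℝ × Euc m => φ p / p.1) p y) volume := by
    obtain ⟨a, b, c⟩ := C1c_fd hψ y
    exact li_mul hf0 a b c
  have hi2 : Integrable (fun p => (p.1⁻¹ • p.1⁻¹ • f p) * φ p) volume :=
    li_mul hfrr h1.continuous h2 h3
  have hgy : LocallyIntegrableOn (fun p => g1 p * y.1 + ⟪g2 p, y.2⟫) Ω volume := by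
    refine LocallyIntegrableOn.add (f := fun p => g1 p * y.1) ?_ ?_
    · simp_rw [mul_comm _ y.1]; exact hg1.smul y.1
    · intro x hx
      obtain ⟨s, hs, hs'⟩ := hg2 x hx
      exact ⟨s, hs, hs'.inner_const y.2⟩
  have hi3 : Integrable (fun p => (g1 p * y.1 + ⟪g2 p, y.2⟫) * (φ p / p.1)) volume :=
    li_mul hgy hψ.1.continuous hψ.2.1 hψ.2.2
  have e1 : (∫ x in Ω, f x / x.1 * fderiv ℝ φ x y)
      = (∫ x in Ω, f x * fderiv ℝ (fun p : ℝ × Euc m => φ p / p.1) x y)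
        + ∫ x in Ω, y.1 * ((x.1⁻¹ • x.1⁻¹ • f x) * φ x) := by
    rw [← integral_add hi1.integrableOn (hi2.const_mul _).integrableOn]
    refine setIntegral_congr_fun ho.measurableSet fun x hx => ?_
    have : x.1 ≠ 0 := (hΩ hx).1.ne'
    simp only [smul_eq_mul]
    rw [fd_divr h1 x y this]
    field_simp
    ring
  have e2 : (∫ x in Ω, φ x * ((x.1⁻¹ • g1 x - x.1⁻¹ • x.1⁻¹ • f x) * y.1 + ⟪x.1⁻¹ • g2 x, y.2⟫))
      = (∫ x in Ω, (φ x / x.1) * (g1 x * y.1 + ⟪g2 x, y.2⟫))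
        - ∫ x in Ω, y.1 * ((x.1⁻¹ • x.1⁻¹ • f x) * φ x) := by
    rw [← integral_sub _ (hi2.const_mul _).integrableOn]
    · refine setIntegral_congr_fun ho.measurableSet fun x hx => ?_
      simp only [smul_eq_mul, real_inner_smul_left]
      ring
    · refine (hi3.congr (Eventually.of_forall fun x => ?_)).integrableOn
      exact mul_comm _ _
  rw [e1, e2, key]
  ring

end Sob


section Push
variable {n : ℕ} (hn : 2 ≤ n)

theorem slab_len (u : ℝ) (h0 : 0 ≤ u) (h1 : u ≤ Real.pi) :
    (∫⁻ θ in Ioo (-Real.pi) Real.pi, (if |θ| < u then (1:ℝ≥0∞) else 0)) = ENNReal.ofReal (2 * u) := by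
  have e : (fun θ : ℝ => if |θ| < u then (1:ℝ≥0∞) else 0) = (Ioo (-u) u).indicator (fun _ => 1) := by
    ext θ
    simp only [indicator, mem_Ioo, abs_lt]
  rw [e, lintegral_indicator measurableSet_Ioo, Measure.restrict_restrict measurableSet_Ioo,
    inter_eq_self_of_subset_left (Ioo_subset_Ioo (by linarith) h1)]
  rw [lintegral_const, one_mul, Measure.restrict_apply_univ, Real.volume_Ioo]
  congr 1; ring

theorem piB_fst_ne {x : Euc n} : (piB hn x).1 ≠ 0 ↔ pr12 hn x ≠ 0 := by
  simp [piB]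

theorem push_lint {ℓ : ℝ × Euc (n - 2) → ℝ} (hl : Measurable ℓ)
    (h0 : ∀ p ∈ (Ioi (0:ℝ)) ×ˢ (univ : Set (Euc (n - 2))), 0 ≤ ℓ p)
    (hle : ∀ᵐ p ∂(volume.restrict ((Ioi (0:ℝ)) ×ˢ (univ : Set (Euc (n - 2))))),
      ℓ p ≤ 2 * Real.pi * p.1) {G : ℝ × Euc (n - 2) → ℝ≥0∞} (hG : Measurable G) :
    ∫⁻ x in circSymm hn ℓ, G (piB hn x)
      = ∫⁻ p in (Ioi (0:ℝ)) ×ˢ univ, (cJ hn : ℝ≥0∞) * ENNReal.ofReal (ℓ p) * G p := by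
  classical
  set G' : (ℝ × Euc (n - 2)) × ℝ → ℝ≥0∞ := fun q =>
    if q.1.1 ≠ 0 ∧ q.2 < uu ℓ q.1 then G q.1 else 0 with hG'
  have hG'm : Measurable G' := by
    refine Measurable.ite ?_ (hG.comp measurable_fst) measurable_const
    refine MeasurableSet.inter (s₁ := {q : (ℝ × Euc (n - 2)) × ℝ | q.1.1 ≠ 0}) ?_ ?_
    · exact (measurable_fst.fst (measurableSet_singleton (0:ℝ))).compl
    · exact measurableSet_lt measurable_snd ((uu_meas hl).comp measurable_fst)
  have h1 := polar_lint hn hG'm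
  have h2 : ∫⁻ x in circSymm hn ℓ, G (piB hn x) = ∫⁻ x : Euc n, G' (piB hn x, Ang hn x) := by
    rw [← lintegral_indicator (circ_meas hn hl)]
    refine lintegral_congr fun x => ?_
    simp only [indicator, circ_mem, hG', piB_fst_ne]
  rw [h2, h1, ← lintegral_const_mul']
  swap
  · exact ENNReal.coe_ne_top
  refine lintegral_congr_ae ?_
  filter_upwards [hle, ae_restrict_mem (measurableSet_Ioi.prod MeasurableSet.univ)] with p hp hp0
  have hr : 0 < p.1 := hp0.1
  have hl0 := h0 p hp0
  have h3 : ∀ θ : ℝ, G' (p, |θ|) = G p * (if |θ| < uu ℓ p then (1:ℝ≥0∞) else 0) := by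
    intro θ
    simp [hG', hr.ne']
  have hmm : Measurable fun θ : ℝ => (if |θ| < uu ℓ p then (1:ℝ≥0∞) else 0) :=
    Measurable.ite (measurableSet_lt continuous_abs.measurable measurable_const)
      measurable_const measurable_const
  simp_rw [h3]
  rw [lintegral_const_mul _ hmm, slab_len]
  · have : ENNReal.ofReal (ℓ p) = ENNReal.ofReal p.1 * ENNReal.ofReal (2 * uu ℓ p) := by
      rw [← ENNReal.ofReal_mul hr.le]
      congr 1
      simp only [uu]; field_simp
    rw [this]; ring
  · simp only [uu]; positivity
  · simp only [uu]
    rw [div_le_iff₀ (by positivity)]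
    linarith

variable {ℓ : ℝ × Euc (n - 2) → ℝ} (hl : Measurable ℓ)
    (h0 : ∀ p ∈ (Ioi (0:ℝ)) ×ˢ (univ : Set (Euc (n - 2))), 0 ≤ ℓ p)
    (hle : ∀ᵐ p ∂(volume.restrict ((Ioi (0:ℝ)) ×ˢ (univ : Set (Euc (n - 2))))),
      ℓ p ≤ 2 * Real.pi * p.1)

theorem push_map (hl : Measurable ℓ)
    (h0 : ∀ p ∈ (Ioi (0:ℝ)) ×ˢ (univ : Set (Euc (n - 2))), 0 ≤ ℓ p)
    (hle : ∀ᵐ p ∂(volume.restrict ((Ioi (0:ℝ)) ×ˢ (univ : Set (Euc (n - 2))))),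
      ℓ p ≤ 2 * Real.pi * p.1) :
    Measure.map (piB hn) (volume.restrict (circSymm hn ℓ))
      = (volume.restrict ((Ioi (0:ℝ)) ×ˢ univ)).withDensity
          (fun p => (cJ hn : ℝ≥0∞) * ENNReal.ofReal (ℓ p)) := by
  have hm : Measurable fun p => (cJ hn : ℝ≥0∞) * ENNReal.ofReal (ℓ p) :=
    hl.ennreal_ofReal.const_mul _
  refine Measure.ext_of_lintegral _ fun G hG => ?_
  rw [lintegral_map hG (piB_cont hn).measurable, push_lint hn hl h0 hle hG,
    lintegral_withDensity_eq_lintegral_mul _ hm hG]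
  rfl

theorem push_int (hl : Measurable ℓ)
    (h0 : ∀ p ∈ (Ioi (0:ℝ)) ×ˢ (univ : Set (Euc (n - 2))), 0 ≤ ℓ p)
    (hle : ∀ᵐ p ∂(volume.restrict ((Ioi (0:ℝ)) ×ˢ (univ : Set (Euc (n - 2))))),
      ℓ p ≤ 2 * Real.pi * p.1) {g : ℝ × Euc (n - 2) → ℝ} (hg : Measurable g) :
    ∫ x in circSymm hn ℓ, g (piB hn x)
      = cJ hn * ∫ p in (Ioi (0:ℝ)) ×ˢ univ, ℓ p * g p := by
  have hm : Measurable fun p => (cJ hn : ℝ≥0∞) * ENNReal.ofReal (ℓ p) :=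
    hl.ennreal_ofReal.const_mul _
  rw [← integral_map (piB_cont hn).measurable.aemeasurable hg.aestronglyMeasurable,
    push_map hn hl h0 hle, integral_withDensity_eq_integral_toReal_smul hm
      (Eventually.of_forall fun p => ENNReal.mul_lt_top ENNReal.coe_lt_top ENNReal.ofReal_lt_top),
    ← integral_const_mul]
  refine setIntegral_congr_fun (measurableSet_Ioi.prod MeasurableSet.univ) fun p hp => ?_
  simp only [smul_eq_mul, ENNReal.toReal_mul, ENNReal.toReal_ofReal (h0 p hp), ENNReal.coe_toReal]
  ring

theorem ell_int (hl : Measurable ℓ)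
    (h0 : ∀ p ∈ (Ioi (0:ℝ)) ×ˢ (univ : Set (Euc (n - 2))), 0 ≤ ℓ p)
    (hle : ∀ᵐ p ∂(volume.restrict ((Ioi (0:ℝ)) ×ˢ (univ : Set (Euc (n - 2))))),
      ℓ p ≤ 2 * Real.pi * p.1) (hv : volume (circSymm hn ℓ) < ⊤) :
    IntegrableOn ℓ ((Ioi (0:ℝ)) ×ˢ univ) volume := by
  have h1 := push_lint hn hl h0 hle (G := fun _ => 1) measurable_const
  simp only [lintegral_const, one_mul, mul_one, Measure.restrict_apply_univ] at h1
  rw [lintegral_const_mul _ hl.ennreal_ofReal] at h1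
  refine ⟨hl.aestronglyMeasurable, ?_⟩
  rw [hasFiniteIntegral_iff_ofReal]
  · have h2 : (cJ hn : ℝ≥0∞) ≠ 0 := by
      exact_mod_cast (cJ_pos hn).ne'
    by_contra h3
    rw [not_lt, top_le_iff] at h3
    rw [h3, ENNReal.mul_top h2] at h1
    exact hv.ne h1
  · filter_upwards [ae_restrict_mem (measurableSet_Ioi.prod MeasurableSet.univ)] with p hp
    exact h0 p hp

end Push


section TestF
variable {n : ℕ} (hn : 2 ≤ n)

theorem piB_deriv {x : Euc n} (hx : pr12 hn x ≠ 0) :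
    HasFDerivAt (piB hn)
      ((‖pr12 hn x‖⁻¹ • (innerSL ℝ (pr12 hn x)).comp (P12 hn)).prod (PC hn)) x := by
  have hne : ‖pr12 hn x‖ ≠ 0 := norm_ne_zero_iff.2 hx
  have h1 : HasFDerivAt (fun y : Euc 2 => ‖y‖ ^ 2) (2 • (innerSL ℝ (pr12 hn x))) (pr12 hn x) :=
    (hasStrictFDerivAt_norm_sq (pr12 hn x)).hasFDerivAt
  have h2 := h1.sqrt (by positivity)
  have h3 : (fun y : Euc 2 => √(‖y‖ ^ 2)) = fun y => ‖y‖ := by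
    ext y; exact Real.sqrt_sq (norm_nonneg _)
  rw [h3, Real.sqrt_sq (norm_nonneg _)] at h2
  have h4 : HasFDerivAt (P12 hn) (P12 hn) x := (P12 hn).hasFDerivAt
  have h5 : HasFDerivAt (PC hn) (PC hn) x := (PC hn).hasFDerivAt
  have h6 := (HasFDerivAt.comp x (show HasFDerivAt (fun y : Euc 2 => ‖y‖) _ (P12 hn x) from h2) h4).prodMk h5
  refine h6.congr_fderiv ?_
  ext v
  · simp
    field_simp
  · simp

theorem comp_piB {Ω : Set (ℝ × Euc (n - 2))} (hΩ : Ω ⊆ Ioi (0:ℝ) ×ˢ univ)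
    {ψ : ℝ × Euc (n - 2) → ℝ} (h : ψ ∈ C1c Ω) {a : Euc n → ℝ} (ha : ContDiff ℝ 1 a) :
    ContDiff ℝ 1 (fun x => a x * ψ (piB hn x)) ∧ HasCompactSupport (fun x => a x * ψ (piB hn x)) := by
  have hK : IsCompact (piB hn ⁻¹' tsupport ψ) := by
    refine Metric.isCompact_of_isClosed_isBounded ((isClosed_tsupport ψ).preimage (piB_cont hn)) ?_
    obtain ⟨R, hR⟩ := h.2.1.isBounded.exists_norm_le
    refine (Metric.isBounded_closedBall (x := (0 : Euc n)) (r := R + R)).subset fun x hx => ?_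
    rw [mem_closedBall_zero_iff]
    have h1 := hR _ hx
    have h2 : ‖pr12 hn x‖ ≤ R := by
      have := (norm_fst_le (piB hn x)).trans h1
      simpa [piB] using this
    have h3 : ‖prC hn x‖ ≤ R := (norm_snd_le (piB hn x)).trans h1
    have h4 := normsq_split hn x
    nlinarith [norm_nonneg (pr12 hn x), norm_nonneg (prC hn x), norm_nonneg x]
  have hsub : tsupport (fun x => a x * ψ (piB hn x)) ⊆ piB hn ⁻¹' tsupport ψ := by
    refine closure_minimal (fun x hx => ?_) ((isClosed_tsupport ψ).preimage (piB_cont hn))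
    refine subset_closure ?_
    intro h0
    exact hx (by simp [h0])
  refine ⟨contDiff_of_ts hsub fun x hx => ?_, HasCompactSupport.of_support_subset_isCompact hK
    (subset_closure.trans hsub)⟩
  have hx0 : pr12 hn x ≠ 0 := by
    rw [← piB_fst_ne hn]
    exact (hΩ (h.2.2 hx)).1.ne'
  refine ha.contDiffAt.mul ?_
  refine h.1.contDiffAt.comp x ?_
  refine ContDiffAt.prodMk ?_ (PC hn).contDiff.contDiffAt
  exact (P12 hn).contDiff.contDiffAt.norm ℝ hx0

theorem fd_comp {Ω : Set (ℝ × Euc (n - 2))} 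
    {ψ : ℝ × Euc (n - 2) → ℝ} (h : ψ ∈ C1c Ω) {a : Euc n → ℝ} (ha : ContDiff ℝ 1 a)
    {x : Euc n} (hx : pr12 hn x ≠ 0) (v : Euc n) :
    fderiv ℝ (fun x => a x * ψ (piB hn x)) x v = fderiv ℝ a x v * ψ (piB hn x)
      + a x * fderiv ℝ ψ (piB hn x) (‖pr12 hn x‖⁻¹ * ⟪pr12 hn x, pr12 hn v⟫, prC hn v) := by
  have h1 : HasFDerivAt a (fderiv ℝ a x) x := (ha.differentiable one_ne_zero x).hasFDerivAt
  have h2 : HasFDerivAt ψ (fderiv ℝ ψ (piB hn x)) (piB hn x) :=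
    (h.1.differentiable one_ne_zero _).hasFDerivAt
  have h3 := h1.fun_mul (h2.comp x (piB_deriv hn hx))
  have h4 : fderiv ℝ (fun x => a x * ψ (piB hn x)) x = _ := h3.fderiv
  rw [h4]
  simp [P12_apply, PC_apply]
  ring

/-- Unit vectors in the plane. -/
noncomputable def vv (i : Fin 2) : Euc n := (JE hn).symm ((if i = 0 then 1 else 0, if i = 0 then 0 else 1), 0)

theorem vv_pr12 (i : Fin 2) (p : Euc 2) : ⟪p, pr12 hn (vv hn i)⟫ = p i := by
  obtain ⟨h0, h1⟩ := JE_symm_pr12 hn (if i = 0 then 1 else 0) (if i = 0 then 0 else 1) 0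
  simp only [PiLp.inner_apply, Fin.sum_univ_two, vv, h0, h1]
  fin_cases i <;> simp

theorem vv_prC (i : Fin 2) : prC hn (vv hn i) = 0 := JE_symm_prC hn _ _ _

end TestF


section ItoII
variable {n : ℕ} (hn : 2 ≤ n)

theorem repr22 {W : Type*} [NormedAddCommGroup W] [NormedSpace ℝ W] [FiniteDimensional ℝ W]
    [MeasurableSpace W] [BorelSpace W] (vol : Measure W) [SigmaFinite vol]
    (μ0 : Measure W) [IsFiniteMeasure μ0] {Ω : Set W} (ho : IsOpen Ω)
    (hac : μ0.restrict Ω ≪ vol) (T : C1c Ω →ₗ[ℝ] ℝ) (K : ℝ) (hK : 0 ≤ K)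
    (hT : ∀ φ : C1c Ω, |T φ| ≤ K * ∫ x, |(φ : W → ℝ) x| ∂μ0) :
    ∃ G : W → ℝ, Integrable G vol ∧ ∀ φ : C1c Ω, T φ = ∫ x, (φ : W → ℝ) x * G x ∂vol := by
  refine riesz18 vol (K.toNNReal • μ0.restrict Ω) ?_ (C1c Ω)
    (fun φ hφ => ⟨hφ.1.continuous, hφ.2.1⟩) T fun φ => ?_
  · exact Measure.AbsolutelyContinuous.smul_left hac _
  · refine (hT φ).trans (le_of_eq ?_)
    rw [integral_smul_nnreal_measure]
    rw [setIntegral_eq_integral_of_forall_compl_eq_zero]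
    · rw [NNReal.smul_def, Real.coe_toNNReal _ hK, smul_eq_mul]
    · intro x hx
      rw [image_eq_zero_of_notMem_tsupport fun h => hx (φ.2.2.2 h), abs_zero]

theorem ac22 {E : Set (Euc n)} {Ω : Set (ℝ × Euc (n - 2))} (ho : IsOpen Ω)
    (hΩ : Ω ⊆ Ioi (0:ℝ) ×ˢ univ)
    (hi : μH[(n : ℝ) - 1] {x : Euc n | x ∈ redBoundary E ∩ cylSet hn Ω ∧ nu12par hn E x = 0} = 0) :
    (Measure.map (piB hn) ((μH[((n - 1 : ℕ) : ℝ)] : Measure (Euc n)).restrict (RB volume E))).restrict Ω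
      ≪ volume := by
  refine Measure.AbsolutelyContinuous.mk fun B hB hB0 => ?_
  rw [Measure.restrict_apply hB, Measure.map_apply (piB_cont hn).measurable (hB.inter ho.measurableSet),
    Measure.restrict_apply ((hB.inter ho.measurableSet).preimage (piB_cont hn).measurable)]
  rw [cast_dim hn] at hi
  refine measure_mono_null (fun x hx => ?_) (measure_union_null (claimY hn (E := E) hB0) hi)
  obtain ⟨⟨h1, h2⟩, h3⟩ := hx
  rw [← red_eq_RB] at h3
  have h4 : pr12 hn x ≠ 0 := by
    rw [← piB_fst_ne hn]
    exact (hΩ h2).1.ne'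
  by_cases h5 : nu12par hn E x = 0
  · right; exact ⟨⟨h3, h4, h2⟩, h5⟩
  · left; exact ⟨h3, h4, h1, h5⟩

variable {ℓ : ℝ × Euc (n - 2) → ℝ}

theorem bound_gen (hl : Measurable ℓ) (hF_perim : perim (circSymm hn ℓ) univ < ⊤)
    (hv : volume (circSymm hn ℓ) < ⊤) {Ω : Set (ℝ × Euc (n - 2))} (hΩ : Ω ⊆ Ioi (0:ℝ) ×ˢ univ)
    {ψ : ℝ × Euc (n - 2) → ℝ} (hψ : ψ ∈ C1c Ω) {a : Euc n → ℝ} (ha : ContDiff ℝ 1 a)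
    {φ : ℝ × Euc (n - 2) → ℝ} (hφ : φ ∈ C1c Ω) (hle : ∀ x, |a x * ψ (piB hn x)| ≤ |φ (piB hn x)|)
    (v : Euc n) :
    |∫ x in circSymm hn ℓ, fderiv ℝ (fun x => a x * ψ (piB hn x)) x v| ≤
      volume.real (ball (0:Euc n) 1) * 2 ^ (n - 1 + 1) * ‖v‖ *
        ∫ p, |φ p| ∂(Measure.map (piB hn) ((μH[((n - 1 : ℕ) : ℝ)] : Measure (Euc n)).restrict
          (RB volume (circSymm hn ℓ)))) := by
  have hE := circ_meas hn hl
  have hb : μH[((n - 1 : ℕ) : ℝ)] (bd volume (circSymm hn ℓ)) ≠ ⊤ := by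
    have := hF_perim.ne
    rw [perim, inter_univ, ess_eq_bd hE, cast_dim hn] at this
    exact this
  haveI : IsFiniteMeasure ((μH[((n - 1 : ℕ) : ℝ)] : Measure (Euc n)).restrict (RB volume (circSymm hn ℓ))) :=
    ⟨by rw [Measure.restrict_apply_univ]
        exact (measure_mono (RB_subset_bd volume _)).trans_lt (lt_top_iff_ne_top.2 hb)⟩
  obtain ⟨h1, h2⟩ := comp_piB hn hΩ hψ ha
  have h3 := thmA (volume : Measure (Euc n)) hE hv.ne (d := n - 1) (by omega)
    (by simp; omega) hb h1 h2 v
  refine h3.trans ?_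
  refine mul_le_mul_of_nonneg_left ?_ (by positivity)
  rw [integral_map (piB_cont hn).measurable.aemeasurable hφ.1.continuous.abs.aestronglyMeasurable]
  have bi : ∀ f : Euc n → ℝ, Continuous f → HasCompactSupport f →
      Integrable (fun x => |f x|) ((μH[((n - 1 : ℕ) : ℝ)] : Measure (Euc n)).restrict (RB volume (circSymm hn ℓ))) := by
    intro f hf hc
    obtain ⟨B, hB⟩ := hc.exists_bound_of_continuous hf
    refine Integrable.mono' (integrable_const B) hf.abs.aestronglyMeasurable (ae_of_all _ fun x => ?_)
    simpa using hB x
  obtain ⟨h4, h5⟩ := comp_piB hn hΩ hφ (a := fun _ => 1) contDiff_const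
  refine integral_mono (bi _ h1.continuous h2) ?_ hle
  have := bi _ h4.continuous h5
  simpa using this

theorem i_ii (hl : Measurable ℓ)
    (h0 : ∀ p ∈ (Ioi (0:ℝ)) ×ˢ (univ : Set (Euc (n - 2))), 0 ≤ ℓ p)
    (hle : ∀ᵐ p ∂(volume.restrict ((Ioi (0:ℝ)) ×ˢ (univ : Set (Euc (n - 2))))),
      ℓ p ≤ 2 * Real.pi * p.1)
    (hF_perim : perim (circSymm hn ℓ) univ < ⊤) (hv : volume (circSymm hn ℓ) < ⊤)
    {Ω : Set (ℝ × Euc (n - 2))} (ho : IsOpen Ω) (hΩ : Ω ⊆ Ioi (0:ℝ) ×ˢ univ)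
    (hi : μH[(n : ℝ) - 1] {x : Euc n | x ∈ redBoundary (circSymm hn ℓ) ∩ cylSet hn Ω ∧
      nu12par hn (circSymm hn ℓ) x = 0} = 0) : W11locProd ℓ Ω := by
  classical
  have hac := ac22 hn ho hΩ hi
  have hE := circ_meas hn hl
  have hb : μH[((n - 1 : ℕ) : ℝ)] (bd volume (circSymm hn ℓ)) ≠ ⊤ := by
    have := hF_perim.ne
    rw [perim, inter_univ, ess_eq_bd hE, cast_dim hn] at this
    exact this
  haveI : IsFiniteMeasure ((μH[((n - 1 : ℕ) : ℝ)] : Measure (Euc n)).restrict (RB volume (circSymm hn ℓ))) :=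
    ⟨by rw [Measure.restrict_apply_univ]
        exact (measure_mono (RB_subset_bd volume _)).trans_lt (lt_top_iff_ne_top.2 hb)⟩
  have hB := fun ψ hψ a ha φ hφ hle v => bound_gen hn hl hF_perim hv hΩ (ψ := ψ) hψ (a := a) ha (φ := φ) hφ hle v
  set μ0 := Measure.map (piB hn) ((μH[((n - 1 : ℕ) : ℝ)] : Measure (Euc n)).restrict
          (RB volume (circSymm hn ℓ))) with hμ0
  set A : ℝ := volume.real (ball (0:Euc n) 1) * 2 ^ (n - 1 + 1) with hA
  have hA0 : 0 ≤ A := by positivity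
  have hc0 : (0:ℝ) < cJ hn := by exact_mod_cast cJ_pos hn
  have hli := ell_int hn hl h0 hle hv
  have hliΩ : LocallyIntegrableOn ℓ Ω volume := (hli.mono_set hΩ).locallyIntegrableOn
  have hintg : ∀ f : ℝ × Euc (n - 2) → ℝ, Continuous f → HasCompactSupport f → tsupport f ⊆ Ω →
      Integrable (fun p => ℓ p * f p) volume := fun f h1 h2 h3 => li_mul hliΩ h1 h2 h3
  have hres : ∀ f : ℝ × Euc (n - 2) → ℝ, tsupport f ⊆ Ω → ∀ S, Ω ⊆ S → 
      ∫ p in S, ℓ p * f p = ∫ p, ℓ p * f p := by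
    intro f hf S hS
    refine setIntegral_eq_integral_of_forall_compl_eq_zero fun x hx => ?_
    rw [image_eq_zero_of_notMem_tsupport fun h => hx (hS (hf h)), mul_zero]
  have hinF : ∀ x ∈ circSymm hn ℓ, pr12 hn x ≠ 0 := fun x hx => hx.1
  -- the y-derivatives
  have hY : ∀ y : Euc (n - 2), ∃ G : ℝ × Euc (n - 2) → ℝ, Integrable G volume ∧
      ∀ φ ∈ C1c Ω, ∫ p, ℓ p * fderiv ℝ φ p (0, y) = ∫ p, φ p * G p := by
    intro y
    let T : C1c Ω →ₗ[ℝ] ℝ :=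
      { toFun := fun φ => ∫ p, ℓ p * fderiv ℝ (φ : ℝ × Euc (n - 2) → ℝ) p (0, y)
        map_add' := by
          intro φ ψ
          obtain ⟨a1, a2, a3⟩ := C1c_fd φ.2 (0, y)
          obtain ⟨b1, b2, b3⟩ := C1c_fd ψ.2 (0, y)
          rw [← integral_add (hintg _ a1 a2 a3) (hintg _ b1 b2 b3)]
          refine integral_congr_ae (Eventually.of_forall fun p => ?_)
          have : fderiv ℝ (((φ + ψ : C1c Ω)) : ℝ × Euc (n - 2) → ℝ) p = _ :=
            fderiv_add (φ.2.1.differentiable one_ne_zero p) (ψ.2.1.differentiable one_ne_zero p)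
          simp only [this, add_apply]
          ring
        map_smul' := by
          intro c φ
          rw [RingHom.id_apply, smul_eq_mul, ← integral_const_mul]
          refine integral_congr_ae (Eventually.of_forall fun p => ?_)
          have : fderiv ℝ (((c • φ : C1c Ω)) : ℝ × Euc (n - 2) → ℝ) p = _ :=
            fderiv_const_smul (φ.2.1.differentiable one_ne_zero p) c
          simp only [this, smul_apply, smul_eq_mul]
          ring }
    set v : Euc n := (JE hn).symm ((0, 0), y) with hvdef
    have hv1 : pr12 hn v = 0 := by
      obtain ⟨e0, e1⟩ := JE_symm_pr12 hn 0 0 y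
      ext i; fin_cases i
      · exact e0
      · exact e1
    have hv2 : prC hn v = y := JE_symm_prC hn 0 0 y
    obtain ⟨G, hG1, hG2⟩ := repr22 volume μ0 ho hac T ((cJ hn : ℝ)⁻¹ * (A * ‖v‖)) (by positivity) (by
      intro φ
      have e1 := hB φ φ.2 (fun _ => 1) contDiff_const φ φ.2 (fun x => by simp) v
      have e2 : ∫ x in circSymm hn ℓ, fderiv ℝ (fun x => 1 * (φ : ℝ × Euc (n - 2) → ℝ) (piB hn x)) x v
          = ∫ x in circSymm hn ℓ, (fun p => fderiv ℝ (φ : ℝ × Euc (n - 2) → ℝ) p (0, y)) (piB hn x) := by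
        refine setIntegral_congr_fun hE fun x hx => ?_
        simp only
        rw [fd_comp hn φ.2 contDiff_const (hinF x hx), hv1, hv2]
        simp
      rw [e2, push_int hn hl h0 hle (C1c_fd φ.2 (0, y)).1.measurable,
        hres _ (C1c_fd φ.2 (0, y)).2.2 _ hΩ, abs_mul, abs_of_pos hc0] at e1
      rw [mul_assoc, ← div_eq_inv_mul, le_div_iff₀ hc0, mul_comm]
      exact e1)
    exact ⟨G, hG1, fun φ hφ => hG2 ⟨φ, hφ⟩⟩
  -- the r-derivative
  have hR : ∃ G : ℝ × Euc (n - 2) → ℝ, Integrable G volume ∧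
      ∀ φ ∈ C1c Ω, (∫ p, ℓ p * fderiv ℝ φ p (1, 0)) + ∫ p, ℓ p * (φ p / p.1) = ∫ p, φ p * G p := by
    let T : C1c Ω →ₗ[ℝ] ℝ :=
      { toFun := fun φ => (∫ p, ℓ p * fderiv ℝ (φ : ℝ × Euc (n - 2) → ℝ) p (1, 0))
          + ∫ p, ℓ p * ((φ : ℝ × Euc (n - 2) → ℝ) p / p.1)
        map_add' := by
          intro φ ψ
          obtain ⟨a1, a2, a3⟩ := C1c_fd φ.2 (1, 0)
          obtain ⟨b1, b2, b3⟩ := C1c_fd ψ.2 (1, 0)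
          have c1 := C1c_divr hΩ φ.2
          have c2 := C1c_divr hΩ ψ.2
          have d1 : ∫ p, ℓ p * fderiv ℝ (((φ + ψ : C1c Ω)) : ℝ × Euc (n - 2) → ℝ) p (1, 0) =
              (∫ p, ℓ p * fderiv ℝ (φ : ℝ × Euc (n - 2) → ℝ) p (1, 0)) + 
              ∫ p, ℓ p * fderiv ℝ (ψ : ℝ × Euc (n - 2) → ℝ) p (1, 0) := by
            rw [← integral_add (hintg _ a1 a2 a3) (hintg _ b1 b2 b3)]
            refine integral_congr_ae (Eventually.of_forall fun p => ?_)
            have : fderiv ℝ (((φ + ψ : C1c Ω)) : ℝ × Euc (n - 2) → ℝ) p = _ :=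
              fderiv_add (φ.2.1.differentiable one_ne_zero p) (ψ.2.1.differentiable one_ne_zero p)
            simp only [this, add_apply]
            ring
          have d2 : ∫ p, ℓ p * ((((φ + ψ : C1c Ω)) : ℝ × Euc (n - 2) → ℝ) p / p.1) =
              (∫ p, ℓ p * ((φ : ℝ × Euc (n - 2) → ℝ) p / p.1)) + 
              ∫ p, ℓ p * ((ψ : ℝ × Euc (n - 2) → ℝ) p / p.1) := by
            rw [← integral_add (hintg _ c1.1.continuous c1.2.1 c1.2.2) (hintg _ c2.1.continuous c2.2.1 c2.2.2)]
            refine integral_congr_ae (Eventually.of_forall fun p => ?_)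
            simp only [Submodule.coe_add, Pi.add_apply]
            ring
          rw [d1, d2]; ring
        map_smul' := by
          intro c φ
          rw [RingHom.id_apply, smul_eq_mul, mul_add, ← integral_const_mul, ← integral_const_mul]
          congr 1
          · refine integral_congr_ae (Eventually.of_forall fun p => ?_)
            have : fderiv ℝ (((c • φ : C1c Ω)) : ℝ × Euc (n - 2) → ℝ) p = _ :=
              fderiv_const_smul (φ.2.1.differentiable one_ne_zero p) c
            simp only [this, smul_apply, smul_eq_mul]
            ring
          · refine integral_congr_ae (Eventually.of_forall fun p => ?_)
            simp only [Submodule.coe_smul, Pi.smul_apply, smul_eq_mul]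
            ring }
    obtain ⟨G, hG1, hG2⟩ := repr22 volume μ0 ho hac T
      ((cJ hn : ℝ)⁻¹ * (A * (‖vv hn 0‖ + ‖vv hn 1‖))) (by positivity) (by
      intro φ
      set f : ℝ × Euc (n - 2) → ℝ := φ.1 with hf
      have hψ := C1c_divr hΩ φ.2
      have ha : ∀ i : Fin 2, ContDiff ℝ 1 (fun x : Euc n => pr12 hn x i) := by
        intro i
        exact ((EuclideanSpace.proj i : Euc 2 →L[ℝ] ℝ).comp (P12 hn)).contDiff
      have hai : ∀ i : Fin 2, ∀ x v : Euc n, fderiv ℝ (fun x : Euc n => pr12 hn x i) x v = pr12 hn v i := by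
        intro i x v
        have : fderiv ℝ (fun x : Euc n => pr12 hn x i) x = _ :=
          ((EuclideanSpace.proj i : Euc 2 →L[ℝ] ℝ).comp (P12 hn)).fderiv
        rw [this]; rfl
      have hbd : ∀ i : Fin 2, ∀ x : Euc n,
          |pr12 hn x i * (fun p : ℝ × Euc (n - 2) => f p / p.1) (piB hn x)| ≤ |f (piB hn x)| := by
        intro i x
        have e1 : |pr12 hn x i| ≤ (piB hn x).1 := by
          have := PiLp.norm_apply_le (pr12 hn x) i
          simpa [piB] using this
        have e2 : 0 ≤ (piB hn x).1 := (abs_nonneg _).trans e1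
        simp only
        rw [abs_mul, abs_div, abs_of_nonneg e2]
        rcases e2.eq_or_lt with h | h
        · rw [← h]; simp
        · rw [mul_div_assoc', div_le_iff₀ h, mul_comm]
          exact mul_le_mul_of_nonneg_left e1 (abs_nonneg _)
      have e0 := hB _ hψ _ (ha 0) f φ.2 (hbd 0) (vv hn 0)
      have e1 := hB _ hψ _ (ha 1) f φ.2 (hbd 1) (vv hn 1)
      have hfi : ∀ i : Fin 2, Integrable (fun x : Euc n => fderiv ℝ (fun x => pr12 hn x i *
          (fun p : ℝ × Euc (n - 2) => f p / p.1) (piB hn x)) x (vv hn i)) volume := by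
        intro i
        obtain ⟨k1, k2⟩ := comp_piB hn hΩ hψ (ha i)
        obtain ⟨k3, k4, -⟩ := C1c_fd (Ω := univ) ⟨k1, k2, subset_univ _⟩ (vv hn i)
        exact k3.integrable_of_hasCompactSupport k4
      have e2 : (∫ x in circSymm hn ℓ, fderiv ℝ (fun x => pr12 hn x 0 *
          (fun p : ℝ × Euc (n - 2) => f p / p.1) (piB hn x)) x (vv hn 0)) +
          (∫ x in circSymm hn ℓ, fderiv ℝ (fun x => pr12 hn x 1 *
          (fun p : ℝ × Euc (n - 2) => f p / p.1) (piB hn x)) x (vv hn 1))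
          = ∫ x in circSymm hn ℓ, (fun p => fderiv ℝ f p (1, 0) + f p / p.1) (piB hn x) := by
        rw [← integral_add (hfi 0).integrableOn (hfi 1).integrableOn]
        refine setIntegral_congr_fun hE fun x hx => ?_
        simp only
        have hx0 := hinF x hx
        have hr : (piB hn x).1 ≠ 0 := (piB_fst_ne hn).2 hx0
        have hpr : ∀ i, pr12 hn (vv hn i) i = 1 := by
          intro i
          rw [← vv_pr12 hn i (pr12 hn (vv hn i))]
          obtain ⟨h0, h1⟩ := JE_symm_pr12 hn (if i = 0 then 1 else 0) (if i = 0 then 0 else 1) 0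
          simp only [PiLp.inner_apply, Fin.sum_univ_two, vv, h0, h1]
          fin_cases i <;> simp
        have hlin : ∀ s : ℝ, fderiv ℝ f (piB hn x) (s, 0) = s * fderiv ℝ f (piB hn x) (1, 0) := by
          intro s
          rw [← smul_eq_mul, ← map_smul]; simp
        rw [fd_comp hn hψ (ha 0) hx0, fd_comp hn hψ (ha 1) hx0, hai, hai, hpr, hpr, vv_pr12, vv_pr12,
          vv_prC, vv_prC, fd_divr φ.2.1 _ _ hr, fd_divr φ.2.1 _ _ hr, hlin, hlin (‖pr12 hn x‖⁻¹ * _)]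
        have hn2 := norm2 (pr12 hn x)
        have hr' : (piB hn x).1 = ‖pr12 hn x‖ := rfl
        rw [hr'] at hr ⊢
        simp only
        field_simp
        linear_combination (f (piB hn x) - ‖pr12 hn x‖ * fderiv ℝ f (piB hn x) (1,0)) * hn2
      have c1 := C1c_fd φ.2 (1, 0)
      have hm : Measurable (fun p => fderiv ℝ f p (1, 0) + f p / p.1) :=
        (c1.1.add hψ.1.continuous).measurable
      rw [push_int hn hl h0 hle hm] at e2
      have e3 : ∫ p in Ioi (0:ℝ) ×ˢ univ, ℓ p * (fderiv ℝ f p (1, 0) + f p / p.1) = T φ := by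
        change _ = (∫ p, ℓ p * fderiv ℝ f p (1, 0)) + ∫ p, ℓ p * (f p / p.1)
        rw [← hres _ c1.2.2 _ hΩ, ← hres _ hψ.2.2 _ hΩ,
          ← integral_add (hintg _ c1.1 c1.2.1 c1.2.2).integrableOn (hintg _ hψ.1.continuous hψ.2.1 hψ.2.2).integrableOn]
        refine integral_congr_ae (Eventually.of_forall fun p => ?_)
        simp only; ring
      rw [e3] at e2
      rw [mul_assoc, ← div_eq_inv_mul, le_div_iff₀ hc0, mul_comm]
      have e4 : (cJ hn : ℝ) * |T φ| = |(cJ hn : ℝ) * T φ| := by rw [abs_mul, abs_of_pos hc0]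
      rw [e4, ← e2]
      refine (abs_add_le _ _).trans ((add_le_add e0 e1).trans (le_of_eq ?_))
      ring)
    exact ⟨G, hG1, fun φ hφ => hG2 ⟨φ, hφ⟩⟩
  obtain ⟨Gr, hGr, HR⟩ := hR
  choose Gy hGy HY using fun j : Fin (n - 2) => hY (EuclideanSpace.single j 1)
  have hlr := li_divr ho hΩ hliΩ
  refine ⟨fun p => p.1⁻¹ • ℓ p - Gr p, fun p => ∑ j, (- Gy j p) • (EuclideanSpace.single j 1 : Euc (n - 2)),
    hliΩ, hlr.sub (hGr.integrableOn.locallyIntegrableOn), ?_, ?_⟩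
  · refine IntegrableOn.locallyIntegrableOn ?_
    refine Integrable.integrableOn ?_
    exact integrable_finsetSum _ fun j _ => (hGy j).neg.smul_const _
  intro φ h1 h2 h3 y
  have hφ : φ ∈ C1c Ω := ⟨h1, h2, h3⟩
  have k1 := HR φ hφ
  have k2 := fun j => HY j φ hφ
  obtain ⟨B, hBd⟩ := h2.exists_bound_of_continuous h1.continuous
  have hφG : ∀ G : ℝ × Euc (n - 2) → ℝ, Integrable G volume → Integrable (fun p => φ p * G p) volume := by
    intro G hG
    have := li_mul (φ := φ) (Ω := Ω) hG.integrableOn.locallyIntegrableOn h1.continuous h2 h3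
    exact this.congr (Eventually.of_forall fun p => mul_comm _ _)
  have hψ := C1c_divr hΩ hφ
  have hi0 := hintg _ hψ.1.continuous hψ.2.1 hψ.2.2
  rw [hres _ (C1c_fd hφ y).2.2 _ subset_rfl, setIntegral_eq_integral_of_forall_compl_eq_zero]
  swap
  · intro x hx
    rw [image_eq_zero_of_notMem_tsupport fun h => hx (h3 h), zero_mul]
  have e1 : ∫ p, ℓ p * fderiv ℝ φ p y = y.1 * (∫ p, ℓ p * fderiv ℝ φ p (1, 0))
      + ∑ j, y.2 j * ∫ p, ℓ p * fderiv ℝ φ p (0, EuclideanSpace.single j 1) := by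
    have hf : ∀ z, Integrable (fun p => ℓ p * fderiv ℝ φ p z) volume := fun z =>
      hintg _ (C1c_fd hφ z).1 (C1c_fd hφ z).2.1 (C1c_fd hφ z).2.2
    simp_rw [← integral_const_mul]
    rw [← integral_finsetSum _ fun j _ => (hf _).const_mul _, ← integral_add ((hf _).const_mul _)
      (integrable_finsetSum _ fun j _ => (hf _).const_mul _)]
    refine integral_congr_ae (Eventually.of_forall fun p => ?_)
    simp only
    have hy : y = y.1 • ((1:ℝ), (0 : Euc (n - 2))) + ∑ j, y.2 j • ((0:ℝ), (EuclideanSpace.single j 1 : Euc (n - 2))) := by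
      refine Prod.ext ?_ ?_
      · simp [Prod.fst_sum]
      · ext i
        simp [Prod.snd_sum, Finset.sum_apply, Pi.single_apply]
    conv_lhs => rw [hy, map_add, map_sum]
    simp only [map_smul, smul_eq_mul, mul_add, Finset.mul_sum]
    congr 1
    · ring
    · refine Finset.sum_congr rfl fun j _ => ?_
      ring
  have e2 : ∫ p, φ p * ((p.1⁻¹ • ℓ p - Gr p) * y.1 +
      ⟪∑ j, (- Gy j p) • (EuclideanSpace.single j 1 : Euc (n - 2)), y.2⟫)
      = y.1 * ((∫ p, ℓ p * (φ p / p.1)) - ∫ p, φ p * Gr p) - ∑ j, y.2 j * ∫ p, φ p * Gy j p := by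
    rw [← integral_sub hi0 (hφG _ hGr)]
    simp_rw [← integral_const_mul]
    rw [← integral_finsetSum _ fun j _ => (hφG _ (hGy j)).const_mul _, ← integral_sub
      ((show Integrable (fun p => ℓ p * (φ p / p.1) - φ p * Gr p) volume from hi0.sub (hφG _ hGr)).const_mul _)
      (integrable_finsetSum _ fun j _ => (hφG _ (hGy j)).const_mul _)]
    refine integral_congr_ae (Eventually.of_forall fun p => ?_)
    simp only [sum_inner, real_inner_smul_left, EuclideanSpace.inner_single_left, smul_eq_mul, map_one, one_mul]
    rw [mul_add, Finset.mul_sum, sub_eq_add_neg (y.1 * _), ← Finset.sum_neg_distrib]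
    congr 1
    · ring
    · refine Finset.sum_congr rfl fun j _ => ?_
      ring
  rw [e1, e2, ← k1]
  simp_rw [k2]
  ring

end ItoII


section Line23

variable {W : Type*} [NormedAddCommGroup W] [NormedSpace ℝ W] [FiniteDimensional ℝ W]
    [MeasurableSpace W] [BorelSpace W] {μ : Measure W} [μ.IsAddHaarMeasure]

theorem shear_int {γ : W → ℝ} (hg : Measurable γ) (hgi : Integrable γ μ) (w : W) :
    Integrable (fun p : ℝ × W => γ (p.2 + p.1 • w)) ((volume.restrict (Ioc (0:ℝ) 1)).prod μ) := by
  have hm : Measurable fun p : ℝ × W => γ (p.2 + p.1 • w) := by fun_prop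
  rw [integrable_prod_iff hm.aestronglyMeasurable]
  refine ⟨Eventually.of_forall fun s => hgi.comp_add_right (s • w), ?_⟩
  have : ∀ s : ℝ, ∫ y, ‖γ (y + s • w)‖ ∂μ = ∫ y, ‖γ y‖ ∂μ := fun s =>
    integral_add_right_eq_self (fun y => ‖γ y‖) (s • w)
  simp only [this]
  exact integrable_const _

theorem line23a {Q : Set W} (hQo : IsOpen Q) (hQc : Convex ℝ Q) {f γ : W → ℝ}
    (hf : Measurable f) (hfi : Integrable f μ) (hg : Measurable γ) (hgi : Integrable γ μ) (w : W)
    (H : ∀ φ ∈ C1c Q, ∫ x, f x * fderiv ℝ φ x w ∂μ = -∫ x, φ x * γ x ∂μ) :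
    ∀ᵐ y ∂μ, y ∈ Q → y + w ∈ Q → f (y + w) - f y = ∫ s in (0:ℝ)..1, γ (y + s • w) := by
  set O : Set W := Q ∩ {y | y + w ∈ Q} with hO
  have hOo : IsOpen O := hQo.inter (hQo.preimage (by fun_prop : Continuous fun y : W => y + w))
  set k : W → ℝ := fun y => f (y + w) - f y - ∫ s in Ioc (0:ℝ) 1, γ (y + s • w) with hk
  have hsh := shear_int (μ := μ) hg hgi w
  have hki3 : Integrable (fun y => ∫ s in Ioc (0:ℝ) 1, γ (y + s • w)) μ := hsh.integral_prod_right
  have hki : Integrable k μ := ((hfi.comp_add_right w).sub hfi).sub hki3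
  have key : ∀ᵐ y ∂μ, y ∈ O → k y = 0 := by
    refine hOo.ae_eq_zero_of_integral_contDiff_smul_eq_zero (hki.locallyIntegrable.locallyIntegrableOn _) ?_
    intro φ hφ hφc hφs
    simp only [smul_eq_mul]
    have h1 : ContDiff ℝ 1 φ := hφ.of_le (by norm_cast)
    obtain ⟨Cφ, hCφ⟩ := hφc.exists_bound_of_continuous hφ.continuous
    have hcd : Continuous fun x => fderiv ℝ φ x w :=
      (h1.continuous_fderiv one_ne_zero).clm_apply continuous_const
    have hdc : HasCompactSupport fun x => fderiv ℝ φ x w := by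
      refine (hφc.fderiv (𝕜 := ℝ)).comp_left (g := fun L : W →L[ℝ] ℝ => L w) (by simp)
    obtain ⟨Cd, hCd⟩ := hdc.exists_bound_of_continuous hcd
    -- translated test functions
    have hs : ∀ s ∈ Ioc (0:ℝ) 1, ∫ x, f x * fderiv ℝ φ (x - s • w) w ∂μ = -∫ x, φ (x - s • w) * γ x ∂μ := by
      intro s hs
      have := H (fun x => φ (x - s • w)) ⟨by fun_prop, ?_, ?_⟩
      · rw [← this]
        refine integral_congr_ae (Eventually.of_forall fun x => ?_)
        simp only [sub_eq_add_neg, fderiv_comp_add_right]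
      · exact hφc.comp_homeomorph (Homeomorph.subRight (s • w))
      · have e : tsupport (fun x => φ (x - s • w)) = (Homeomorph.subRight (s • w)) ⁻¹' tsupport φ := by
          exact tsupport_comp_eq_preimage φ (Homeomorph.subRight (s • w))
        rw [e]
        intro x hx
        have hx' : x - s • w ∈ O := hφs hx
        have : x = (1 - s) • (x - s • w) + s • ((x - s • w) + w) := by module
        rw [this]
        exact hQc hx'.1 hx'.2 (by linarith [hs.2]) hs.1.le (by ring)
    have hs2 : ∫ s in Ioc (0:ℝ) 1, ∫ x, f x * fderiv ℝ φ (x - s • w) w ∂μ =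
        -∫ s in Ioc (0:ℝ) 1, ∫ x, φ x * γ (x + s • w) ∂μ := by
      rw [← integral_neg]
      refine setIntegral_congr_fun measurableSet_Ioc fun s h => ?_
      beta_reduce
      rw [hs s h]
      congr 1
      rw [← integral_add_right_eq_self (fun x => φ (x - s • w) * γ x) (s • w)]
      simp
    have hF1 : ∫ s in Ioc (0:ℝ) 1, ∫ x, f x * fderiv ℝ φ (x - s • w) w ∂μ =
        ∫ x, f x * (φ x - φ (x - w)) ∂μ := by
      rw [integral_integral_swap]
      · refine integral_congr_ae (Eventually.of_forall fun x => ?_)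
        simp only
        rw [integral_const_mul]
        congr 1
        have hd : ∀ s ∈ uIcc (0:ℝ) 1, HasDerivAt (fun s : ℝ => -φ (x - s • w)) (fderiv ℝ φ (x - s • w) w) s := by
          intro s _
          have h2 : HasDerivAt (fun s : ℝ => x - s • w) (-w) s := by
            have := ((hasDerivAt_id s).smul_const w).const_sub x
            simpa using this
          have h3 := ((h1.differentiable one_ne_zero) (x - s • w)).hasFDerivAt.comp_hasDerivAt s h2
          have h4 := h3.neg
          simp only [map_neg, neg_neg] at h4
          exact h4
        have := intervalIntegral.integral_eq_sub_of_hasDerivAt hd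
          ((hcd.comp (by fun_prop : Continuous fun s : ℝ => x - s • w)).intervalIntegrable _ _)
        rw [← intervalIntegral.integral_of_le zero_le_one, this]
        simp; ring
      · have : Integrable (fun p : ℝ × W => f p.2) ((volume.restrict (Ioc (0:ℝ) 1)).prod μ) := hfi.comp_snd _
        exact this.mul_bdd (c := Cd) ((hcd.comp (by fun_prop : Continuous fun p : ℝ × W => p.2 - p.1 • w)).aestronglyMeasurable)
          (Eventually.of_forall fun p => hCd _)
    have hF2 : ∫ s in Ioc (0:ℝ) 1, ∫ x, φ x * γ (x + s • w) ∂μ =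
        ∫ x, φ x * (∫ s in Ioc (0:ℝ) 1, γ (x + s • w)) ∂μ := by
      rw [integral_integral_swap]
      · simp only [integral_const_mul]
      · exact hsh.bdd_mul (c := Cφ) ((hφ.continuous.comp continuous_snd).aestronglyMeasurable)
          (Eventually.of_forall fun p => hCφ _)
    rw [hF1, hF2] at hs2
    have hb : ∀ g : W → ℝ, Integrable g μ → Integrable (fun x => φ x * g x) μ := fun g hg =>
      hg.bdd_mul (c := Cφ) hφ.continuous.aestronglyMeasurable (Eventually.of_forall hCφ)
    have hA : Integrable (fun x => φ x * f (x + w) - φ x * f x) μ :=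
      (hb _ (hfi.comp_add_right w)).sub (hb _ hfi)
    have hB : Integrable (fun x => φ (x - w) * f x) μ := hfi.bdd_mul (c := Cφ)
        (hφ.continuous.comp (by fun_prop : Continuous fun x : W => x - w)).aestronglyMeasurable (Eventually.of_forall fun x => hCφ _)
    have e1 : ∫ x, φ x * k x ∂μ = (∫ x, φ x * f (x + w) ∂μ) - (∫ x, φ x * f x ∂μ) -
        ∫ x, φ x * (∫ s in Ioc (0:ℝ) 1, γ (x + s • w)) ∂μ := by
      rw [← integral_sub (hb _ (hfi.comp_add_right w)) (hb _ hfi),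
        ← integral_sub hA (hb _ hki3)]
      refine integral_congr_ae (Eventually.of_forall fun x => ?_)
      simp only [hk]; ring
    have e2 : ∫ x, φ x * f (x + w) ∂μ = ∫ x, φ (x - w) * f x ∂μ := by
      rw [← integral_add_right_eq_self (fun x => φ (x - w) * f x) w]
      simp
    have e3 : ∫ x, f x * (φ x - φ (x - w)) ∂μ = (∫ x, φ x * f x ∂μ) - ∫ x, φ (x - w) * f x ∂μ := by
      rw [← integral_sub (hb _ hfi) hB]
      refine integral_congr_ae (Eventually.of_forall fun x => ?_)
      simp only; ring
    rw [e1, e2]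
    linarith
  filter_upwards [key] with y hy h1 h2
  have := hy ⟨h1, h2⟩
  rw [intervalIntegral.integral_of_le zero_le_one]
  simp only [hk] at this
  linarith

theorem line23 {Q : Set W} (hQo : IsOpen Q) (hQc : Convex ℝ Q) {f γ : W → ℝ}
    (hf : Measurable f) (hfi : Integrable f μ) (hg : Measurable γ) (hgi : Integrable γ μ) (w : W)
    (H : ∀ φ ∈ C1c Q, ∫ x, f x * fderiv ℝ φ x w ∂μ = -∫ x, φ x * γ x ∂μ) :
    ∀ᵐ y ∂μ, y ∈ Q → y + w ∈ Q → IntegrableOn (fun s : ℝ => γ (y + s • w)) (Ioc 0 1) ∧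
      f (y + w) - f y = (∫ s in (0:ℝ)..1, γ (y + s • w)) ∧
      ∀ᵐ t ∂(volume.restrict (Ioc (0:ℝ) 1)), f (y + t • w) - f y = ∫ s in (0:ℝ)..t, γ (y + s • w) := by
  have ha := line23a hQo hQc hf hfi hg hgi w H
  have hb : ∀ᵐ y ∂μ, IntegrableOn (fun s : ℝ => γ (y + s • w)) (Ioc 0 1) :=
    (shear_int (μ := μ) hg hgi w).prod_left_ae
  have hc : ∀ᵐ y ∂μ, ∀ᵐ t ∂(volume.restrict (Ioc (0:ℝ) 1)), y ∈ Q → y + w ∈ Q →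
      f (y + t • w) - f y = ∫ s in Ioc (0:ℝ) 1, t * γ (y + s • t • w) := by
    have hmI : Measurable fun p : W × ℝ => ∫ s in Ioc (0:ℝ) 1, p.2 * γ (p.1 + s • p.2 • w) := by
      have : StronglyMeasurable fun q : (W × ℝ) × ℝ => q.1.2 * γ (q.1.1 + q.2 • q.1.2 • w) :=
        Measurable.stronglyMeasurable (by fun_prop)
      exact this.integral_prod_right'.measurable
    have hmS : MeasurableSet {p : W × ℝ | p.1 ∈ Q → p.1 + w ∈ Q →
        f (p.1 + p.2 • w) - f p.1 = ∫ s in Ioc (0:ℝ) 1, p.2 * γ (p.1 + s • p.2 • w)} := by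
      refine MeasurableSet.imp (hQo.measurableSet.preimage measurable_fst) (MeasurableSet.imp ?_ ?_)
      · exact hQo.measurableSet.preimage (by fun_prop : Measurable fun p : W × ℝ => p.1 + w)
      · exact measurableSet_eq_fun (by fun_prop) hmI
    have := (Measure.ae_ae_comm (μ := μ) (ν := volume.restrict (Ioc (0:ℝ) 1)) (p := fun y t => y ∈ Q → y + w ∈ Q →
      f (y + t • w) - f y = ∫ s in Ioc (0:ℝ) 1, t * γ (y + s • t • w)) hmS).2 ?_
    · exact this
    · refine (ae_restrict_iff' measurableSet_Ioc).2 (Eventually.of_forall fun t ht => ?_)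
      have := line23a hQo hQc hf hfi (hg.const_mul t) (hgi.const_mul t) (t • w) ?_
      · filter_upwards [this] with y hy h1 h2
        have h3 : y + t • w ∈ Q := by
          have : y + t • w = (1 - t) • y + t • (y + w) := by module
          rw [this]
          exact hQc h1 h2 (by linarith [ht.2]) ht.1.le (by ring)
        rw [← intervalIntegral.integral_of_le zero_le_one]
        exact hy h1 h3
      · intro φ hφ
        have := H φ hφ
        simp only [map_smul, smul_eq_mul, mul_left_comm _ t, integral_const_mul, this]
        ring
  filter_upwards [ha, hb, hc] with y h1 h2 h3 hy hyw
  refine ⟨h2, h1 hy hyw, ?_⟩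
  filter_upwards [h3] with t ht
  rw [ht hy hyw, ← intervalIntegral.integral_of_le zero_le_one, intervalIntegral.integral_const_mul]
  have := intervalIntegral.mul_integral_comp_mul_left (a := 0) (b := 1) (f := fun s => γ (y + s • w)) t
  simp only [mul_zero, mul_one] at this
  rw [← this]
  congr 2
  ext s
  rw [smul_smul, mul_comm s t]

end Line23


theorem cross24 {g v : ℝ → ℝ} (hg : IntegrableOn g (Ioc 0 1)) {a b c : ℝ} (hab : a < b)
    (hv : ∀ᵐ t ∂(volume.restrict (Ioc (0:ℝ) 1)), v t = c + ∫ s in (0:ℝ)..t, g s)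
    (hc : c ≤ a) (hb : b ≤ c + ∫ s in (0:ℝ)..1, g s) :
    ENNReal.ofReal (b - a) ≤ ∫⁻ t in Ioc (0:ℝ) 1, (v ⁻¹' (Ioo a b)).indicator (fun t => ‖g t‖ₑ) t := by
  set h : ℝ → ℝ := fun t => c + ∫ s in (0:ℝ)..t, g s with hh
  have hgi : IntegrableOn g (uIcc 0 1) := by
    rw [uIcc_of_le zero_le_one, integrableOn_Icc_iff_integrableOn_Ioc]; exact hg
  have hcont : ContinuousOn h (Icc 0 1) := by
    have := intervalIntegral.continuousOn_primitive_interval hgi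
    rw [uIcc_of_le zero_le_one] at this
    exact continuousOn_const.add this
  have h0 : h 0 = c := by simp [hh]
  have hS : IsCompact (Icc (0:ℝ) 1 ∩ h ⁻¹' (Ici b)) :=
    isCompact_Icc.of_isClosed_subset (hcont.preimage_isClosed_of_isClosed isClosed_Icc isClosed_Ici) inter_subset_left
  obtain ⟨t1, ⟨ht1, ht1b⟩, ht1l⟩ := hS.exists_isLeast ⟨1, ⟨by norm_num, hb⟩⟩
  have hcont1 : ContinuousOn h (Icc 0 t1) := hcont.mono (Icc_subset_Icc_right ht1.2)
  have hS2 : IsCompact (Icc (0:ℝ) t1 ∩ h ⁻¹' (Iic a)) :=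
    isCompact_Icc.of_isClosed_subset (hcont1.preimage_isClosed_of_isClosed isClosed_Icc isClosed_Iic) inter_subset_left
  obtain ⟨t0, ⟨ht0, ht0a⟩, ht0g⟩ := hS2.exists_isGreatest ⟨0, ⟨⟨le_rfl, ht1.1⟩, by
    simp only [mem_preimage, h0, mem_Iic]; exact hc⟩⟩
  simp only [mem_preimage, mem_Iic, mem_Ici] at ht0a ht1b
  have hle : t0 ≤ t1 := ht0.2
  have hI : ∀ t ∈ Icc (0:ℝ) 1, IntervalIntegrable g volume 0 t := fun t ht => by
    rw [intervalIntegrable_iff_integrableOn_Ioc_of_le ht.1]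
    exact hg.mono_set (Ioc_subset_Ioc_right ht.2)
  have hd : h t1 - h t0 = ∫ s in Ioc t0 t1, g s := by
    rw [← intervalIntegral.integral_of_le hle, ← intervalIntegral.integral_interval_sub_left (hI t1 ht1) (hI t0 ⟨ht0.1, hle.trans ht1.2⟩)]
    simp [hh]
  have e1 : ENNReal.ofReal (b - a) ≤ ∫⁻ s in Ioc t0 t1, ‖g s‖ₑ := by
    refine le_trans ?_ (enorm_integral_le_lintegral_enorm _)
    rw [← hd, Real.enorm_eq_ofReal_abs]
    exact ENNReal.ofReal_le_ofReal ((by linarith : b - a ≤ h t1 - h t0).trans (le_abs_self _))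
  refine e1.trans ?_
  have hsub : Ioo t0 t1 ⊆ Ioc 0 1 := fun t ht => ⟨ht0.1.trans_lt ht.1, ht.2.le.trans ht1.2⟩
  rw [setLIntegral_congr (Ioo_ae_eq_Ioc (a := t0) (b := t1)).symm]
  refine le_trans (lintegral_mono_ae ?_) (lintegral_mono_set hsub)
  filter_upwards [ae_restrict_of_ae_restrict_of_subset hsub hv, ae_restrict_mem measurableSet_Ioo] with t hvt ht
  have : t ∈ v ⁻¹' Ioo a b := by
    have e : v t = h t := hvt
    simp only [mem_preimage, e]
    refine ⟨?_, ?_⟩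
    · by_contra hcon
      exact absurd (ht0g ⟨⟨(hsub ht).1.le, ht.2.le⟩, not_lt.1 hcon⟩) (not_le.2 ht.1)
    · by_contra hcon
      exact absurd (ht1l ⟨⟨(hsub ht).1.le, (hsub ht).2⟩, not_lt.1 hcon⟩) (not_le.2 ht.2)
  rw [indicator_of_mem this]

section Pair25

variable {W : Type*} [NormedAddCommGroup W] [NormedSpace ℝ W] [FiniteDimensional ℝ W]
    [MeasurableSpace W] [BorelSpace W] {μ : Measure W} [μ.IsAddHaarMeasure]

theorem pair25 {Q : Set W} (hQo : IsOpen Q) (hQc : Convex ℝ Q) {f : W → ℝ} {γ : W → W → ℝ} {N : W → ℝ≥0∞}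
    (hf : Measurable f) (hfi : Integrable f μ) (hg : ∀ w, Measurable (γ w)) (hgi : ∀ w, Integrable (γ w) μ)
    (H : ∀ w, ∀ φ ∈ C1c Q, ∫ x, f x * fderiv ℝ φ x w ∂μ = -∫ x, φ x * γ w x ∂μ)
    (hN : Measurable N) (hgN : ∀ w x, ‖γ w x‖ₑ ≤ ENNReal.ofReal ‖w‖ * N x)
    {q : W} {ρ : ℝ} (hρ : 0 < ρ) (hD : ball q ρ ⊆ Q) {a b : ℝ} (hab : a < b) :
    ENNReal.ofReal (b - a) * (μ ({x | f x ≤ a} ∩ ball q ρ) * μ ({x | b ≤ f x} ∩ ball q ρ)) ≤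
      ENNReal.ofReal (2 * ρ) * (∫⁻ x in ball q ρ ∩ f ⁻¹' (Ioo a b), N x ∂μ) * μ (ball 0 (2 * ρ)) := by
  set A := {x | f x ≤ a} ∩ ball q ρ with hA
  set B := {x | b ≤ f x} ∩ ball q ρ with hB
  set S := ball q ρ ∩ f ⁻¹' (Ioo a b) with hS
  have hAm : MeasurableSet A := (measurableSet_le hf measurable_const).inter measurableSet_ball
  have hBm : MeasurableSet B := (measurableSet_le measurable_const hf).inter measurableSet_ball
  have hSm : MeasurableSet S := measurableSet_ball.inter (hf measurableSet_Ioo)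
  set δ := ENNReal.ofReal (b - a) with hδ
  have hpt : ∀ w, ∫⁻ y, A.indicator 1 y * B.indicator (fun _ => δ) (y + w) ∂μ ≤
      (ball (0:W) (2 * ρ)).indicator (fun _ => ENNReal.ofReal (2 * ρ) * ∫⁻ x in S, N x ∂μ) w := by
    intro w
    by_cases hw : w ∈ ball (0:W) (2 * ρ)
    · rw [indicator_of_mem hw]
      have hNS : Measurable (S.indicator N) := hN.indicator hSm
      calc _ ≤ ∫⁻ y, (∫⁻ t in Ioc (0:ℝ) 1, ENNReal.ofReal ‖w‖ * S.indicator N (y + t • w)) ∂μ := by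
            refine lintegral_mono_ae ?_
            filter_upwards [line23 hQo hQc hf hfi (hg w) (hgi w) w (H w)] with y hy
            by_cases hyA : y ∈ A
            swap
            · rw [indicator_of_notMem hyA, zero_mul]; exact zero_le
            by_cases hyB : y + w ∈ B
            swap
            · rw [indicator_of_notMem hyB, mul_zero]; exact zero_le
            rw [indicator_of_mem hyA, indicator_of_mem hyB, Pi.one_apply, one_mul]
            obtain ⟨h1, h2, h3⟩ := hy (hD hyA.2) (hD hyB.2)
            refine (cross24 (v := fun t => f (y + t • w)) (c := f y) h1 hab ?_ hyA.1 ?_).trans ?_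
            · filter_upwards [h3] with t ht; linarith
            · have := hyB.1; simp only [Set.mem_ofPred_eq] at this; linarith
            · refine setLIntegral_mono' measurableSet_Ioc fun t ht => ?_
              by_cases htS : f (y + t • w) ∈ Ioo a b
              · have h5 : y + t • w ∈ S := by
                  refine ⟨?_, htS⟩
                  have : y + t • w = (1 - t) • y + t • (y + w) := by module
                  rw [this]
                  exact (convex_ball q ρ) hyA.2 hyB.2 (by linarith [ht.2]) ht.1.le (by ring)
                rw [indicator_of_mem h5]
                exact (indicator_le_self _ _ _).trans (hgN w _)
              · rw [indicator_of_notMem (by exact htS)]; exact zero_le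
        _ = ∫⁻ t in Ioc (0:ℝ) 1, ∫⁻ y, ENNReal.ofReal ‖w‖ * S.indicator N (y + t • w) ∂μ := by
            refine lintegral_lintegral_swap ?_
            exact Measurable.aemeasurable (by fun_prop)
        _ = ENNReal.ofReal ‖w‖ * ∫⁻ x in S, N x ∂μ := by
            have : ∀ t : ℝ, ∫⁻ y, ENNReal.ofReal ‖w‖ * S.indicator N (y + t • w) ∂μ = ENNReal.ofReal ‖w‖ * ∫⁻ x in S, N x ∂μ := by
              intro t
              rw [lintegral_const_mul _ (by fun_prop), lintegral_add_right_eq_self (S.indicator N) (t • w), lintegral_indicator hSm]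
            simp only [this]
            simp
        _ ≤ _ := by
            gcongr
            exact (mem_ball_zero_iff.1 hw).le
    · rw [indicator_of_notMem hw]
      refine le_of_eq ?_
      rw [lintegral_eq_zero_iff (by
        refine (measurable_one.indicator hAm).mul ((measurable_const.indicator hBm).comp (by fun_prop : Measurable fun y : W => y + w)))]
      refine Eventually.of_forall fun y => ?_
      by_cases hyA : y ∈ A
      swap
      · simp [indicator_of_notMem hyA]
      by_cases hyB : y + w ∈ B
      swap
      · simp [indicator_of_notMem hyB]
      exfalso
      apply hw
      rw [mem_ball_zero_iff]
      calc ‖w‖ = dist (y + w) y := by simp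
        _ ≤ dist (y + w) q + dist y q := dist_triangle_right _ _ _
        _ < 2 * ρ := by have := mem_ball.1 hyA.2; have := mem_ball.1 hyB.2; linarith
  calc δ * (μ A * μ B) = ∫⁻ y, ∫⁻ w, A.indicator 1 y * B.indicator (fun _ => δ) (y + w) ∂μ ∂μ := by
        have : ∀ y, ∫⁻ w, A.indicator 1 y * B.indicator (fun _ => δ) (y + w) ∂μ = A.indicator 1 y * (δ * μ B) := by
          intro y
          have hmB : Measurable fun w => B.indicator (fun _ => δ) (y + w) :=
            (measurable_const.indicator hBm).comp (by fun_prop : Measurable fun w : W => y + w)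
          rw [lintegral_const_mul _ hmB,
            lintegral_add_left_eq_self (B.indicator fun _ => δ) y, lintegral_indicator hBm, setLIntegral_const]
        simp only [this]
        rw [lintegral_mul_const _ (measurable_one.indicator hAm), lintegral_indicator_one hAm]
        ring
    _ = ∫⁻ w, ∫⁻ y, A.indicator 1 y * B.indicator (fun _ => δ) (y + w) ∂μ ∂μ := by
        refine lintegral_lintegral_swap (Measurable.aemeasurable ?_)
        exact ((measurable_one.indicator hAm).comp measurable_fst).mul
          ((measurable_const.indicator hBm).comp (by fun_prop : Measurable fun p : W × W => p.1 + p.2))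
    _ ≤ _ := lintegral_mono hpt
    _ = _ := by rw [lintegral_indicator measurableSet_ball, setLIntegral_const]

end Pair25


section Cover25

variable {V : Type*} [NormedAddCommGroup V] [NormedSpace ℝ V] [FiniteDimensional ℝ V]
  [MeasurableSpace V] [BorelSpace V]

theorem cover25 {lam : Measure V} [IsFiniteMeasure lam] {S : Set V} (hS : lam S = 0) {c : ℝ} (hc : 0 < c) {d : ℕ}
    (h : ∀ x ∈ S, ∀ ε > 0, ∃ ρ, 0 < ρ ∧ ρ < ε ∧ ENNReal.ofReal (c * ρ ^ d) ≤ lam (closedBall x ρ)) :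
    μH[(d:ℝ)] S = 0 := by
  have main : ∀ η : ℝ≥0∞, 0 < η → η ≠ ⊤ → μH[(d:ℝ)] S ≤ ENNReal.ofReal (10 ^ d / c) * η := by
    intro η hη hηt
    obtain ⟨U, hSU, hUo, hU⟩ := Set.exists_isOpen_lt_of_lt S η (by rw [hS]; exact hη)
    have hk : ∀ k : ℕ, ∃ u : Set (V × ℝ), u.Countable ∧ (∀ p ∈ u, 0 < p.2 ∧ p.2 ≤ 1 / ((k:ℝ) + 1)) ∧
        S ⊆ (⋃ p : u, closedBall p.1.1 (5 * p.1.2)) ∧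
        ∑' p : u, ENNReal.ofReal (c * p.1.2 ^ d) ≤ η := by
      intro k
      set t : Set (V × ℝ) := {p | p.1 ∈ S ∧ 0 < p.2 ∧ p.2 ≤ 1 / ((k:ℝ) + 1) ∧ closedBall p.1 p.2 ⊆ U ∧
        ENNReal.ofReal (c * p.2 ^ d) ≤ lam (closedBall p.1 p.2)} with ht
      obtain ⟨u, hut, hud, huc⟩ := Vitali.exists_disjoint_subfamily_covering_enlargement_closedBall t
        (fun p => p.1) (fun p => p.2) (1 / ((k:ℝ) + 1)) (fun p hp => hp.2.2.1) 5 (by norm_num)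
      have hcount : u.Countable := hud.countable_of_nonempty_interior fun p hp =>
        ⟨p.1, interior_mono ball_subset_closedBall (by
          rw [isOpen_ball.interior_eq]; exact mem_ball_self (hut hp).2.1)⟩
      refine ⟨u, hcount, fun p hp => ⟨(hut hp).2.1, (hut hp).2.2.1⟩, ?_, ?_⟩
      · intro x hx
        obtain ⟨ε, hε, hεU⟩ := Metric.isOpen_iff.1 hUo x (hSU hx)
        obtain ⟨ρ, h1, h2, h3⟩ := h x hx (min ε (1 / ((k:ℝ) + 1))) (lt_min hε (by positivity))
        have hpt : (x, ρ) ∈ t := ⟨hx, h1, h2.le.trans (min_le_right _ _),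
          (closedBall_subset_ball (h2.trans_le (min_le_left _ _))).trans hεU, h3⟩
        obtain ⟨b, hb, hsub⟩ := huc _ hpt
        exact mem_iUnion.2 ⟨⟨b, hb⟩, hsub (mem_closedBall_self h1.le)⟩
      · calc _ ≤ ∑' p : u, lam (closedBall p.1.1 p.1.2) := ENNReal.tsum_le_tsum fun p => (hut p.2).2.2.2.2
          _ = lam (⋃ p ∈ u, closedBall p.1 p.2) :=
            (measure_biUnion hcount hud fun p _ => measurableSet_closedBall).symm
          _ ≤ lam U := measure_mono (iUnion₂_subset fun p hp => (hut hp).2.2.2.1)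
          _ ≤ η := hU.le
    choose u hu1 hu2 hu3 hu4 using hk
    haveI : ∀ k, Countable (u k) := fun k => (hu1 k).to_subtype
    have hdiam : ∀ k (p : u k), ediam (closedBall p.1.1 (5 * p.1.2)) ≤ ENNReal.ofReal (10 * p.1.2) := by
      intro k p
      refine Metric.ediam_le fun x hx y hy => ?_
      rw [edist_dist]
      refine ENNReal.ofReal_le_ofReal ((dist_triangle_right x y p.1.1).trans ?_)
      have := mem_closedBall.1 hx
      have := mem_closedBall.1 hy
      linarith
    refine (Measure.hausdorffMeasure_le_liminf_tsum (d:ℝ) S (l := atTop)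
      (fun k : ℕ => ENNReal.ofReal (10 * (1 / ((k:ℝ) + 1)))) ?_ (fun k (p : u k) => closedBall p.1.1 (5 * p.1.2))
      (Eventually.of_forall fun k p => (hdiam k p).trans ?_) (Eventually.of_forall hu3)).trans ?_
    · have := (tendsto_one_div_add_atTop_nhds_zero_nat (𝕜 := ℝ)).const_mul 10
      rw [mul_zero] at this
      simpa using (ENNReal.tendsto_ofReal this)
    · exact ENNReal.ofReal_le_ofReal (by linarith [(hu2 k p p.2).2])
    · refine liminf_le_of_frequently_le' (Eventually.frequently (Eventually.of_forall fun k => ?_))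
      calc _ ≤ ∑' p : u k, ENNReal.ofReal (10 ^ d / c) * ENNReal.ofReal (c * p.1.2 ^ d) := by
            refine ENNReal.tsum_le_tsum fun p => ?_
            have hp := (hu2 k p p.2).1
            rw [ENNReal.rpow_natCast, ← ENNReal.ofReal_mul (by positivity)]
            refine (pow_le_pow_left' (hdiam k p) d).trans ?_
            rw [← ENNReal.ofReal_pow (by positivity)]
            refine ENNReal.ofReal_le_ofReal (le_of_eq ?_)
            rw [mul_pow]; field_simp
        _ = ENNReal.ofReal (10 ^ d / c) * ∑' p : u k, ENNReal.ofReal (c * p.1.2 ^ d) := ENNReal.tsum_mul_left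
        _ ≤ _ := by gcongr; exact hu4 k
  refine le_antisymm ?_ zero_le
  have hK : 0 < 10 ^ d / c := by positivity
  refine le_of_forall_gt_imp_ge_of_dense fun ε hε => ?_
  by_cases hεt : ε = ⊤
  · rw [hεt]; exact le_top
  have := main (ε / ENNReal.ofReal (10 ^ d / c)) (ENNReal.div_pos hε.ne' ENNReal.ofReal_ne_top)
    (ENNReal.div_lt_top hεt (by simpa using hK)).ne
  rwa [ENNReal.mul_div_cancel (by simpa using hK) ENNReal.ofReal_ne_top] at this

theorem densI (μ : Measure V) [μ.IsAddHaarMeasure] {E : Set V} (hE : MeasurableSet E) {x : V} (hx : x ∈ bd μ E) :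
    ∃ δ > 0, ∀ ρ0 > 0, ∃ ρ, 0 < ρ ∧ ρ < ρ0 ∧ δ * ρ ^ Module.finrank ℝ V ≤ μ.real (E ∩ ball x ρ) ∧
      δ * ρ ^ Module.finrank ℝ V ≤ μ.real (Eᶜ ∩ ball x ρ) := by
  obtain ⟨h1, h2⟩ := hx
  unfold D0 at h1 h2
  push Not at h1 h2
  obtain ⟨ε1, hε1, h1⟩ := h1
  obtain ⟨ε2, hε2, h2⟩ := h2
  set m := Module.finrank ℝ V with hm
  set m0 := μ.real (ball (0:V) 1) with hm0
  have hm0p : 0 < m0 := real_unit_pos μ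
  have hsum : ∀ ρ, 0 < ρ → μ.real (E ∩ ball x ρ) + μ.real (Eᶜ ∩ ball x ρ) = m0 * ρ ^ m := by
    intro ρ hρ
    have e1 := measureReal_inter_add_sdiff (μ := μ) (s := ball x ρ) hE (measure_ball_lt_top).ne
    rw [real_ball_eq μ x hρ] at e1
    rw [inter_comm E, inter_comm Eᶜ, ← sdiff_eq]
    linarith
  refine ⟨min (min ε1 ε2) (m0 / 2), by positivity, fun ρ0 hρ0 => ?_⟩
  set δ := min (min ε1 ε2) (m0 / 2) with hδ
  have hδ1 : δ ≤ ε1 := (min_le_left _ _).trans (min_le_left _ _)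
  have hδ2 : δ ≤ ε2 := (min_le_left _ _).trans (min_le_right _ _)
  have hδ3 : δ ≤ m0 / 2 := min_le_right _ _
  obtain ⟨ρ1, a1, a2, a3⟩ := h1 ρ0 hρ0
  obtain ⟨ρ2, b1, b2, b3⟩ := h2 ρ0 hρ0
  have p1 : 0 < ρ1 ^ m := by positivity
  have p2 : 0 < ρ2 ^ m := by positivity
  by_cases c1 : δ * ρ1 ^ m ≤ μ.real (Eᶜ ∩ ball x ρ1)
  · exact ⟨ρ1, a1, a2, by nlinarith, c1⟩
  by_cases c2 : δ * ρ2 ^ m ≤ μ.real (E ∩ ball x ρ2)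
  · exact ⟨ρ2, b1, b2, c2, by nlinarith⟩
  push Not at c1 c2
  set g : ℝ → ℝ := fun ρ => μ.real (E ∩ ball x ρ) - m0 / 2 * ρ ^ m with hg
  have hdiff : ∀ σ ρ, 0 < σ → σ ≤ ρ → |μ.real (E ∩ ball x ρ) - μ.real (E ∩ ball x σ)| ≤ |m0 * ρ ^ m - m0 * σ ^ m| := by
    intro σ ρ hσ hσρ
    have e1 : μ.real (E ∩ ball x σ) ≤ μ.real (E ∩ ball x ρ) :=
      measureReal_mono (inter_subset_inter_right _ (ball_subset_ball hσρ)) (fin_inter_ball μ E x ρ)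
    have e2 : μ.real (Eᶜ ∩ ball x σ) ≤ μ.real (Eᶜ ∩ ball x ρ) :=
      measureReal_mono (inter_subset_inter_right _ (ball_subset_ball hσρ)) (fin_inter_ball μ Eᶜ x ρ)
    have e3 := hsum σ hσ
    have e4 := hsum ρ (hσ.trans_le hσρ)
    rw [abs_of_nonneg (by linarith), abs_of_nonneg (by linarith)]
    linarith
  have hcont : ContinuousOn g (Ioi 0) := by
    refine ContinuousOn.sub ?_ (by fun_prop)
    intro σ hσ
    refine ContinuousAt.continuousWithinAt ?_
    have ht : Tendsto (fun ρ : ℝ => |m0 * ρ ^ m - m0 * σ ^ m|) (𝓝 σ) (𝓝 0) := by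
      have : Continuous fun ρ : ℝ => |m0 * ρ ^ m - m0 * σ ^ m| := Continuous.abs (by fun_prop)
      simpa using this.tendsto σ
    rw [ContinuousAt, tendsto_iff_dist_tendsto_zero]
    refine squeeze_zero' (Eventually.of_forall fun _ => dist_nonneg) ?_ ht
    filter_upwards [Ioi_mem_nhds hσ] with ρ hρ
    rw [Real.dist_eq]
    rcases le_total σ ρ with h | h
    · exact hdiff σ ρ hσ h
    · rw [abs_sub_comm, abs_sub_comm (m0 * ρ ^ m)]; exact hdiff ρ σ hρ h
  have hg1 : 0 ≤ g ρ1 := by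
    have := hsum ρ1 a1
    simp only [hg]; nlinarith
  have hg2 : g ρ2 ≤ 0 := by
    simp only [hg]; nlinarith
  have hsub : uIcc ρ2 ρ1 ⊆ Ioi 0 := fun t ht => (lt_min b1 a1).trans_le ht.1
  obtain ⟨ρ, hρ, hgρ⟩ := intermediate_value_uIcc (hcont.mono hsub)
    (show (0:ℝ) ∈ uIcc (g ρ2) (g ρ1) by rw [uIcc_of_le (hg2.trans hg1)]; exact ⟨hg2, hg1⟩)
  have hρ0' : 0 < ρ := hsub hρ
  have p3 : 0 < ρ ^ m := by positivity
  have := hsum ρ hρ0'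
  simp only [hg] at hgρ
  refine ⟨ρ, hρ0', hρ.2.trans_lt (max_lt b2 a2), by nlinarith, by nlinarith⟩

end Cover25


section Ang26

variable {n : ℕ} (hn : 2 ≤ n)

theorem angle26 {p q : Euc 2} (hp : p ≠ 0) (hq : q ≠ 0) :
    InnerProductGeometry.angle p q ≤ Real.pi * ‖p - q‖ / ‖p‖ := by
  set θ := InnerProductGeometry.angle p q with hθ
  have hp0 : 0 < ‖p‖ := norm_pos_iff.2 hp
  have hq0 : 0 < ‖q‖ := norm_pos_iff.2 hq
  have h0 : 0 ≤ θ := InnerProductGeometry.angle_nonneg p q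
  have h1 : θ ≤ Real.pi := InnerProductGeometry.angle_le_pi p q
  have hcos : Real.cos θ ≤ 1 - 2 / Real.pi ^ 2 * θ ^ 2 := Real.cos_le_one_sub_mul_cos_sq (by rw [abs_of_nonneg h0]; exact h1)
  have e1 : Real.cos θ * (‖p‖ * ‖q‖) = ⟪p, q⟫ := InnerProductGeometry.cos_angle_mul_norm_mul_norm p q
  have e2 : ‖p - q‖ ^ 2 = ‖p‖ ^ 2 - 2 * ⟪p, q⟫ + ‖q‖ ^ 2 := norm_sub_sq_real p q
  have hpi := Real.pi_pos
  rw [le_div_iff₀ hp0]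
  refine abs_le_of_sq_le_sq' ?_ (by positivity) |>.2
  obtain ⟨k, hk⟩ : ∃ k, k = θ / Real.pi := ⟨_, rfl⟩
  have hθk : θ = Real.pi * k := by rw [hk]; field_simp
  have hk0 : 0 ≤ k := by rw [hk]; positivity
  have hk1 : k ≤ 1 := by rw [hk, div_le_one hpi]; exact h1
  have hcos2 : Real.cos θ ≤ 1 - 2 * k ^ 2 := by
    refine hcos.trans (le_of_eq ?_)
    rw [hk]; field_simp
  have hpq : 0 < ‖p‖ * ‖q‖ := by positivity
  have hkk : k ^ 2 ≤ 1 := by nlinarith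
  have e3 : (k * ‖p‖) ^ 2 ≤ ‖p - q‖ ^ 2 := by
    rw [e2, ← e1]
    have h5 := mul_le_mul_of_nonneg_right hcos2 hpq.le
    have h6 : 0 ≤ (1 - k ^ 2) * (‖p‖ - ‖q‖) ^ 2 := mul_nonneg (by linarith) (sq_nonneg _)
    have h7 : 0 ≤ k ^ 2 * (2 * (‖p‖ * ‖q‖) + ‖q‖ ^ 2) := by positivity
    nlinarith
  calc (θ * ‖p‖) ^ 2 = Real.pi ^ 2 * (k * ‖p‖) ^ 2 := by rw [hθk]; ring
    _ ≤ Real.pi ^ 2 * ‖p - q‖ ^ 2 := by gcongr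
    _ = _ := by ring

theorem Ang_lip {x y : Euc n} (hx : pr12 hn x ≠ 0) (hy : pr12 hn y ≠ 0) :
    |Ang hn x - Ang hn y| ≤ Real.pi / ‖pr12 hn x‖ * ‖x - y‖ := by
  have hA : ∀ z : Euc n, pr12 hn z ≠ 0 → Ang hn z = InnerProductGeometry.angle (pr12 hn z) (e1 2 (by norm_num)) := by
    intro z hz
    unfold Ang InnerProductGeometry.angle hatv
    rw [e1_norm, inner_smul_left]
    simp [div_eq_inv_mul]
  rw [hA x hx, hA y hy]
  have h1 := InnerProductGeometry.angle_le_angle_add_angle (pr12 hn x) (pr12 hn y) (e1 2 (by norm_num))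
  have h2 := InnerProductGeometry.angle_le_angle_add_angle (pr12 hn y) (pr12 hn x) (e1 2 (by norm_num))
  rw [InnerProductGeometry.angle_comm (pr12 hn y) (pr12 hn x)] at h2
  have h3 := angle26 hx hy
  have h4 : ‖pr12 hn x - pr12 hn y‖ ≤ ‖x - y‖ := by rw [← pr12_sub]; exact norm_pr12_le hn _
  have h5 : Real.pi * ‖pr12 hn x - pr12 hn y‖ / ‖pr12 hn x‖ ≤ Real.pi / ‖pr12 hn x‖ * ‖x - y‖ := by
    rw [div_mul_eq_mul_div]
    gcongr
  rw [abs_le]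
  constructor <;> linarith

theorem vol26 {M : Set (ℝ × Euc (n - 2))} (hM : MeasurableSet M) {R A0 s : ℝ} (hs : 0 ≤ s) (hR : ∀ p ∈ M, p.1 ≤ R) :
    volume {y : Euc n | piB hn y ∈ M ∧ |Ang hn y - A0| ≤ s} ≤
      cJ hn * (ENNReal.ofReal R * ENNReal.ofReal (4 * s) * volume M) := by
  have hT : MeasurableSet {t : ℝ | |t - A0| ≤ s} :=
    measurableSet_le (continuous_abs.measurable.comp (by fun_prop : Measurable fun t : ℝ => t - A0)) measurable_const
  set Z : Set ((ℝ × Euc (n - 2)) × ℝ) := M ×ˢ {t : ℝ | |t - A0| ≤ s} with hZ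
  have hZm : MeasurableSet Z := hM.prod hT
  have h := polar_lint hn (G := Z.indicator 1) (measurable_one.indicator hZm)
  have hset : {y : Euc n | piB hn y ∈ M ∧ |Ang hn y - A0| ≤ s} = (fun y => (piB hn y, Ang hn y)) ⁻¹' Z := rfl
  have hm : Measurable fun y => (piB hn y, Ang hn y) := (piB_cont hn).measurable.prodMk (Ang_meas hn)
  rw [hset, ← lintegral_indicator_one (hm hZm)]
  refine le_trans (le_of_eq h) ?_
  gcongr
  calc _ ≤ ∫⁻ p in Ioi (0:ℝ) ×ˢ (univ : Set (Euc (n - 2))), M.indicator (fun _ => ENNReal.ofReal R * ENNReal.ofReal (4 * s)) p := by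
        refine lintegral_mono fun p => ?_
        by_cases hp : p ∈ M
        · rw [indicator_of_mem hp]
          gcongr
          · exact hR p hp
          · have hsub : ∀ θ : ℝ, Z.indicator (1 : (ℝ × Euc (n - 2)) × ℝ → ℝ≥0∞) (p, |θ|) ≤
                (Icc (A0 - s) (A0 + s) ∪ Icc (-A0 - s) (-A0 + s)).indicator 1 θ := by
              intro θ
              by_cases hz : (p, |θ|) ∈ Z
              · have : θ ∈ Icc (A0 - s) (A0 + s) ∪ Icc (-A0 - s) (-A0 + s) := by
                  have h2 : |(|θ|) - A0| ≤ s := hz.2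
                  rw [abs_le] at h2
                  rcases abs_cases θ with ⟨h3, -⟩ | ⟨h3, -⟩ <;> rw [h3] at h2
                  · left; exact ⟨by linarith, by linarith⟩
                  · right; exact ⟨by linarith, by linarith⟩
                rw [indicator_of_mem hz, indicator_of_mem this]; rfl
              · rw [indicator_of_notMem hz]; exact zero_le
            refine (setLIntegral_le_lintegral _ _).trans ((lintegral_mono hsub).trans ?_)
            rw [lintegral_indicator_one (measurableSet_Icc.union measurableSet_Icc)]
            refine (measure_union_le _ _).trans ?_
            rw [Real.volume_Icc, Real.volume_Icc, ← ENNReal.ofReal_add (by linarith) (by linarith)]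
            exact ENNReal.ofReal_le_ofReal (by linarith)
        · rw [indicator_of_notMem hp]
          have : ∀ θ : ℝ, Z.indicator (1 : (ℝ × Euc (n - 2)) × ℝ → ℝ≥0∞) (p, |θ|) = 0 := fun θ => indicator_of_notMem (fun hz => hp hz.1) _
          simp [this]
    _ ≤ ∫⁻ p, M.indicator (fun _ => ENNReal.ofReal R * ENNReal.ofReal (4 * s)) p := setLIntegral_le_lintegral _ _
    _ = _ := by rw [lintegral_indicator hM, setLIntegral_const]

/-- the two parametrisations of the graph -/
noncomputable def Phi (σ : ℝ) (u : ℝ × Euc (n - 2) → ℝ) (p : ℝ × Euc (n - 2)) : Euc n :=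
  (JE hn).symm ((p.1 * Real.cos (σ * u p), p.1 * Real.sin (σ * u p)), p.2)

theorem Phi_meas (σ : ℝ) {u : ℝ × Euc (n - 2) → ℝ} (hu : Measurable u) : Measurable (Phi hn σ u) := by
  unfold Phi
  exact (JE hn).symm.continuous.measurable.comp (by fun_prop)

theorem Phi_near {x : Euc n} (hx : pr12 hn x ≠ 0) : ∃ σ : ℝ, (σ = 1 ∨ σ = -1) ∧
    ∀ (u : ℝ × Euc (n - 2) → ℝ) (p : ℝ × Euc (n - 2)),
      dist (Phi hn σ u p) x ≤ ‖((JE hn).symm : ((ℝ × ℝ) × Euc (n - 2)) →L[ℝ] Euc n)‖ * (dist p (piB hn x) + ‖pr12 hn x‖ * |u p - Ang hn x|) := by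
  set r := ‖pr12 hn x‖ with hr
  have hr0 : 0 < r := norm_pos_iff.2 hx
  set A := Ang hn x with hA
  have hsq := norm2 (pr12 hn x)
  have habs : |r⁻¹ * pr12 hn x 0| ≤ 1 := by
    rw [abs_mul, abs_of_pos (inv_pos.2 hr0), inv_mul_le_iff₀ hr0, mul_one]
    exact abs_le_of_sq_le_sq (by nlinarith [sq_nonneg (pr12 hn x 1)]) hr0.le
  have hcos : r * Real.cos A = pr12 hn x 0 := by
    rw [hA, Ang_eq, Real.cos_arccos (abs_le.1 habs).1 (abs_le.1 habs).2, mul_inv_cancel_left₀ hr0.ne']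
  have hsin : ∃ σ : ℝ, (σ = 1 ∨ σ = -1) ∧ r * Real.sin (σ * A) = pr12 hn x 1 := by
    have : (r * Real.sin A) ^ 2 = pr12 hn x 1 ^ 2 := by
      have := Real.sin_sq_add_cos_sq A
      have h2 : (r * Real.cos A) ^ 2 = pr12 hn x 0 ^ 2 := by rw [hcos]
      nlinarith
    rcases sq_eq_sq_iff_eq_or_eq_neg.1 this with h | h
    · exact ⟨1, Or.inl rfl, by rw [one_mul, h]⟩
    · exact ⟨-1, Or.inr rfl, by rw [neg_one_mul, Real.sin_neg]; linarith⟩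
  obtain ⟨σ, hσ, hsin⟩ := hsin
  have hσ1 : |σ| = 1 := by rcases hσ with h | h <;> simp [h]
  have hcos2 : r * Real.cos (σ * A) = pr12 hn x 0 := by
    rw [← hcos]; rcases hσ with h | h <;> simp [h]
  refine ⟨σ, hσ, fun u p => ?_⟩
  have ex : x = (JE hn).symm ((r * Real.cos (σ * A), r * Real.sin (σ * A)), prC hn x) := by
    rw [hsin, hcos2, ← JE_apply, ContinuousLinearEquiv.symm_apply_apply]
  have hd : |σ * u p - σ * A| = |u p - A| := by rw [← mul_sub, abs_mul, hσ1, one_mul]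
  have hp1 : |p.1 - r| ≤ dist p (piB hn x) := by
    rw [Prod.dist_eq]; exact le_max_left _ _
  have hp2 : dist p.2 (prC hn x) ≤ dist p (piB hn x) := by
    rw [Prod.dist_eq]; exact le_max_right _ _
  have hnn : 0 ≤ r * |u p - A| := by positivity
  have key : ∀ c c' : ℝ, |c| ≤ 1 → |c - c'| ≤ |u p - A| → |p.1 * c - r * c'| ≤ dist p (piB hn x) + r * |u p - A| := by
    intro c c' h1 h2
    have : p.1 * c - r * c' = (p.1 - r) * c + r * (c - c') := by ring
    rw [this]
    refine (abs_add_le _ _).trans ?_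
    rw [abs_mul, abs_mul, abs_of_pos hr0]
    have := mul_le_mul hp1 h1 (abs_nonneg _) dist_nonneg
    have := mul_le_mul_of_nonneg_left h2 hr0.le
    linarith
  conv_lhs => rw [ex]
  unfold Phi
  have hop : ∀ z z' : (ℝ × ℝ) × Euc (n - 2), dist ((JE hn).symm z) ((JE hn).symm z') ≤
      ‖((JE hn).symm : ((ℝ × ℝ) × Euc (n - 2)) →L[ℝ] Euc n)‖ * dist z z' := by
    intro z z'
    rw [dist_eq_norm, dist_eq_norm, ← map_sub]
    exact ((JE hn).symm : ((ℝ × ℝ) × Euc (n - 2)) →L[ℝ] Euc n).le_opNorm (z - z')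
  refine (hop _ _).trans ?_
  gcongr
  rw [Prod.dist_eq, Prod.dist_eq]
  refine max_le (max_le ?_ ?_) ?_
  · exact key _ _ (Real.abs_cos_le_one _) (by rw [← hd]; exact Real.abs_cos_sub_cos_le _ _)
  · exact key _ _ (Real.abs_sin_le_one _) (by rw [← hd]; exact Real.abs_sin_sub_sin_le _ _)
  · simp only; linarith

end Ang26


section Mass27

variable {W : Type*} [NormedAddCommGroup W] [NormedSpace ℝ W] [FiniteDimensional ℝ W]
    [MeasurableSpace W] [BorelSpace W] {μ : Measure W} [μ.IsAddHaarMeasure]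

theorem mass27 {Q : Set W} (hQo : IsOpen Q) (hQc : Convex ℝ Q) {f : W → ℝ} {γ : W → W → ℝ} {N : W → ℝ≥0∞}
    (hf : Measurable f) (hfi : Integrable f μ) (hg : ∀ w, Measurable (γ w)) (hgi : ∀ w, Integrable (γ w) μ)
    (H : ∀ w, ∀ φ ∈ C1c Q, ∫ x, f x * fderiv ℝ φ x w ∂μ = -∫ x, φ x * γ w x ∂μ)
    (hN : Measurable N) (hgN : ∀ w x, ‖γ w x‖ₑ ≤ ENNReal.ofReal ‖w‖ * N x)
    {C e : ℝ} (hC : 0 < C) (he : 0 < e) (A0 : ℝ) :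
    ∃ c > 0, ∀ (q : W) (ρ : ℝ), 0 < ρ → ball q ρ ⊆ Q →
      ENNReal.ofReal (e * ρ ^ Module.finrank ℝ W) ≤ μ ({x | A0 - C * ρ ≤ f x} ∩ ball q ρ) →
      ENNReal.ofReal (e * ρ ^ Module.finrank ℝ W) ≤ μ ({x | f x ≤ A0 + C * ρ} ∩ ball q ρ) →
      ENNReal.ofReal (c * ρ ^ Module.finrank ℝ W) ≤
        ∫⁻ x in ball q ρ ∩ {x | |f x - A0| ≤ 2 * (C * ρ)}, (1 + N x) ∂μ := by
  set d := Module.finrank ℝ W with hd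
  set m0 := μ.real (ball (0:W) 1) with hm0
  have hm0p : 0 < m0 := real_unit_pos μ
  refine ⟨min (e / 2) (C * e ^ 2 / (2 * m0 * 2 ^ d)), by positivity, fun q ρ hρ hD h1 h2 => ?_⟩
  set s := C * ρ with hs
  have hs0 : 0 < s := by positivity
  have hρd : 0 < ρ ^ d := by positivity
  have habsm : Measurable fun x => |f x - A0| := continuous_abs.measurable.comp (hf.sub_const A0)
  set T := ball q ρ ∩ {x | |f x - A0| ≤ 2 * s} with hT
  have hTm : MeasurableSet T := measurableSet_ball.inter (measurableSet_le habsm measurable_const)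
  by_cases hcase : ENNReal.ofReal (e / 2 * ρ ^ d) ≤ μ T
  · calc _ ≤ ENNReal.ofReal (e / 2 * ρ ^ d) := by gcongr; exact min_le_left _ _
      _ ≤ μ T := hcase
      _ = ∫⁻ x in T, 1 ∂μ := by simp
      _ ≤ _ := lintegral_mono fun x => le_self_add
  push Not at hcase
  have hsplit : ENNReal.ofReal (e * ρ ^ d) = ENNReal.ofReal (e / 2 * ρ ^ d) + ENNReal.ofReal (e / 2 * ρ ^ d) := by
    rw [← ENNReal.ofReal_add (by positivity) (by positivity)]; congr 1; ring
  have half : ∀ X Y : Set W, ENNReal.ofReal (e * ρ ^ d) ≤ μ X → X ⊆ Y ∪ T → ENNReal.ofReal (e / 2 * ρ ^ d) ≤ μ Y := by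
    intro X Y hX hXY
    by_contra hcon
    push Not at hcon
    have := hX.trans ((measure_mono hXY).trans (measure_union_le _ _))
    rw [hsplit] at this
    exact absurd this (not_le.2 (ENNReal.add_lt_add hcon hcase))
  have hA := half _ ({x | A0 + 2 * s ≤ f x} ∩ ball q ρ) h1 (by
    rintro x ⟨hx1, hx2⟩
    simp only [Set.mem_ofPred_eq] at hx1
    by_cases hx3 : A0 + 2 * s ≤ f x
    · exact Or.inl ⟨hx3, hx2⟩
    · refine Or.inr ⟨hx2, ?_⟩
      simp only [Set.mem_ofPred_eq, abs_le]; constructor <;> linarith)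
  have hB := half _ ({x | f x ≤ A0 - 2 * s} ∩ ball q ρ) h2 (by
    rintro x ⟨hx1, hx2⟩
    simp only [Set.mem_ofPred_eq] at hx1
    by_cases hx3 : f x ≤ A0 - 2 * s
    · exact Or.inl ⟨hx3, hx2⟩
    · refine Or.inr ⟨hx2, ?_⟩
      simp only [Set.mem_ofPred_eq, abs_le]; constructor <;> linarith)
  have hP := pair25 (μ := μ) hQo hQc hf hfi hg hgi H hN hgN hρ hD (a := A0 - 2 * s) (b := A0 + 2 * s) (by linarith)
  have hball : μ (ball (0:W) (2 * ρ)) = ENNReal.ofReal ((2 * ρ) ^ d * m0) := by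
    rw [← real_ball_eq μ (0:W) (by positivity : 0 < 2 * ρ), ofReal_measureReal (measure_ball_lt_top).ne]
  set I := ∫⁻ x in ball q ρ ∩ f ⁻¹' (Ioo (A0 - 2 * s) (A0 + 2 * s)), N x ∂μ with hI
  have hK : 0 < 2 * ρ * ((2 * ρ) ^ d * m0) := by positivity
  have h3 : ENNReal.ofReal (2 * ρ * ((2 * ρ) ^ d * m0)) * ENNReal.ofReal (C * e ^ 2 / (2 * m0 * 2 ^ d) * ρ ^ d) ≤
      ENNReal.ofReal (2 * ρ * ((2 * ρ) ^ d * m0)) * I := by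
    calc _ = ENNReal.ofReal (4 * s) * (ENNReal.ofReal (e / 2 * ρ ^ d) * ENNReal.ofReal (e / 2 * ρ ^ d)) := by
          rw [← ENNReal.ofReal_mul (by positivity), ← ENNReal.ofReal_mul (by positivity), ← ENNReal.ofReal_mul (by positivity)]
          congr 1
          rw [hs, mul_pow]; field_simp; ring
      _ ≤ _ := by
          have e4 : A0 + 2 * s - (A0 - 2 * s) = 4 * s := by ring
          rw [e4] at hP
          refine le_trans ?_ (hP.trans (le_of_eq ?_))
          · gcongr
          · rw [hball, ENNReal.ofReal_mul (by positivity : 0 ≤ 2 * ρ)]; ring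
  rw [ENNReal.mul_le_mul_iff_right (by simpa using hK) ENNReal.ofReal_ne_top] at h3
  calc _ ≤ ENNReal.ofReal (C * e ^ 2 / (2 * m0 * 2 ^ d) * ρ ^ d) := by gcongr; exact min_le_right _ _
    _ ≤ I := h3
    _ ≤ ∫⁻ x in T, N x ∂μ := by
        refine lintegral_mono_set fun x hx => ⟨hx.1, ?_⟩
        have := hx.2
        simp only [mem_preimage, mem_Ioo] at this
        simp only [Set.mem_ofPred_eq, abs_le]; constructor <;> linarith
    _ ≤ _ := lintegral_mono fun x => le_add_self

end Mass27

theorem extract27 {m : ℕ} {u : ℝ × Euc m → ℝ} (hu : Measurable u) {Ω : Set (ℝ × Euc m)} (ho : IsOpen Ω)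
    (hW : W11locProd u Ω) {p0 : ℝ × Euc m} {R : ℝ} (hb : closedBall p0 R ⊆ Ω) :
    ∃ (f : ℝ × Euc m → ℝ) (γ : ℝ × Euc m → ℝ × Euc m → ℝ) (N : ℝ × Euc m → ℝ≥0∞),
      Measurable f ∧ Integrable f volume ∧ (∀ p ∈ ball p0 R, f p = u p) ∧ (∀ w, Measurable (γ w)) ∧
      (∀ w, Integrable (γ w) volume) ∧
      (∀ w, ∀ φ ∈ C1c (ball p0 R), ∫ x, f x * fderiv ℝ φ x w = -∫ x, φ x * γ w x) ∧
      Measurable N ∧ (∀ w x, ‖γ w x‖ₑ ≤ ENNReal.ofReal ‖w‖ * N x) ∧ ∫⁻ x, N x ≠ ⊤ := by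
  obtain ⟨g1, g2, hf, h1, h2, hH⟩ := hW
  set Q := ball p0 R with hQ
  have hQm : MeasurableSet Q := measurableSet_ball
  have hQΩ : Q ⊆ Ω := ball_subset_closedBall.trans hb
  have hK : IsCompact (closedBall p0 R) := isCompact_closedBall _ _
  have if_ : IntegrableOn u Q := (hf.integrableOn_compact_subset hb hK).mono_set ball_subset_closedBall
  have i1 : IntegrableOn g1 Q := (h1.integrableOn_compact_subset hb hK).mono_set ball_subset_closedBall
  have i2 : IntegrableOn g2 Q := (h2.integrableOn_compact_subset hb hK).mono_set ball_subset_closedBall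
  set G1 := i1.aestronglyMeasurable.mk g1 with hG1
  set G2 := i2.aestronglyMeasurable.mk g2 with hG2
  have m1 : Measurable G1 := i1.aestronglyMeasurable.stronglyMeasurable_mk.measurable
  have m2 : Measurable G2 := i2.aestronglyMeasurable.stronglyMeasurable_mk.measurable
  have a1 : ∀ᵐ x, x ∈ Q → g1 x = G1 x := (ae_restrict_iff' hQm).1 i1.aestronglyMeasurable.ae_eq_mk
  have a2 : ∀ᵐ x, x ∈ Q → g2 x = G2 x := (ae_restrict_iff' hQm).1 i2.aestronglyMeasurable.ae_eq_mk
  have j1 : IntegrableOn G1 Q := i1.congr i1.aestronglyMeasurable.ae_eq_mk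
  have j2 : IntegrableOn G2 Q := i2.congr i2.aestronglyMeasurable.ae_eq_mk
  have mg : ∀ w : ℝ × Euc m, Measurable fun x => G1 x * w.1 + ⟪G2 x, w.2⟫ := fun w =>
    (m1.mul_const _).add (m2.inner measurable_const)
  refine ⟨Q.indicator u, fun w => Q.indicator fun x => G1 x * w.1 + ⟪G2 x, w.2⟫,
    Q.indicator fun x => ‖G1 x‖ₑ + ‖G2 x‖ₑ, hu.indicator hQm, if_.integrable_indicator hQm,
    fun p hp => indicator_of_mem hp _, fun w => (mg w).indicator hQm, fun w => ?_, fun w φ hφ => ?_,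
    (m1.enorm.add m2.enorm).indicator hQm, fun w x => ?_, ?_⟩
  · refine IntegrableOn.integrable_indicator ?_ hQm
    exact (j1.mul_const _).add (j2.inner_const _)
  · have hφ0 : ∀ x, x ∉ Q → φ x = 0 := fun x hx => image_eq_zero_of_notMem_tsupport fun h => hx (hφ.2.2 h)
    have hφ1 : ∀ x, x ∉ Q → fderiv ℝ φ x = 0 := fun x hx =>
      image_eq_zero_of_notMem_tsupport fun h => hx (hφ.2.2 (tsupport_fderiv_subset ℝ h))
    have e := hH φ hφ.1 hφ.2.1 (hφ.2.2.trans hQΩ) w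
    rw [← integral_indicator ho.measurableSet, ← integral_indicator ho.measurableSet] at e
    have e1 : ∫ x, Q.indicator u x * fderiv ℝ φ x w = ∫ x, Ω.indicator (fun x => u x * fderiv ℝ φ x w) x := by
      refine integral_congr_ae (Eventually.of_forall fun x => ?_)
      by_cases hx : x ∈ Q
      · simp only [indicator_of_mem hx, indicator_of_mem (hQΩ hx)]
      · simp only [indicator, hφ1 x hx]; simp
    have e2 : ∫ x, φ x * Q.indicator (fun x => G1 x * w.1 + ⟪G2 x, w.2⟫) x =
        ∫ x, Ω.indicator (fun x => φ x * (g1 x * w.1 + ⟪g2 x, w.2⟫)) x := by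
      refine integral_congr_ae ?_
      filter_upwards [a1, a2] with x b1 b2
      by_cases hx : x ∈ Q
      · simp only [indicator_of_mem hx, indicator_of_mem (hQΩ hx), b1 hx, b2 hx]
      · simp only [indicator, hφ0 x hx]; simp
    rw [e1, e2, e]
  · by_cases hx : x ∈ Q
    · simp only [indicator_of_mem hx]
      refine (enorm_add_le _ _).trans ?_
      rw [mul_add]
      have hw1 : ‖w.1‖ₑ ≤ ENNReal.ofReal ‖w‖ := by rw [← ofReal_norm]; exact ENNReal.ofReal_le_ofReal (norm_fst_le w)
      have hw2 : ‖w.2‖ₑ ≤ ENNReal.ofReal ‖w‖ := by rw [← ofReal_norm]; exact ENNReal.ofReal_le_ofReal (norm_snd_le w)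
      refine add_le_add ?_ ?_
      · rw [enorm_mul, mul_comm]; gcongr
      · have : ‖⟪G2 x, w.2⟫‖ₑ ≤ ‖G2 x‖ₑ * ‖w.2‖ₑ := by
          rw [← ofReal_norm, ← ofReal_norm, ← ofReal_norm, ← ENNReal.ofReal_mul (norm_nonneg _)]
          exact ENNReal.ofReal_le_ofReal (norm_inner_le_norm _ _)
        rw [mul_comm]
        exact this.trans (by gcongr)
    · simp only [indicator_of_notMem hx]; simp
  · rw [lintegral_indicator hQm, lintegral_add_left m1.enorm]
    exact ENNReal.add_ne_top.2 ⟨j1.2.ne, j2.2.ne⟩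


section P28
variable {n : ℕ} (hn : 2 ≤ n)

theorem near28 {x y : Euc n} {ρ : ℝ} (hy : y ∈ ball x ρ) (hρ : ρ < ‖pr12 hn x‖ / 2) : pr12 hn y ≠ 0 := by
  have h := piB_dist hn y x
  rw [← dist_eq_norm] at h
  have h1 : dist (piB hn y).1 (piB hn x).1 ≤ dist y x := (le_max_left _ _).trans h
  have h2 : dist y x < ρ := mem_ball.1 hy
  rw [Real.dist_eq] at h1
  have h3 := (abs_le.1 h1).1
  have e1 : (piB hn y).1 = ‖pr12 hn y‖ := rfl
  have e2 : (piB hn x).1 = ‖pr12 hn x‖ := rfl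
  rw [e1, e2] at h3
  have : 0 ≤ dist y x := dist_nonneg
  exact norm_pos_iff.1 (by linarith)

theorem lowvol28 {x : Euc n} (hx : pr12 hn x ≠ 0) {ρ δ : ℝ} (hρ0 : 0 < ρ) (hρ : ρ < ‖pr12 hn x‖ / 2) (hδ : 0 < δ)
    {G : Set (Euc n)} (hG : G ⊆ ball x ρ) {M : Set (ℝ × Euc (n - 2))} (hM : MeasurableSet M)
    (hMb : M ⊆ ball (piB hn x) ρ) (hGM : ∀ y ∈ G, piB hn y ∈ M)
    (h : δ * ρ ^ n ≤ volume.real G) :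
    ENNReal.ofReal (δ / (8 * Real.pi * cJ hn) * ρ ^ (n - 1)) ≤ volume M := by
  set r := ‖pr12 hn x‖ with hr
  have hr0 : 0 < r := norm_pos_iff.2 hx
  have hpi := Real.pi_pos
  have hcJ : (0:ℝ) < cJ hn := by exact_mod_cast cJ_pos hn
  have hMfin : volume M ≠ ⊤ := ((measure_mono hMb).trans_lt measure_ball_lt_top).ne
  have hs : 0 ≤ Real.pi / r * ρ := by positivity
  have hv := vol26 hn hM (A0 := Ang hn x) (R := 2 * r) hs (by
    intro p hp
    have h1 : dist p.1 (piB hn x).1 ≤ dist p (piB hn x) := le_max_left _ _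
    have h2 := mem_ball.1 (hMb hp)
    rw [Real.dist_eq] at h1
    have h3 := (abs_le.1 h1).2
    have e2 : (piB hn x).1 = r := rfl
    rw [e2] at h3
    linarith)
  have hsub : G ⊆ {y : Euc n | piB hn y ∈ M ∧ |Ang hn y - Ang hn x| ≤ Real.pi / r * ρ} := by
    intro y hy
    refine ⟨hGM y hy, ?_⟩
    have h1 := Ang_lip hn hx (near28 hn (hG hy) hρ)
    rw [abs_sub_comm]
    refine h1.trans ?_
    have h2 := mem_ball.1 (hG hy)
    rw [dist_comm, dist_eq_norm] at h2
    gcongr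
  have hle := (measure_mono hsub).trans hv
  have h1 : ENNReal.ofReal (δ * ρ ^ n) ≤ volume G := by
    refine (ENNReal.ofReal_le_ofReal h).trans ?_
    exact ENNReal.ofReal_toReal_le
  have h2 := h1.trans hle
  have e : (cJ hn : ℝ≥0∞) * (ENNReal.ofReal (2 * r) * ENNReal.ofReal (4 * (Real.pi / r * ρ)) * volume M)
      = ENNReal.ofReal (cJ hn * (2 * r * (4 * (Real.pi / r * ρ)) * volume.real M)) := by
    rw [ENNReal.ofReal_mul (p := (cJ hn : ℝ)) hcJ.le,
      ENNReal.ofReal_mul (p := 2 * r * (4 * (Real.pi / r * ρ))) (by positivity),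
      ENNReal.ofReal_mul (p := 2 * r) (by positivity),
      measureReal_def, ENNReal.ofReal_toReal hMfin, ENNReal.ofReal_coe_nnreal]
  rw [e] at h2
  have h3 := (ENNReal.ofReal_le_ofReal_iff (by positivity)).1 h2
  rw [← ENNReal.ofReal_toReal hMfin]
  apply ENNReal.ofReal_le_ofReal
  change _ ≤ volume.real M
  have e4 : (cJ hn : ℝ) * (2 * r * (4 * (Real.pi / r * ρ)) * volume.real M) = ρ * (8 * Real.pi * cJ hn * volume.real M) := by
    field_simp; ring
  rw [e4] at h3
  have e5 : ρ ^ n = ρ * ρ ^ (n - 1) := by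
    rw [← pow_succ']; congr 1; omega
  rw [e5] at h3
  have h4 : δ * ρ ^ (n - 1) ≤ 8 * Real.pi * cJ hn * volume.real M := by
    refine le_of_mul_le_mul_left ?_ hρ0
    linarith
  rw [div_mul_eq_mul_div, div_le_iff₀ (by positivity)]
  linarith

theorem dens28 {ℓ : ℝ × Euc (n - 2) → ℝ} (hl : Measurable ℓ)
    {p0 : ℝ × Euc (n - 2)} {R : ℝ} {f : ℝ × Euc (n - 2) → ℝ} {γ : ℝ × Euc (n - 2) → ℝ × Euc (n - 2) → ℝ}
    {N : ℝ × Euc (n - 2) → ℝ≥0∞}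
    (hf : Measurable f) (hfi : Integrable f volume) (hfu : ∀ p ∈ ball p0 R, f p = uu ℓ p)
    (hg : ∀ w, Measurable (γ w)) (hgi : ∀ w, Integrable (γ w) volume)
    (H : ∀ w, ∀ φ ∈ C1c (ball p0 R), ∫ x, f x * fderiv ℝ φ x w = -∫ x, φ x * γ w x)
    (hN : Measurable N) (hgN : ∀ w x, ‖γ w x‖ₑ ≤ ENNReal.ofReal ‖w‖ * N x)
    {κ : Measure (ℝ × Euc (n - 2))} (hκ : κ = (volume.restrict (ball p0 R)).withDensity (fun p => 1 + N p))
    {x : Euc n} (hxb : x ∈ bd volume (circSymm hn ℓ)) (hx : pr12 hn x ≠ 0) (hxQ : piB hn x ∈ ball p0 R) :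
    ∃ c > 0, ∀ ε > 0, ∃ ρ, 0 < ρ ∧ ρ < ε ∧ ENNReal.ofReal (c * ρ ^ (n - 1)) ≤
      (κ.map (Phi hn 1 (uu ℓ)) + κ.map (Phi hn (-1) (uu ℓ))) (closedBall x ρ) := by
  set r := ‖pr12 hn x‖ with hr
  have hr0 : 0 < r := norm_pos_iff.2 hx
  have hpi := Real.pi_pos
  have hcJ : (0:ℝ) < cJ hn := by exact_mod_cast cJ_pos hn
  set q := piB hn x with hq
  set C := Real.pi / r with hC
  have hC0 : 0 < C := by positivity
  obtain ⟨δ, hδ, hD⟩ := densI volume (circ_meas hn hl) hxb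
  have e : Module.finrank ℝ (Euc n) = n := by simp
  rw [e] at hD
  set e' := δ / (8 * Real.pi * cJ hn) with he'
  have he0 : 0 < e' := by positivity
  obtain ⟨c, hc, hm⟩ := mass27 (μ := volume) isOpen_ball (convex_ball p0 R) hf hfi hg hgi H hN hgN hC0 he0 (Ang hn x)
  rw [finrank_base hn] at hm
  obtain ⟨σ, hσ, hPhi⟩ := Phi_near hn hx
  set K := ‖((JE hn).symm : ((ℝ × ℝ) × Euc (n - 2)) →L[ℝ] Euc n)‖ with hK
  have hK0 : 0 ≤ K := norm_nonneg _
  set C' := K * (1 + r * (2 * C)) + 1 with hC'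
  have hC'0 : 0 < C' := by positivity
  obtain ⟨η, hη, hηQ⟩ := Metric.isOpen_iff.1 (isOpen_ball (x := p0) (ε := R)) q hxQ
  refine ⟨c / C' ^ (n - 1), by positivity, fun ε hε => ?_⟩
  obtain ⟨ρ, hρ0, hρ, hA, hB⟩ := hD (min (min (r / 2) η) (ε / C')) (by positivity)
  have hρr : ρ < r / 2 := hρ.trans_le ((min_le_left _ _).trans (min_le_left _ _))
  have hρη : ρ < η := hρ.trans_le ((min_le_left _ _).trans (min_le_right _ _))
  have hρε : ρ < ε / C' := hρ.trans_le (min_le_right _ _)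
  have hbQ : ball q ρ ⊆ ball p0 R := (ball_subset_ball hρη.le).trans hηQ
  have hpb : ∀ y ∈ ball x ρ, piB hn y ∈ ball q ρ := by
    intro y hy
    rw [mem_ball]
    have := piB_dist hn y x
    rw [← dist_eq_norm] at this
    exact this.trans_lt hy
  have hAng : ∀ y ∈ ball x ρ, |Ang hn x - Ang hn y| ≤ C * ρ := by
    intro y hy
    refine (Ang_lip hn hx (near28 hn hy hρr)).trans ?_
    have h2 := mem_ball.1 hy
    rw [dist_comm, dist_eq_norm] at h2
    gcongr
  have v1 : ENNReal.ofReal (e' * ρ ^ (n - 1)) ≤ volume ({p | Ang hn x - C * ρ ≤ f p} ∩ ball q ρ) := by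
    refine lowvol28 hn hx hρ0 hρr hδ inter_subset_right ((measurableSet_le measurable_const hf).inter measurableSet_ball)
      inter_subset_right ?_ hA
    rintro y ⟨hyF, hy⟩
    refine ⟨?_, hpb y hy⟩
    have h1 := ((circ_mem hn).1 hyF).2
    have h2 := (abs_le.1 (hAng y hy)).2
    change _ ≤ f _
    rw [hfu _ (hbQ (hpb y hy))]
    linarith
  have v2 : ENNReal.ofReal (e' * ρ ^ (n - 1)) ≤ volume ({p | f p ≤ Ang hn x + C * ρ} ∩ ball q ρ) := by
    refine lowvol28 hn hx hρ0 hρr hδ inter_subset_right ((measurableSet_le hf measurable_const).inter measurableSet_ball)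
      inter_subset_right ?_ hB
    rintro y ⟨hyF, hy⟩
    refine ⟨?_, hpb y hy⟩
    have h1 : ¬ (Ang hn y < uu ℓ (piB hn y)) := fun h => hyF ((circ_mem hn).2 ⟨near28 hn hy hρr, h⟩)
    have h2 := (abs_le.1 (hAng y hy)).1
    change f _ ≤ _
    rw [hfu _ (hbQ (hpb y hy))]
    linarith [not_lt.1 h1]
  have hmain := hm q ρ hρ0 hbQ v1 v2
  set T := ball q ρ ∩ {p | |f p - Ang hn x| ≤ 2 * (C * ρ)} with hT
  have hTm : MeasurableSet T := measurableSet_ball.inter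
    (measurableSet_le (continuous_abs.measurable.comp (hf.sub_const _)) measurable_const)
  have hκT : κ T = ∫⁻ p in T, (1 + N p) := by
    rw [hκ, withDensity_apply _ hTm, Measure.restrict_restrict hTm,
      inter_eq_left.2 (inter_subset_left.trans hbQ)]
  rw [← hκT] at hmain
  have hTsub : T ⊆ Phi hn σ (uu ℓ) ⁻¹' closedBall x (C' * ρ) := by
    rintro p ⟨hp1, hp2⟩
    rw [mem_preimage, mem_closedBall]
    refine (hPhi (uu ℓ) p).trans ?_
    rw [← hfu p (hbQ hp1)]
    have h1 : dist p q ≤ ρ := (mem_ball.1 hp1).le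
    have h2 : |f p - Ang hn x| ≤ 2 * (C * ρ) := hp2
    calc K * (dist p q + r * |f p - Ang hn x|) ≤ K * (ρ + r * (2 * (C * ρ))) := by gcongr
      _ ≤ C' * ρ := by rw [hC']; nlinarith
  refine ⟨C' * ρ, by positivity, ?_, ?_⟩
  · rw [lt_div_iff₀ hC'0] at hρε; linarith
  · have e1 : c / C' ^ (n - 1) * (C' * ρ) ^ (n - 1) = c * ρ ^ (n - 1) := by
      rw [mul_pow]; field_simp
    rw [e1]
    refine hmain.trans ((measure_mono hTsub).trans ?_)
    have hle : κ.map (Phi hn σ (uu ℓ)) (closedBall x (C' * ρ)) = κ (Phi hn σ (uu ℓ) ⁻¹' closedBall x (C' * ρ)) :=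
      Measure.map_apply (Phi_meas hn σ (uu_meas hl)) measurableSet_closedBall
    rw [← hle, Measure.add_apply]
    rcases hσ with rfl | rfl
    · exact le_self_add
    · exact le_add_self

end P28


section P29
variable {n : ℕ} (hn : 2 ≤ n)

theorem cyl_eq29 {B : Set (ℝ × Euc (n - 2))} : cylSet hn B = {x | pr12 hn x ≠ 0 ∧ piB hn x ∈ B} := rfl

theorem cyl_meas29 {B : Set (ℝ × Euc (n - 2))} (hB : MeasurableSet B) : MeasurableSet (cylSet hn B) := by
  have h : cylSet hn B = piB hn ⁻¹' (B ∩ {p | p.1 ≠ 0}) := by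
    ext x
    rw [cyl_eq29]
    change (_ ∧ _) ↔ (_ ∧ (piB hn x).1 ≠ 0)
    rw [piB_fst_ne hn, and_comm]
  rw [h]
  exact (piB_cont hn).measurable (hB.inter (measurable_fst (measurableSet_singleton (0:ℝ)).compl))

theorem map_null29 {u : ℝ × Euc (n - 2) → ℝ} (hu : Measurable u) (σ : ℝ) {Q B : Set (ℝ × Euc (n - 2))}
    (hQ : MeasurableSet Q) (hQp : ∀ p ∈ Q, 0 ≤ p.1) {N : ℝ × Euc (n - 2) → ℝ≥0∞}
    (hB : MeasurableSet B) (h0 : volume B = 0) :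
    ((volume.restrict Q).withDensity N).map (Phi hn σ u) (cylSet hn B) = 0 := by
  have hc := cyl_meas29 hn hB
  have hP := Phi_meas hn σ hu
  rw [Measure.map_apply hP hc]
  apply withDensity_absolutelyContinuous
  rw [Measure.restrict_apply (hP hc)]
  refine measure_mono_null ?_ h0
  rintro p ⟨hp, hpQ⟩
  have h := hp.2
  change piB hn (Phi hn σ u p) ∈ B at h
  unfold Phi at h
  rwa [polar_piB hn (hQp p hpQ)] at h

theorem half29 {m : ℕ} {f : ℝ × Euc m → ℝ} {Ω : Set (ℝ × Euc m)} (h : W11locProd f Ω) (c : ℝ) :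
    W11locProd (fun p => c * f p) Ω := by
  obtain ⟨g1, g2, hf, h1, h2, hH⟩ := h
  refine ⟨fun p => c * g1 p, fun p => c • g2 p, hf.smul c, h1.smul c, h2.smul c, ?_⟩
  intro φ a b d y
  have e1 : ∀ x, c * f x * fderiv ℝ φ x y = c * (f x * fderiv ℝ φ x y) := fun x => by ring
  have e2 : ∀ x, φ x * (c * g1 x * y.1 + ⟪c • g2 x, y.2⟫) = c * (φ x * (g1 x * y.1 + ⟪g2 x, y.2⟫)) := fun x => by
    rw [real_inner_smul_left]; ring
  simp only [e1, e2]
  rw [integral_const_mul, integral_const_mul, hH φ a b d y]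
  ring

theorem local29 {ℓ : ℝ × Euc (n - 2) → ℝ} (hl : Measurable ℓ) {Ω : Set (ℝ × Euc (n - 2))} (ho : IsOpen Ω)
    (hΩ : Ω ⊆ (Ioi (0:ℝ)) ×ˢ (univ : Set (Euc (n - 2)))) (hW : W11locProd (uu ℓ) Ω)
    {p0 : ℝ × Euc (n - 2)} {R : ℝ} (hb : closedBall p0 R ⊆ Ω) {B : Set (ℝ × Euc (n - 2))}
    (hB : MeasurableSet B) (h0 : volume B = 0) :
    μH[((n - 1 : ℕ) : ℝ)] (bd volume (circSymm hn ℓ) ∩ cylSet hn (B ∩ ball p0 R)) = 0 := by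
  obtain ⟨f, γ, N, hf, hfi, hfu, hg, hgi, H, hN, hgN, hNf⟩ := extract27 (uu_meas hl) ho hW hb
  set κ := (volume.restrict (ball p0 R)).withDensity (fun p => 1 + N p) with hκ
  have hfin : IsFiniteMeasure κ := by
    refine isFiniteMeasure_withDensity ?_
    rw [lintegral_add_left measurable_const]
    refine ENNReal.add_ne_top.2 ⟨?_, ?_⟩
    · rw [lintegral_one, Measure.restrict_apply_univ]
      exact measure_ball_lt_top.ne
    · exact ((lintegral_mono' Measure.restrict_le_self le_rfl).trans_lt hNf.lt_top).ne
  have i1 : IsFiniteMeasure (κ.map (Phi hn 1 (uu ℓ))) := Measure.isFiniteMeasure_map _ _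
  have i2 : IsFiniteMeasure (κ.map (Phi hn (-1) (uu ℓ))) := Measure.isFiniteMeasure_map _ _
  set lam := κ.map (Phi hn 1 (uu ℓ)) + κ.map (Phi hn (-1) (uu ℓ)) with hlam
  have hQp : ∀ p ∈ ball p0 R, 0 ≤ p.1 := fun p hp => (hΩ (hb (ball_subset_closedBall hp))).1.le
  have hcyl : lam (cylSet hn B) = 0 := by
    rw [hlam, Measure.add_apply, hκ, map_null29 hn (uu_meas hl) _ measurableSet_ball hQp hB h0,
      map_null29 hn (uu_meas hl) _ measurableSet_ball hQp hB h0, add_zero]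
  set S : ℕ → Set (Euc n) := fun k => {x | x ∈ cylSet hn B ∧ ∀ ε > 0, ∃ ρ, 0 < ρ ∧ ρ < ε ∧
    ENNReal.ofReal (1 / ((k:ℝ) + 1) * ρ ^ (n - 1)) ≤ lam (closedBall x ρ)} with hS
  have hSk : ∀ k, μH[((n - 1 : ℕ) : ℝ)] (S k) = 0 := by
    intro k
    have hk : (0:ℝ) < 1 / ((k:ℝ) + 1) := by positivity
    exact cover25 (lam := lam) (measure_mono_null (fun x hx => hx.1) hcyl) hk (fun x hx => hx.2)
  refine measure_mono_null ?_ (measure_iUnion_null hSk)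
  rintro x ⟨hxb, hx0, hxB, hxQ⟩
  obtain ⟨c, hc, h⟩ := dens28 hn hl hf hfi hfu hg hgi H hN hgN hκ hxb hx0 hxQ
  obtain ⟨k, hk⟩ := exists_nat_one_div_lt hc
  refine mem_iUnion.2 ⟨k, ⟨hx0, hxB⟩, fun ε hε => ?_⟩
  obtain ⟨ρ, a, b, d⟩ := h ε hε
  refine ⟨ρ, a, b, le_trans (ENNReal.ofReal_le_ofReal ?_) d⟩
  gcongr

theorem ii_iii {ℓ : ℝ × Euc (n - 2) → ℝ} (hl : Measurable ℓ) {Ω : Set (ℝ × Euc (n - 2))} (ho : IsOpen Ω)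
    (hΩ : Ω ⊆ (Ioi (0:ℝ)) ×ˢ (univ : Set (Euc (n - 2)))) (hW : W11locProd (fun p => ℓ p / p.1) Ω)
    (B : Set (ℝ × Euc (n - 2))) (hB : MeasurableSet B) (hBΩ : B ⊆ Ω) (h0 : μH[(n : ℝ) - 1] B = 0) :
    perim (circSymm hn ℓ) (cylSet hn B) = 0 := by
  rw [cast_dim hn] at h0
  have hv : volume B = 0 := vol_ac_haus hn h0
  have hW' : W11locProd (uu ℓ) Ω := by
    have h := half29 hW (1 / 2)
    have e : (fun p : ℝ × Euc (n - 2) => 1 / 2 * (ℓ p / p.1)) = uu ℓ := by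
      funext p
      unfold uu
      rw [div_mul_div_comm, one_mul]
    rwa [e] at h
  unfold perim
  rw [cast_dim hn, ess_eq_bd (circ_meas hn hl)]
  have hR : ∀ p : ℝ × Euc (n - 2), ∃ R > 0, p ∈ Ω → closedBall p R ⊆ Ω := by
    intro p
    by_cases hp : p ∈ Ω
    · obtain ⟨R, hR, h⟩ := Metric.nhds_basis_closedBall.mem_iff.1 (ho.mem_nhds hp)
      exact ⟨R, hR, fun _ => h⟩
    · exact ⟨1, one_pos, fun h => absurd h hp⟩
  choose R hR0 hRΩ using hR
  obtain ⟨t, htΩ, htc, ht⟩ := TopologicalSpace.countable_cover_nhdsWithin (s := Ω) (f := fun p => ball p (R p))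
    (fun p _ => mem_nhdsWithin_of_mem_nhds (ball_mem_nhds p (hR0 p)))
  refine measure_mono_null (t := ⋃ p ∈ t, bd volume (circSymm hn ℓ) ∩ cylSet hn (B ∩ ball p (R p))) ?_
    ((measure_biUnion_null_iff htc).2 fun p hp => local29 hn hl ho hΩ hW' (hRΩ p (htΩ hp)) hB hv)
  rintro x ⟨hxb, hx0, hxB⟩
  obtain ⟨p, hp, hxp⟩ := mem_iUnion₂.1 (ht (hBΩ hxB))
  exact mem_iUnion₂.2 ⟨p, hp, hxb, hx0, hxB, hxp⟩

end P29

/-- **Proposition 6.12.** For an open `Ω ⊆ (0,∞) × ℝ^{n-2}` the following are equivalent: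
(i) `H^{n-1}({x ∈ ∂*F^ℓ ∩ Φ₁₂(Ω×S¹) : ν₁₂∥^{F^ℓ}(x) = 0}) = 0`;
(ii) `ξ^ℓ ∈ W^{1,1}_loc(Ω)` and `ℓ ∈ W^{1,1}_loc(Ω)`;
(iii) `P(F^ℓ; Φ₁₂(B×S¹)) = 0` for every Borel `B ⊆ Ω` with `H^{n-1}(B) = 0`. -/
theorem circular_symmetral_tangential_characterisation
    (n : ℕ) (hn : 2 ≤ n)
    (ℓ : ℝ × Euc (n - 2) → ℝ) (hl_meas : Measurable ℓ)
    (hl_nonneg : ∀ p ∈ (Ioi (0:ℝ)) ×ˢ (univ : Set (Euc (n - 2))), 0 ≤ ℓ p)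
    (hl_le : ∀ᵐ p ∂(volume.restrict ((Ioi (0:ℝ)) ×ˢ (univ : Set (Euc (n - 2))))),
      ℓ p ≤ 2 * Real.pi * p.1)
    (hF_perim : perim (circSymm hn ℓ) univ < ⊤)
    (hF_vol : volume (circSymm hn ℓ) < ⊤)
    (Ω : Set (ℝ × Euc (n - 2))) (hΩ_open : IsOpen Ω) (hΩ_sub : Ω ⊆ (Ioi (0:ℝ)) ×ˢ (univ : Set (Euc (n - 2)))) :
    ((μH[(n : ℝ) - 1] {x : Euc n | x ∈ redBoundary (circSymm hn ℓ) ∩ cylSet hn Ω ∧ nu12par hn (circSymm hn ℓ) x = 0} = 0) ↔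
      (W11locProd (fun p => ℓ p / p.1) Ω ∧ W11locProd ℓ Ω)) ∧
    ((W11locProd (fun p => ℓ p / p.1) Ω ∧ W11locProd ℓ Ω) ↔
      ∀ B : Set (ℝ × Euc (n - 2)), MeasurableSet B → B ⊆ Ω → μH[(n : ℝ) - 1] B = 0 →
        perim (circSymm hn ℓ) (cylSet hn B) = 0) := by
  have hm := circ_meas hn hl_meas
  have h12 := fun h => i_ii hn hl_meas hl_nonneg hl_le hF_perim hF_vol hΩ_open hΩ_sub h
  have h12' := fun h => (⟨W11_divr hΩ_open hΩ_sub (h12 h), h12 h⟩ :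
    W11locProd (fun p => ℓ p / p.1) Ω ∧ W11locProd ℓ Ω)
  have h23 := fun (h : W11locProd (fun p => ℓ p / p.1) Ω) => ii_iii hn hl_meas hΩ_open hΩ_sub h
  have h31 := iii_i hn hm hF_perim hΩ_open
  exact ⟨⟨h12', fun h => h31 (h23 h.1)⟩, ⟨fun h => h23 h.1, fun h => h12' (h31 h)⟩⟩
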